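/- arXiv:1312.5876 — 2 statements merged into one kernel-verified Lean document; each statement's English description precedes it below -/
import Mathlib

section
/- Let X be a complex Banach space and T a continuous linear operator on X. Then T possesses hereditarily hypercyclic subspaces if and only if T is weakly mixing and T possesses a hypercyclic subspace. -/
open Filter Topology

section ClosedCofinite

variable {X : Type*} [NormedAddCommGroup X] [NormedSpace ℂ X]

/-- A closed subspace of finite codimension. -/
def ClosedCofinite (E : Submodule ℂ X) : Prop :=
  IsClosed (E : Set X) ∧ E.CoFG

namespace ClosedCofinite

theorem top : ClosedCofinite (⊤ : Submodule ℂ X) :=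
  ⟨isClosed_univ, Submodule.CoFG.top⟩

theorem inf {E F : Submodule ℂ X} (hE : ClosedCofinite E) (hF : ClosedCofinite F) :
    ClosedCofinite (E ⊓ F) :=
  ⟨hE.1.inter hF.1, hE.2.inf hF.2⟩

theorem iInf_lt {E : ℕ → Submodule ℂ X} (n : ℕ) (hE : ∀ k < n, ClosedCofinite (E k)) :
    ClosedCofinite (⨅ k, ⨅ _ : k < n, E k) := by
  induction n with
  | zero => simpa using top
  | succ n ih =>
    have h : (⨅ k, ⨅ _ : k < n + 1, E k) = (⨅ k, ⨅ _ : k < n, E k) ⊓ E n := by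
      ext x
      simp only [Submodule.mem_iInf, Submodule.mem_inf]
      constructor
      · exact fun h => ⟨fun k hk => h k (by omega), h n (by omega)⟩
      · rintro ⟨h, h'⟩ k hk
        rcases Nat.lt_succ_iff_lt_or_eq.1 hk with hk | rfl
        exacts [h k hk, h']
    rw [h]
    exact (ih fun k hk => hE k (by omega)).inf (hE n (by omega))

theorem comap {E : Submodule ℂ X} (hE : ClosedCofinite E) (A : X →L[ℂ] X) :
    ClosedCofinite (E.comap (A : X →ₗ[ℂ] X)) := by
  refine ⟨hE.1.preimage A.continuous, ?_⟩
  have := hE.2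
  have h := Submodule.CoFG.ker (E.mkQ ∘ₗ (A : X →ₗ[ℂ] X))
  rwa [LinearMap.ker_comp, Submodule.ker_mkQ] at h

theorem ker {Y : Type*} [NormedAddCommGroup Y] [NormedSpace ℂ Y] [FiniteDimensional ℂ Y]
    (φ : X →L[ℂ] Y) : ClosedCofinite (LinearMap.ker (φ : X →ₗ[ℂ] Y)) :=
  ⟨φ.isClosed_ker, Submodule.CoFG.ker _⟩

theorem exists_mem_norm_eq_one {E M : Submodule ℂ X} (hE : ClosedCofinite E)
    (hM : ¬ Module.Finite ℂ M) : ∃ x ∈ M, x ∈ E ∧ ‖x‖ = 1 := by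
  have hne : M ⊓ E ≠ ⊥ := by
    intro h
    exact hM (Module.Finite.iff_fg.2 (hE.2.fg_of_disjoint (disjoint_iff.2 h)))
  obtain ⟨x, hx, hx0⟩ := Submodule.exists_mem_ne_zero_of_ne_bot hne
  have hn : ‖x‖ ≠ 0 := norm_ne_zero_iff.2 hx0
  refine ⟨((‖x‖⁻¹ : ℝ) : ℂ) • x, M.smul_mem _ hx.1, E.smul_mem _ hx.2, ?_⟩
  rw [norm_smul]
  simp [hn]

/-- A dense subspace meets a closed subspace of finite codimension in a dense subset of it. -/
theorem subset_closure_inf {E D : Submodule ℂ X} (hE : ClosedCofinite E)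
    (hD : Dense (D : Set X)) : (E : Set X) ⊆ closure ((D ⊓ E : Submodule ℂ X) : Set X) := by
  obtain ⟨G, hG⟩ := (E.comap D.subtype).exists_isCompl
  have hcofg : (E.comap D.subtype).CoFG := by
    have := hE.2
    have h := Submodule.CoFG.ker (E.mkQ ∘ₗ D.subtype)
    rwa [LinearMap.ker_comp, Submodule.ker_mkQ] at h
  have hGfin : FiniteDimensional ℂ G := .of_fg (hcofg.fg_of_isCompl hG)
  set G' := G.map D.subtype
  have hG'D : G' ≤ D := Submodule.map_subtype_le D G
  set C := (D ⊓ E).topologicalClosure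
  have hCE : C ≤ E := Submodule.topologicalClosure_minimal _ inf_le_right hE.1
  have hclosed := Submodule.isClosed_sup_finiteDimensional C G'
    (Submodule.isClosed_topologicalClosure _)
  have hle : D ≤ C ⊔ G' := by
    intro d hd
    have hmem : (⟨d, hd⟩ : D) ∈ (E.comap D.subtype) ⊔ G := by
      rw [hG.sup_eq_top]; trivial
    obtain ⟨a, ha, b, hb, hab⟩ := Submodule.mem_sup.1 hmem
    refine Submodule.mem_sup.2 ⟨a, ?_, b, ⟨b, hb, rfl⟩, congrArg Subtype.val hab⟩
    exact Submodule.le_topologicalClosure _ ⟨a.2, ha⟩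
  intro x hx
  have hx' : x ∈ C ⊔ G' := by
    have : closure (D : Set X) ⊆ ((C ⊔ G' : Submodule ℂ X) : Set X) :=
      closure_minimal hle hclosed
    exact this (hD x)
  obtain ⟨y, hy, g, hg, rfl⟩ := Submodule.mem_sup.1 hx'
  have hgE : g ∈ E := by
    have h := E.sub_mem hx (hCE hy)
    rwa [add_sub_cancel_left] at h
  exact C.add_mem hy (Submodule.le_topologicalClosure _ ⟨hG'D hg, hgE⟩)

end ClosedCofinite

/-- Mazur's lemma: a finite-dimensional subspace is almost orthogonal to some closed subspace of
finite codimension. -/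
theorem exists_closedCofinite_norm_le (G : Submodule ℂ X) [FiniteDimensional ℂ G] :
    ∃ E : Submodule ℂ X, ClosedCofinite E ∧ ∀ y ∈ G, ∀ v ∈ E, ‖y‖ ≤ 2 * ‖y + v‖ := by
  have hcomp : IsCompact (Metric.sphere (0 : G) 1) := by
    have := FiniteDimensional.proper ℂ G
    exact isCompact_sphere _ _
  obtain ⟨t, htS, htfin, hcover⟩ := hcomp.finite_cover_balls (e := 1 / 2) (by norm_num)
  choose ψ hψ1 hψ2 using fun y : G => exists_dual_vector'' ℂ (y : X)
  have := htfin.to_subtype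
  have : Fintype t := Fintype.ofFinite t
  refine ⟨_, ClosedCofinite.ker (ContinuousLinearMap.pi fun y : t => ψ y), ?_⟩
  intro y hy v hv
  by_cases hy0 : y = 0
  · simp [hy0]
  have hn : 0 < ‖y‖ := norm_pos_iff.2 hy0
  set c : ℂ := ((‖y‖⁻¹ : ℝ) : ℂ)
  have hc : ‖c‖ = ‖y‖⁻¹ := by simp [c]
  have hu : (⟨c • y, G.smul_mem c hy⟩ : G) ∈ Metric.sphere (0 : G) 1 := by
    simp [norm_smul, hc, hn.ne']
  obtain ⟨z, hz, hzy⟩ := Set.mem_iUnion₂.1 (hcover hu)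
  have hz1 : ‖(z : X)‖ = 1 := by simpa using htS hz
  have hdist : ‖c • y - z‖ < 1 / 2 := by
    rw [Metric.mem_ball, dist_eq_norm] at hzy
    exact hzy
  have hv0 : ψ z v = 0 := congrFun (LinearMap.mem_ker.1 hv) ⟨z, hz⟩
  have h1 : (1 : ℝ) ≤ ‖c • (y + v)‖ + 1 / 2 := by
    have e : ψ z z = ψ z (c • (y + v)) - ψ z (c • y - z) := by
      simp [hv0]
    have h2 : ‖ψ z z‖ = 1 := by rw [hψ2]; simp [hz1]
    have h3 : ∀ w, ‖ψ z w‖ ≤ ‖w‖ := fun w => by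
      simpa using (ψ z).le_of_opNorm_le (hψ1 z) w
    calc (1 : ℝ) = ‖ψ z (c • (y + v)) - ψ z (c • y - z)‖ := by rw [← e, h2]
      _ ≤ ‖ψ z (c • (y + v))‖ + ‖ψ z (c • y - z)‖ := norm_sub_le _ _
      _ ≤ _ := add_le_add (h3 _) ((h3 _).trans hdist.le)
  rw [norm_smul, hc] at h1
  have h4 : 1 / 2 ≤ ‖y + v‖ / ‖y‖ := by
    rw [div_eq_inv_mul ‖y + v‖]; linarith
  rw [le_div_iff₀ hn] at h4
  linarith

end ClosedCofinite

section EssentialSpectrum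

open scoped ENNReal NNReal

/-- In a complex Banach algebra, if `b` is the inverse of `a` and `a - μ` is invertible for every
`μ` in the closed unit disc, then the powers of `b` become arbitrarily small. -/
theorem exists_norm_pow_lt_of_forall_isUnit_sub {A : Type*} [NormedRing A] [NormedAlgebra ℂ A]
    [CompleteSpace A] {a b : A} (hab : a * b = 1) (hba : b * a = 1)
    (h : ∀ μ : ℂ, ‖μ‖ ≤ 1 → IsUnit (a - algebraMap ℂ A μ)) {ε : ℝ} (hε : 0 < ε) :
    ∃ n : ℕ, 0 < n ∧ ‖b ^ n‖ < ε := by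
  cases subsingleton_or_nontrivial A with
  | inl hA => exact ⟨1, one_pos, by rw [Subsingleton.elim (b ^ 1) 0, norm_zero]; exact hε⟩
  | inr hA =>
    have hspec : ∀ z ∈ spectrum ℂ b, ‖z‖₊ < 1 := by
      intro z hz
      by_contra! hz1
      have hz1' : 1 ≤ ‖z‖ := hz1
      have hz0 : z ≠ 0 := norm_pos_iff.1 (by linarith)
      have hu := h z⁻¹ (by rw [norm_inv]; exact inv_le_one_of_one_le₀ hz1')
      refine hz ?_
      have hb : IsUnit b := ⟨⟨b, a, hba, hab⟩, rfl⟩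
      have hzu : IsUnit (algebraMap ℂ A z) := (IsUnit.mk0 z hz0).map (algebraMap ℂ A)
      have e : algebraMap ℂ A z - b = algebraMap ℂ A z * (b * (a - algebraMap ℂ A z⁻¹)) := by
        rw [mul_sub, hba, mul_sub, mul_one, ← Algebra.commutes, ← mul_assoc, ← map_mul,
          mul_inv_cancel₀ hz0, map_one, one_mul]
      change IsUnit _
      rw [e]
      exact hzu.mul (hb.mul hu)
    have hrad : spectralRadius ℂ b < (1 : ℝ≥0) :=
      spectrum.spectralRadius_lt_of_forall_lt b hspec
    obtain ⟨r, hr1, hr2⟩ := ENNReal.lt_iff_exists_nnreal_btwn.1 hrad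
    have hr1' : r < 1 := by exact_mod_cast hr2
    have hlim := (spectrum.pow_nnnorm_pow_one_div_tendsto_nhds_spectralRadius b).eventually_lt_const
      hr1
    have hpow : Tendsto (fun n : ℕ => (r : ℝ) ^ n) atTop (𝓝 0) :=
      tendsto_pow_atTop_nhds_zero_of_lt_one r.2 hr1'
    obtain ⟨n, hn1, hn2, hn0⟩ := (hlim.and ((hpow.eventually_lt_const hε).and
      (eventually_gt_atTop 0))).exists
    refine ⟨n, hn0, lt_of_le_of_lt ?_ hn2⟩
    have hn0' : (n : ℝ) ≠ 0 := by exact_mod_cast hn0.ne'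
    have h1 : (‖b ^ n‖₊ : ℝ≥0∞) ≤ (r : ℝ≥0∞) ^ n := by
      have h2 := ENNReal.rpow_le_rpow hn1.le (Nat.cast_nonneg (α := ℝ) n)
      rwa [← ENNReal.rpow_mul, one_div_mul_cancel hn0', ENNReal.rpow_one,
        ENNReal.rpow_natCast] at h2
    exact_mod_cast h1

variable {X : Type*} [NormedAddCommGroup X] [NormedSpace ℂ X]

variable (X) in
/-- The operators with arbitrarily small restrictions to closed subspaces of finite
codimension. -/
def negligibleOperators : Submodule ℂ (X →L[ℂ] X) where
  carrier := {A | ∀ ε : ℝ, 0 < ε → ∃ E, ClosedCofinite E ∧ ∀ x ∈ E, ‖A x‖ ≤ ε * ‖x‖}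
  zero_mem' := fun ε hε => ⟨⊤, ClosedCofinite.top, fun x _ => by simp; positivity⟩
  add_mem' := by
    intro A B hA hB ε hε
    obtain ⟨E, hE, hEA⟩ := hA (ε / 2) (half_pos hε)
    obtain ⟨F, hF, hFB⟩ := hB (ε / 2) (half_pos hε)
    refine ⟨E ⊓ F, hE.inf hF, fun x hx => ?_⟩
    have h := norm_add_le (A x) (B x)
    have h1 := hEA x hx.1
    have h2 := hFB x hx.2
    simp only [add_apply]
    linarith
  smul_mem' := by
    intro c A hA ε hε
    obtain ⟨E, hE, hEA⟩ := hA (ε / (‖c‖ + 1)) (by positivity)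
    refine ⟨E, hE, fun x hx => ?_⟩
    calc ‖(c • A) x‖ = ‖c‖ * ‖A x‖ := norm_smul _ _
      _ ≤ (‖c‖ + 1) * (ε / (‖c‖ + 1) * ‖x‖) := by
        gcongr
        · linarith
        · exact hEA x hx
      _ = ε * ‖x‖ := by field_simp

namespace negligibleOperators

theorem mul_left_mem (A : X →L[ℂ] X) {B : X →L[ℂ] X} (hB : B ∈ negligibleOperators X) :
    A * B ∈ negligibleOperators X := by
  intro ε hε
  obtain ⟨E, hE, hEB⟩ := hB (ε / (‖A‖ + 1)) (by positivity)
  refine ⟨E, hE, fun x hx => ?_⟩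
  calc ‖(A * B) x‖ ≤ ‖A‖ * ‖B x‖ := A.le_opNorm _
    _ ≤ (‖A‖ + 1) * (ε / (‖A‖ + 1) * ‖x‖) := by
      gcongr
      · linarith
      · exact hEB x hx
    _ = ε * ‖x‖ := by field_simp

theorem mul_right_mem {A : X →L[ℂ] X} (B : X →L[ℂ] X) (hA : A ∈ negligibleOperators X) :
    A * B ∈ negligibleOperators X := by
  intro ε hε
  obtain ⟨E, hE, hEA⟩ := hA (ε / (‖B‖ + 1)) (by positivity)
  refine ⟨_, hE.comap B, fun x hx => ?_⟩
  calc ‖(A * B) x‖ ≤ ε / (‖B‖ + 1) * ‖B x‖ := hEA _ hx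
    _ ≤ ε / (‖B‖ + 1) * ((‖B‖ + 1) * ‖x‖) := by
      gcongr
      exact (B.le_opNorm x).trans (by gcongr; linarith)
    _ = ε * ‖x‖ := by field_simp

theorem mem_of_forall_eq_zero {A : X →L[ℂ] X} {E : Submodule ℂ X} (hE : ClosedCofinite E)
    (h : ∀ x ∈ E, A x = 0) : A ∈ negligibleOperators X :=
  fun ε hε => ⟨E, hE, fun x hx => by rw [h x hx, norm_zero]; positivity⟩

theorem isClosed : IsClosed (negligibleOperators X : Set (X →L[ℂ] X)) := by
  refine isClosed_of_closure_subset fun A hA ε hε => ?_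
  obtain ⟨B, hB, hAB⟩ := Metric.mem_closure_iff.1 hA (ε / 2) (half_pos hε)
  obtain ⟨E, hE, hEB⟩ := hB (ε / 2) (half_pos hε)
  refine ⟨E, hE, fun x hx => ?_⟩
  have h1 : ‖(A - B) x‖ ≤ ε / 2 * ‖x‖ :=
    (A - B).le_of_opNorm_le (by rw [← dist_eq_norm]; exact hAB.le) x
  have h2 := hEB x hx
  calc ‖A x‖ = ‖(A - B) x + B x‖ := by simp
    _ ≤ ‖(A - B) x‖ + ‖B x‖ := norm_add_le _ _
    _ ≤ ε * ‖x‖ := by linarith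

instance : IsClosed (negligibleOperators X : Set (X →L[ℂ] X)) := isClosed

end negligibleOperators

variable (X) in
/-- The operators modulo the negligible ones. -/
def OperatorQuotient := (X →L[ℂ] X) ⧸ negligibleOperators X

namespace OperatorQuotient

open negligibleOperators

noncomputable instance : NormedAddCommGroup (OperatorQuotient X) :=
  Submodule.Quotient.normedAddCommGroup (negligibleOperators X)

noncomputable instance : NormedSpace ℂ (OperatorQuotient X) :=
  Submodule.Quotient.normedSpace (negligibleOperators X) ℂ

instance [CompleteSpace X] : CompleteSpace (OperatorQuotient X) :=
  Submodule.Quotient.completeSpace (negligibleOperators X)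

/-- The quotient map. -/
noncomputable def mk : (X →L[ℂ] X) →ₗ[ℂ] OperatorQuotient X := (negligibleOperators X).mkQ

theorem mk_surjective (q : OperatorQuotient X) : ∃ A, mk A = q :=
  Submodule.Quotient.mk_surjective _ q

theorem mk_eq_mk {A B : X →L[ℂ] X} : mk A = mk B ↔ A - B ∈ negligibleOperators X :=
  Submodule.Quotient.eq _

theorem norm_mk_le (A : X →L[ℂ] X) : ‖mk A‖ ≤ ‖A‖ :=
  Submodule.Quotient.norm_mk_le _ A

theorem exists_mk_eq_norm_lt (q : OperatorQuotient X) {ε : ℝ} (hε : 0 < ε) :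
    ∃ A, mk A = q ∧ ‖A‖ < ‖q‖ + ε :=
  Submodule.Quotient.norm_mk_lt q hε

/-- Left multiplication by an operator on the operators modulo the negligible ones. -/
noncomputable def leftMulLinear (A : X →L[ℂ] X) : OperatorQuotient X →ₗ[ℂ] OperatorQuotient X :=
  (negligibleOperators X).liftQ (mk ∘ₗ LinearMap.mulLeft ℂ A) fun _ hB =>
    (Submodule.Quotient.mk_eq_zero _).2 (mul_left_mem A hB)

theorem norm_leftMulLinear_le (A : X →L[ℂ] X) (q : OperatorQuotient X) :
    ‖leftMulLinear A q‖ ≤ ‖A‖ * ‖q‖ := by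
  refine le_of_forall_pos_le_add fun ε hε => ?_
  obtain ⟨B, rfl, hB⟩ := exists_mk_eq_norm_lt q (ε := ε / (‖A‖ + 1)) (by positivity)
  calc ‖leftMulLinear A (mk B)‖ ≤ ‖A * B‖ := norm_mk_le _
    _ ≤ ‖A‖ * ‖B‖ := norm_mul_le _ _
    _ ≤ ‖A‖ * (‖mk B‖ + ε / (‖A‖ + 1)) := by gcongr
    _ = ‖A‖ * ‖mk B‖ + ‖A‖ / (‖A‖ + 1) * ε := by ring
    _ ≤ ‖A‖ * ‖mk B‖ + 1 * ε := by
      gcongr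
      rw [div_le_one (by positivity)]
      linarith
    _ = ‖A‖ * ‖mk B‖ + ε := by ring

/-- Left multiplication by an operator, as a bounded operator. -/
noncomputable def leftMulCLM (A : X →L[ℂ] X) : OperatorQuotient X →L[ℂ] OperatorQuotient X :=
  (leftMulLinear A).mkContinuous ‖A‖ (norm_leftMulLinear_le A)

theorem leftMulCLM_mk (A B : X →L[ℂ] X) : leftMulCLM A (mk B) = mk (A * B) := rfl

theorem clm_ext {Φ Ψ : OperatorQuotient X →L[ℂ] OperatorQuotient X}
    (h : ∀ A, Φ (mk A) = Ψ (mk A)) : Φ = Ψ := by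
  refine ContinuousLinearMap.ext fun q => ?_
  obtain ⟨A, rfl⟩ := mk_surjective q
  exact h A

variable (X) in
/-- Left multiplication, as an algebra homomorphism. -/
noncomputable def leftMul :
    (X →L[ℂ] X) →ₐ[ℂ] (OperatorQuotient X →L[ℂ] OperatorQuotient X) :=
  AlgHom.ofLinearMap
    { toFun := leftMulCLM
      map_add' := fun A B => clm_ext fun C => by
        rw [add_apply, leftMulCLM_mk, leftMulCLM_mk, leftMulCLM_mk, add_mul, map_add]
      map_smul' := fun c A => clm_ext fun C => by
        rw [smul_apply, leftMulCLM_mk, leftMulCLM_mk, smul_mul_assoc, map_smul,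
          RingHom.id_apply] }
    (clm_ext fun C => (leftMulCLM_mk 1 C).trans (by rw [one_mul]; rfl))
    (fun A B => clm_ext fun C => by
      change leftMulCLM (A * B) (mk C) = leftMulCLM A (leftMulCLM B (mk C))
      rw [leftMulCLM_mk, leftMulCLM_mk, leftMulCLM_mk, mul_assoc])

theorem leftMul_mk (A B : X →L[ℂ] X) : leftMul X A (mk B) = mk (A * B) := rfl

theorem leftMul_eq_one {A : X →L[ℂ] X} (hA : A - 1 ∈ negligibleOperators X) :
    leftMul X A = 1 := by
  refine clm_ext fun C => mk_eq_mk.2 ?_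
  have h := mul_right_mem C hA
  rwa [sub_mul, one_mul] at h

end OperatorQuotient

open negligibleOperators OperatorQuotient in
/-- If `T - μ` is invertible modulo negligible operators for every `μ` in the closed unit disc,
then some power of `T` is expanding on a closed subspace of finite codimension. -/
theorem exists_pow_expanding [CompleteSpace X] {T : X →L[ℂ] X}
    (h : ∀ μ : ℂ, ‖μ‖ ≤ 1 → ∃ S : X →L[ℂ] X,
      (T - algebraMap ℂ (X →L[ℂ] X) μ) * S - 1 ∈ negligibleOperators X ∧
      S * (T - algebraMap ℂ (X →L[ℂ] X) μ) - 1 ∈ negligibleOperators X) :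
    ∃ n : ℕ, 0 < n ∧ ∃ E : Submodule ℂ X, ClosedCofinite E ∧ ∀ x ∈ E, 2 * ‖x‖ ≤ ‖(T ^ n) x‖ := by
  have hunit : ∀ μ : ℂ, ‖μ‖ ≤ 1 → IsUnit (leftMul X T - algebraMap ℂ _ μ) := by
    intro μ hμ
    obtain ⟨S, h1, h2⟩ := h μ hμ
    have e : leftMul X T - algebraMap ℂ _ μ = leftMul X (T - algebraMap ℂ (X →L[ℂ] X) μ) := by
      rw [map_sub, AlgHom.commutes]
    rw [e]
    exact ⟨⟨_, leftMul X S, by rw [← map_mul, leftMul_eq_one h1],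
      by rw [← map_mul, leftMul_eq_one h2]⟩, rfl⟩
  obtain ⟨S, h1, h2⟩ := h 0 (by simp)
  rw [map_zero, sub_zero] at h1 h2
  have hTS : leftMul X T * leftMul X S = 1 := by rw [← map_mul, leftMul_eq_one h1]
  have hST : leftMul X S * leftMul X T = 1 := by rw [← map_mul, leftMul_eq_one h2]
  set one : OperatorQuotient X := mk 1
  obtain ⟨n, hn, hlt⟩ := exists_norm_pow_lt_of_forall_isUnit_sub
    (A := OperatorQuotient X →L[ℂ] OperatorQuotient X)
    hTS hST hunit (ε := (1 / 8) / (‖one‖ + 1)) (by positivity)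
  have hSn : ‖mk (S ^ n)‖ < 1 / 8 := by
    have e : mk (S ^ n) =
        (leftMul X S ^ n) one := by
      rw [← map_pow, leftMul_mk, mul_one]
    rw [e]
    calc ‖(leftMul X S ^ n) one‖ ≤ ‖leftMul X S ^ n‖ * ‖one‖ := ContinuousLinearMap.le_opNorm _ _
      _ ≤ (1 / 8) / (‖one‖ + 1) * ‖one‖ := by gcongr
      _ < (1 / 8) / (‖one‖ + 1) * (‖one‖ + 1) := by gcongr; linarith
      _ = 1 / 8 := by field_simp
  obtain ⟨B, hBmk, hB⟩ := exists_mk_eq_norm_lt (mk (S ^ n))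
    (ε := 1 / 8) (by norm_num)
  have hB' : ‖B‖ ≤ 1 / 4 := by linarith
  have hK := mk_eq_mk.1 hBmk
  have hpow : S ^ n * T ^ n - 1 ∈ negligibleOperators X := by
    refine mk_eq_mk.1 ?_
    have hc : leftMul X (S ^ n * T ^ n) = 1 := by
      rw [map_mul, map_pow, map_pow]
      have hcomm : Commute (leftMul X S) (leftMul X T) := hST.trans hTS.symm
      rw [← hcomm.mul_pow, hST, one_pow]
    have e := leftMul_mk (S ^ n * T ^ n) 1
    rw [hc, mul_one] at e
    exact e.symm
  obtain ⟨E, hE, hE'⟩ := mul_right_mem (T ^ n) hK (1 / 4) (by norm_num)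
  obtain ⟨F, hF, hF'⟩ := hpow (1 / 4) (by norm_num)
  refine ⟨n, hn, E ⊓ F, hE.inf hF, fun x hx => ?_⟩
  have a1 := hE' x hx.1
  have a2 := hF' x hx.2
  have a3 : ‖B ((T ^ n) x)‖ ≤ 1 / 4 * ‖(T ^ n) x‖ := B.le_of_opNorm_le hB' _
  have e : x = B ((T ^ n) x) - ((B - S ^ n) * T ^ n) x - (S ^ n * T ^ n - 1) x := by
    simp
  have a4 : ‖x‖ ≤ ‖B ((T ^ n) x)‖ + ‖((B - S ^ n) * T ^ n) x‖ + ‖(S ^ n * T ^ n - 1) x‖ := by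
    calc ‖x‖ = ‖B ((T ^ n) x) - ((B - S ^ n) * T ^ n) x - (S ^ n * T ^ n - 1) x‖ := by rw [← e]
      _ ≤ _ := (norm_sub_le _ _).trans (by gcongr; exact norm_sub_le _ _)
  linarith

end EssentialSpectrum

section Growth

/-- Recursive choice of a sequence whose terms are related to all the previous ones. -/
theorem exists_seq_forall_lt {α : Type*} [Nonempty α] (P : ℕ → α → Prop)
    (r : ℕ → ℕ → α → α → Prop)
    (h : ∀ (n : ℕ) (g : ℕ → α), (∀ m < n, P m (g m)) → ∃ y, P n y ∧ ∀ m < n, r m n (g m) y) :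
    ∃ f : ℕ → α, (∀ n, P n (f n)) ∧ ∀ m n, m < n → r m n (f m) (f n) := by
  classical
  choose! Y hY using h
  let d : α := Classical.arbitrary α
  let f : ℕ → α := WellFounded.fix (wellFounded_lt (α := ℕ))
    fun n rec => Y n fun m => if hm : m < n then rec m hm else d
  have hf : ∀ n, f n = Y n fun m => if m < n then f m else d := by
    intro n
    simp only [f]
    rw [WellFounded.fix_eq]
    simp
  have hP : ∀ n, P n (f n) := by
    intro n
    induction n using Nat.strong_induction_on with
    | _ n ih =>
      rw [hf]
      exact (hY n _ fun m hm => by simpa [hm] using ih m hm).1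
  refine ⟨f, hP, fun m n hmn => ?_⟩
  rw [hf n]
  simpa [hmn] using (hY n (fun m => if m < n then f m else d)
    fun m hm => by simpa [hm] using hP m).2 m hmn

variable {X : Type*} [NormedAddCommGroup X] [NormedSpace ℂ X] [CompleteSpace X]

/-- An operator with dense range that is bounded below on a closed subspace of finite codimension
is invertible modulo negligible operators. -/
theorem exists_inverse_mod_negligibleOperators {A : X →L[ℂ] X} {E : Submodule ℂ X}
    (hE : ClosedCofinite E) {c : ℝ} (hc : 0 < c) (hA : ∀ x ∈ E, c * ‖x‖ ≤ ‖A x‖)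
    (hd : DenseRange A) :
    ∃ S : X →L[ℂ] X, A * S - 1 ∈ negligibleOperators X ∧ S * A - 1 ∈ negligibleOperators X := by
  have hcofg := hE.2
  have hEc : CompleteSpace E := hE.1.completeSpace_coe
  have hanti : AntilipschitzWith (Real.toNNReal c⁻¹) (A ∘L E.subtypeL) := by
    refine ContinuousLinearMap.antilipschitz_of_bound _ fun x => ?_
    rw [Real.coe_toNNReal _ (by positivity), inv_mul_eq_div, le_div_iff₀ hc, mul_comm]
    exact hA x x.2
  have hclosed : IsClosed ((E.map (A : X →ₗ[ℂ] X) : Submodule ℂ X) : Set X) := by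
    have h := hanti.isClosed_range (A ∘L E.subtypeL).uniformContinuous
    convert h using 1
    ext y
    simp
  have hrange := LinearMap.isClosed_range_of_isClosed_map_of_finiteDimensional_quotient hclosed
  have hsurj : Function.Surjective A := by
    intro y
    have : closure (Set.range A) ⊆ ((A : X →ₗ[ℂ] X).range : Set X) := by
      refine closure_minimal ?_ hrange
      rintro _ ⟨x, rfl⟩
      exact ⟨x, rfl⟩
    obtain ⟨x, hx⟩ := this (hd y)
    exact ⟨x, hx⟩
  have hdisj : Disjoint (A : X →ₗ[ℂ] X).ker E := by
    rw [Submodule.disjoint_def]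
    intro x hx hxE
    have h := hA x hxE
    have hx' : A x = 0 := hx
    rw [hx', norm_zero] at h
    exact norm_le_zero_iff.1 (by nlinarith [norm_nonneg x])
  obtain ⟨G, hGclosed, hG⟩ :=
    (Submodule.ClosedComplemented.of_disjoint_of_finiteDimensional_quotient
      hE.1 hdisj).exists_isClosed_isCompl
  have hkfg : (A : X →ₗ[ℂ] X).ker.FG := hcofg.fg_of_disjoint hdisj
  have hGc : ClosedCofinite G := ⟨hGclosed, Submodule.FG.cofg_of_isCompl hG hkfg⟩
  have hGcomp : CompleteSpace G := hGclosed.completeSpace_coe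
  let B : G →L[ℂ] X := A ∘L G.subtypeL
  have hker : B.ker = ⊥ := by
    rw [LinearMap.ker_eq_bot']
    intro g hg
    have h : (g : X) ∈ (A : X →ₗ[ℂ] X).ker := hg
    exact Subtype.ext (Submodule.disjoint_def.1 hG.disjoint _ h g.2)
  have hran : B.range = ⊤ := by
    rw [LinearMap.range_eq_top]
    intro y
    obtain ⟨x, rfl⟩ := hsurj y
    obtain ⟨k, hk, g, hg, rfl⟩ := Submodule.mem_sup.1
      (hG.sup_eq_top ▸ Submodule.mem_top : x ∈ (A : X →ₗ[ℂ] X).ker ⊔ G)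
    have hk' : A k = 0 := hk
    exact ⟨⟨g, hg⟩, by simp [B, hk']⟩
  let e := ContinuousLinearEquiv.ofBijective B hker hran
  have hAS : ∀ y, A (e.symm y : X) = y := fun y =>
    ContinuousLinearEquiv.ofBijective_apply_symm_apply B hker hran y
  have hSA : ∀ g : G, e.symm (A g) = g := fun g =>
    ContinuousLinearEquiv.ofBijective_symm_apply_apply B hker hran g
  refine ⟨G.subtypeL ∘L (e.symm : X →L[ℂ] G), ?_, ?_⟩
  · convert (negligibleOperators X).zero_mem using 1
    ext y
    simp [hAS]
  · refine negligibleOperators.mem_of_forall_eq_zero hGc fun x hx => ?_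
    have h := hSA ⟨x, hx⟩
    simp only [] at h
    simp [h]

/-- If `S` is expanding on a closed subspace of finite codimension, then every
infinite-dimensional closed subspace contains a vector whose orbit tends to infinity. -/
theorem exists_tendsto_norm_pow_atTop {S : X →L[ℂ] X} {E M : Submodule ℂ X}
    (hE : ClosedCofinite E) (hS : ∀ x ∈ E, 2 * ‖x‖ ≤ ‖S x‖) (hMc : IsClosed (M : Set X))
    (hM : ¬ Module.Finite ℂ M) :
    ∃ x ∈ M, Tendsto (fun n => ‖(S ^ n) x‖) atTop atTop := by
  let V : ℕ → Submodule ℂ X := fun n =>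
    ⨅ j, ⨅ _ : j < n, E.comap ((S ^ j : X →L[ℂ] X) : X →ₗ[ℂ] X)
  have hV : ∀ n, ClosedCofinite (V n) := fun n =>
    ClosedCofinite.iInf_lt n fun j _ => hE.comap (S ^ j)
  have hVmem : ∀ {n x}, x ∈ V n → ∀ j < n, (S ^ j) x ∈ E := by
    intro n x hx j hj
    simp only [V, Submodule.mem_iInf] at hx
    exact hx j hj
  have hVS : ∀ n x, (∀ j < n, (S ^ j) x ∈ E) → 2 ^ n * ‖x‖ ≤ ‖(S ^ n) x‖ := by
    intro n x hx
    induction n with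
    | zero => simp
    | succ n ih =>
      have h1 := ih fun j hj => hx j (by omega)
      have h2 := hS _ (hx n (by omega))
      have h3 : (S ^ (n + 1)) x = S ((S ^ n) x) := by rw [pow_succ']; rfl
      rw [h3, pow_succ]
      linarith
  let P : ℕ → X × Submodule ℂ X × Submodule ℂ X → Prop := fun i a =>
    a.1 ∈ M ∧ ‖a.1‖ = 1 ∧ a.1 ∈ a.2.1 ∧ FiniteDimensional ℂ a.2.1 ∧ a.1 ∈ V (2 * i + 2) ∧
      ClosedCofinite a.2.2 ∧ ∀ y ∈ a.2.1, ∀ v ∈ a.2.2, ∀ n < 2 * i + 4,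
        ‖(S ^ n) y‖ ≤ 2 * ‖(S ^ n) (y + v)‖
  obtain ⟨f, hP, hr⟩ := exists_seq_forall_lt P
    (fun _ _ a b => a.2.1 ≤ b.2.1 ∧ b.1 ∈ a.2.2) (by
      intro i g hg
      obtain ⟨e, heM, ⟨heC, heV⟩, he1⟩ := ((ClosedCofinite.iInf_lt i fun m hm =>
        (hg m hm).2.2.2.2.2.1).inf (hV (2 * i + 2))).exists_mem_norm_eq_one hM
      simp only [SetLike.mem_coe, Submodule.mem_iInf] at heC
      have hfin : ∀ m : Fin i, FiniteDimensional ℂ (g m).2.1 := fun m => (hg m m.2).2.2.2.1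
      let F : Submodule ℂ X := (⨆ m : Fin i, (g m).2.1) ⊔ Submodule.span ℂ {e}
      have hF : FiniteDimensional ℂ F := inferInstance
      choose C hC hCF using fun n : ℕ =>
        exists_closedCofinite_norm_le (F.map ((S ^ n : X →L[ℂ] X) : X →ₗ[ℂ] X))
      refine ⟨(e, F, ⨅ n, ⨅ _ : n < 2 * i + 4,
        (C n).comap ((S ^ n : X →L[ℂ] X) : X →ₗ[ℂ] X)), ⟨heM, he1, ?_, hF, heV,
        ClosedCofinite.iInf_lt _ fun n _ => (hC n).comap _, ?_⟩, ?_⟩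
      · exact Submodule.mem_sup_right (Submodule.mem_span_singleton_self e)
      · intro y hy v hv n hn
        simp only [Submodule.mem_iInf] at hv
        rw [map_add]
        exact hCF n _ ⟨y, hy, rfl⟩ _ (hv n hn)
      · intro m hm
        exact ⟨(le_iSup (fun m : Fin i => (g m).2.1) ⟨m, hm⟩).trans le_sup_left, heC m hm⟩)
  set a : ℕ → X := fun i => ((1 / 2 : ℂ) ^ i) • (f i).1
  have hna : ∀ i, ‖a i‖ = (1 / 2) ^ i := fun i => by
    simp [a, norm_smul, (hP i).2.1]
  have hsum : Summable a := by
    refine Summable.of_norm ?_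
    simp only [hna]
    exact summable_geometric_two
  refine ⟨∑' i, a i, tsum_mem hMc fun i => M.smul_mem _ (hP i).1, ?_⟩
  have hle : ∀ n, 2 ≤ n → 2 ^ (n / 2) / 6 ≤ ‖(S ^ n) (∑' i, a i)‖ := by
    intro n hn
    obtain ⟨k, hk⟩ : ∃ k, n / 2 = k + 1 := ⟨n / 2 - 1, by omega⟩
    rw [hk]
    have haF : ∀ j i, j ≤ i → a j ∈ (f i).2.1 := by
      intro j i hji
      refine Submodule.smul_mem _ _ ?_
      rcases hji.eq_or_lt with rfl | h
      · exact (hP j).2.2.1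
      · exact (hr j i h).1 (hP j).2.2.1
    have h1 := (hP k).2.2.2.2.2.2 (∑ i ∈ Finset.range (k + 1), a i)
      (Submodule.sum_mem _ fun j hj => haF j k (by simpa [Nat.lt_succ_iff] using hj))
      (a (k + 1)) (Submodule.smul_mem _ _ (hr k (k + 1) (by omega)).2) n (by omega)
    rw [← Finset.sum_range_succ] at h1
    have h2 := (hP (k + 1)).2.2.2.2.2.2 (∑ i ∈ Finset.range (k + 1 + 1), a i)
      (Submodule.sum_mem _ fun j hj => haF j (k + 1) (by simpa [Nat.lt_succ_iff] using hj))
      (∑' i, a (i + (k + 1 + 1))) (tsum_mem (hP (k + 1)).2.2.2.2.2.1.1 fun i =>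
        Submodule.smul_mem _ _ (hr (k + 1) (i + (k + 1 + 1)) (by omega)).2) n (by omega)
    rw [hsum.sum_add_tsum_nat_add] at h2
    have h3 := hVS n (f (k + 1)).1
      (fun j hj => hVmem (hP (k + 1)).2.2.2.2.1 j (by omega))
    rw [(hP (k + 1)).2.1, mul_one] at h3
    have h4 : ‖(S ^ n) (a (k + 1))‖ = (1 / 2) ^ (k + 1) * ‖(S ^ n) (f (k + 1)).1‖ := by
      simp [a, norm_smul]
    have h5 : ‖(S ^ n) (a (k + 1))‖ ≤ ‖(S ^ n) (∑ i ∈ Finset.range (k + 1 + 1), a i)‖ +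
        ‖(S ^ n) (∑ i ∈ Finset.range (k + 1), a i)‖ := by
      have e : (S ^ n) (a (k + 1)) = (S ^ n) (∑ i ∈ Finset.range (k + 1 + 1), a i) -
          (S ^ n) (∑ i ∈ Finset.range (k + 1), a i) := by
        rw [Finset.sum_range_succ, map_add, add_sub_cancel_left]
      rw [e]
      exact norm_sub_le _ _
    have h6 : (2 : ℝ) ^ (k + 1) ≤ (1 / 2) ^ (k + 1) * ‖(S ^ n) (f (k + 1)).1‖ := by
      calc (2 : ℝ) ^ (k + 1) = (1 / 2) ^ (k + 1) * 2 ^ (2 * (k + 1)) := by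
            rw [pow_mul, ← mul_pow]; norm_num
        _ ≤ (1 / 2) ^ (k + 1) * 2 ^ n := by
          gcongr
          · norm_num
          · omega
        _ ≤ _ := by gcongr
    linarith
  have hlim : Tendsto (fun n : ℕ => (2 : ℝ) ^ (n / 2) / 6) atTop atTop :=
    ((tendsto_pow_atTop_atTop_of_one_lt one_lt_two).comp
      (Nat.tendsto_div_const_atTop two_ne_zero)).atTop_div_const (by norm_num)
  refine tendsto_atTop_mono' _ ?_ hlim
  filter_upwards [eventually_ge_atTop 2] with n hn using hle n hn

end Growth

section ApproximateEigenvalue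

variable {X : Type*} [NormedAddCommGroup X] [NormedSpace ℂ X]

/-- A continuous functional that separates a point from a closed subspace. -/
theorem exists_functional_eq_zero_of_notMem {N : Submodule ℂ X} (hN : IsClosed (N : Set X))
    {x : X} (hx : x ∉ N) : ∃ φ : X →L[ℂ] ℂ, (∀ y ∈ N, φ y = 0) ∧ φ x ≠ 0 := by
  have : IsClosed (N : Set X) := hN
  have hne : N.mkQL x ≠ 0 := fun h => hx ((Submodule.Quotient.mk_eq_zero N).1 h)
  obtain ⟨ψ, -, hψ⟩ := exists_dual_vector ℂ (N.mkQL x) (norm_ne_zero_iff.2 hne)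
  refine ⟨ψ ∘L N.mkQL, fun y hy => ?_, ?_⟩
  · have h : N.mkQL y = 0 := (Submodule.Quotient.mk_eq_zero N).2 hy
    simp [h]
  · rw [ContinuousLinearMap.comp_apply, hψ]
    simpa using hne

theorem denseRange_sub_algebraMap {T : X →L[ℂ] X} {x : X}
    (hx : DenseRange fun n : ℕ => (T ^ n) x) {μ : ℂ} (hμ : ‖μ‖ ≤ 1) :
    DenseRange (T - algebraMap ℂ (X →L[ℂ] X) μ) := by
  set A := T - algebraMap ℂ (X →L[ℂ] X) μ with hA
  by_contra hd
  obtain ⟨z, hz⟩ : ∃ z, z ∉ closure (Set.range A) := by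
    simpa [DenseRange, Dense] using hd
  obtain ⟨φ, hφ, hφz⟩ := exists_functional_eq_zero_of_notMem
    (N := (A : X →ₗ[ℂ] X).range.topologicalClosure)
    (Submodule.isClosed_topologicalClosure _) (x := z) hz
  have hφT : ∀ y, φ (T y) = μ * φ y := by
    intro y
    have h := hφ (A y) (Submodule.le_topologicalClosure _ ⟨y, rfl⟩)
    rw [hA, sub_apply, map_sub, sub_eq_zero] at h
    rw [h, Algebra.algebraMap_eq_smul_one]
    simp
  have hφn : ∀ n : ℕ, φ ((T ^ n) x) = μ ^ n * φ x := by
    intro n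
    induction n with
    | zero => simp
    | succ n ih =>
      rw [pow_succ', pow_succ', mul_assoc, ← ih]
      exact hφT _
  have hbound : ∀ y, ‖φ y‖ ≤ ‖φ x‖ := by
    intro y
    have hcl : IsClosed {y | ‖φ y‖ ≤ ‖φ x‖} := isClosed_le (by fun_prop) continuous_const
    refine hx.induction_on y hcl fun n => ?_
    change ‖φ ((T ^ n) x)‖ ≤ _
    rw [hφn, norm_mul, norm_pow]
    exact mul_le_of_le_one_left (norm_nonneg _) (pow_le_one₀ (norm_nonneg _) hμ)
  have h := hbound (((‖φ x‖ + 1 : ℝ) : ℂ) • ((φ z)⁻¹ • z))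
  simp only [map_smul, smul_eq_mul, inv_mul_cancel₀ hφz, mul_one, Complex.norm_real,
    Real.norm_eq_abs] at h
  linarith [le_abs_self (‖φ x‖ + 1)]

theorem not_tendsto_norm_atTop_of_denseRange [Nontrivial X] {u : ℕ → X} (hu : DenseRange u) :
    ¬ Tendsto (fun n => ‖u n‖) atTop atTop := by
  intro h
  have hev := h.eventually_gt_atTop 1
  rw [← Nat.cofinite_eq_atTop, eventually_cofinite] at hev
  have hfin : (Metric.ball (0 : X) 1 ∩ Set.range u).Finite := by
    refine (hev.image u).subset ?_
    rintro _ ⟨hy, n, rfl⟩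
    exact ⟨n, by simpa using (mem_ball_zero_iff.1 hy).le, rfl⟩
  have hsub := hu.open_subset_closure_inter (Metric.isOpen_ball (x := (0 : X)) (ε := 1))
  rw [hfin.isClosed.closure_eq] at hsub
  have := Module.punctured_nhds_neBot ℂ X 0
  exact infinite_of_mem_nhds (0 : X) (Metric.ball_mem_nhds 0 one_pos) (hfin.subset hsub)

theorem tendsto_norm_pow_atTop_of_pow {T : X →L[ℂ] X} {m : ℕ} (hm : 0 < m) {x : X}
    (h : Tendsto (fun k => ‖((T ^ m) ^ k) x‖) atTop atTop) :
    Tendsto (fun n => ‖(T ^ n) x‖) atTop atTop := by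
  have h1 : Tendsto (fun n : ℕ => ‖((T ^ m) ^ (n / m + 1)) x‖ / (1 + ‖T‖) ^ m) atTop atTop :=
    (h.comp ((tendsto_add_atTop_nat 1).comp
      (Nat.tendsto_div_const_atTop hm.ne'))).atTop_div_const (by positivity)
  refine tendsto_atTop_mono (fun n => ?_) h1
  rw [div_le_iff₀ (by positivity)]
  have hlt := Nat.lt_mul_div_succ n hm
  have hle := Nat.mul_div_le n m
  obtain ⟨j, hj⟩ := Nat.exists_eq_add_of_le hlt.le
  have hjm : j ≤ m := by
    rw [mul_add, mul_one] at hj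
    omega
  rw [← pow_mul, hj, add_comm n j, pow_add]
  calc ‖(T ^ j * T ^ n) x‖ ≤ ‖T ^ j‖ * ‖(T ^ n) x‖ := (T ^ j).le_opNorm _
    _ ≤ (1 + ‖T‖) ^ m * ‖(T ^ n) x‖ := by
      gcongr
      calc ‖T ^ j‖ ≤ (1 + ‖T‖) ^ j := by
            rcases Nat.eq_zero_or_pos j with rfl | hj0
            · rw [pow_zero, pow_zero]
              exact ContinuousLinearMap.norm_id_le
            · exact (norm_pow_le' T hj0).trans (by gcongr; linarith)
        _ ≤ (1 + ‖T‖) ^ m := pow_le_pow_right₀ (by linarith [norm_nonneg T]) hjm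
    _ = _ := mul_comm _ _

/-- An operator with a hypercyclic subspace has an approximate eigenvalue in the closed unit disc
with approximate eigenvectors in every closed subspace of finite codimension. -/
theorem exists_approximate_eigenvalue [CompleteSpace X] {T : X →L[ℂ] X} {M : Submodule ℂ X}
    (hMc : IsClosed (M : Set X)) (hM : ¬ Module.Finite ℂ M)
    (hMd : ∀ x ∈ M, x ≠ 0 → DenseRange fun n : ℕ => (T ^ n) x) :
    ∃ μ : ℂ, ‖μ‖ ≤ 1 ∧ ∀ E : Submodule ℂ X, ClosedCofinite E → ∀ δ : ℝ, 0 < δ →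
      ∃ x ∈ E, ‖x‖ = 1 ∧ ‖T x - μ • x‖ ≤ δ := by
  obtain ⟨x₀, hx₀M, -, hx₀⟩ := ClosedCofinite.top.exists_mem_norm_eq_one hM
  have hx₀0 : x₀ ≠ 0 := norm_ne_zero_iff.1 (by rw [hx₀]; exact one_ne_zero)
  have : Nontrivial X := ⟨⟨x₀, 0, hx₀0⟩⟩
  by_contra! hcon
  obtain ⟨m, hm, E, hE, hEm⟩ := exists_pow_expanding (T := T) (by
    intro μ hμ
    obtain ⟨E, hE, δ, hδ, hEδ⟩ := hcon μ hμ
    refine exists_inverse_mod_negligibleOperators hE hδ (fun x hx => ?_)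
      (denseRange_sub_algebraMap (hMd x₀ hx₀M hx₀0) hμ)
    have e : (T - algebraMap ℂ (X →L[ℂ] X) μ) x = T x - μ • x := by
      simp [Algebra.algebraMap_eq_smul_one]
    rw [e]
    by_cases hx0 : x = 0
    · simp [hx0]
    have hn : 0 < ‖x‖ := norm_pos_iff.2 hx0
    have h := hEδ (((‖x‖⁻¹ : ℝ) : ℂ) • x) (E.smul_mem _ hx) (by
      rw [norm_smul]
      simp [hn.ne'])
    rw [map_smul, smul_comm μ, ← smul_sub, norm_smul, Complex.norm_real, norm_inv, norm_norm,
      inv_mul_eq_div, lt_div_iff₀ hn] at h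
    exact h.le)
  obtain ⟨x, hxM, hx⟩ := exists_tendsto_norm_pow_atTop hE hEm hMc hM
  have hxT := tendsto_norm_pow_atTop_of_pow hm hx
  have hx0 : x ≠ 0 := by
    rintro rfl
    simp only [map_zero, norm_zero] at hxT
    exact not_tendsto_const_atTop _ _ hxT
  exact not_tendsto_norm_atTop_of_denseRange (hMd x hxM hx0) hxT

/-- The approximate eigenvectors may be taken in a given dense subspace, for all powers of the
operator simultaneously. -/
theorem exists_approximate_eigenvector_pow {T : X →L[ℂ] X} {μ : ℂ}
    (hT : ∀ E : Submodule ℂ X, ClosedCofinite E → ∀ δ : ℝ, 0 < δ →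
      ∃ x ∈ E, ‖x‖ = 1 ∧ ‖T x - μ • x‖ ≤ δ) {D E : Submodule ℂ X} (hD : Dense (D : Set X))
    (hE : ClosedCofinite E) (N : ℕ) {δ : ℝ} (hδ : 0 < δ) :
    ∃ x ∈ D, x ∈ E ∧ ‖x‖ = 1 ∧ ∀ n < N, ‖(T ^ n) x - μ ^ n • x‖ ≤ δ := by
  let K : ℕ → ℝ := fun n => ‖∑ i ∈ Finset.range n,
    T ^ i * (algebraMap ℂ (X →L[ℂ] X) μ) ^ (n - 1 - i)‖
  obtain ⟨C, hC0, hC⟩ : ∃ C : ℝ, 0 < C ∧ ∀ n < N, K n ≤ C := by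
    refine ⟨1 + ∑ n ∈ Finset.range N, K n, ?_, fun n hn => ?_⟩
    · have : 0 ≤ ∑ n ∈ Finset.range N, K n := Finset.sum_nonneg fun n _ => norm_nonneg _
      linarith
    · have := Finset.single_le_sum (f := K) (fun n _ => norm_nonneg _) (Finset.mem_range.2 hn)
      linarith
  obtain ⟨x, hxE, hx1, hx⟩ := hT E hE (δ / (4 * C)) (by positivity)
  set A := T - algebraMap ℂ (X →L[ℂ] X) μ
  have hAx : ∀ y, A y = T y - μ • y := fun y => by
    simp [A, Algebra.algebraMap_eq_smul_one]
  obtain ⟨y, hy, hxy⟩ := Metric.mem_closure_iff.1 (hE.subset_closure_inf hD hxE)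
    (min (1 / 2) (δ / (4 * C) / (‖A‖ + 1))) (by positivity)
  rw [dist_eq_norm, lt_min_iff, lt_div_iff₀ (a := ‖x - y‖) (c := ‖A‖ + 1) (by positivity)] at hxy
  have hy2 : 1 / 2 ≤ ‖y‖ := by
    have := norm_sub_norm_le x y
    linarith
  have hAy : ‖A y‖ ≤ δ / (2 * C) := by
    have e : A y = A x - A (x - y) := by rw [map_sub]; abel
    have h1 := A.le_opNorm (x - y)
    have h2 : ‖A‖ * ‖x - y‖ ≤ ‖x - y‖ * (‖A‖ + 1) := by nlinarith [norm_nonneg (x - y)]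
    have h3 : δ / (2 * C) = δ / (4 * C) + δ / (4 * C) := by field_simp; norm_num
    rw [e, h3]
    refine (norm_sub_le _ _).trans (add_le_add ?_ (by linarith))
    rwa [hAx]
  have hn : 0 < ‖y‖ := by linarith
  have hpow : ∀ n < N, ‖(T ^ n) y - μ ^ n • y‖ ≤ δ / 2 := by
    intro n hn
    have hcomm : Commute T (algebraMap ℂ (X →L[ℂ] X) μ) := (Algebra.commutes μ T).symm
    have e : (T ^ n) y - μ ^ n • y = (∑ i ∈ Finset.range n,
        T ^ i * (algebraMap ℂ (X →L[ℂ] X) μ) ^ (n - 1 - i)) (A y) := by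
      have h := congrArg (fun B : X →L[ℂ] X => B y) (hcomm.geom_sum₂_mul n)
      rw [← map_pow, Algebra.algebraMap_eq_smul_one] at h
      simp only [sub_apply] at h
      exact h.symm
    rw [e]
    calc _ ≤ K n * ‖A y‖ := ContinuousLinearMap.le_opNorm _ _
      _ ≤ C * (δ / (2 * C)) := by
        gcongr
        exact hC n hn
      _ = δ / 2 := by field_simp
  refine ⟨((‖y‖⁻¹ : ℝ) : ℂ) • y, D.smul_mem _ hy.1, E.smul_mem _ hy.2, ?_, fun n hn' => ?_⟩
  · rw [norm_smul]
    simp [hn.ne']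
  · rw [map_smul, smul_comm (μ ^ n), ← smul_sub, norm_smul, Complex.norm_real, norm_inv,
      norm_norm, inv_mul_eq_div, div_le_iff₀ hn]
    nlinarith [hpow n hn']

end ApproximateEigenvalue

section WeakMixing

/-- Birkhoff transitivity theorem for sequences of continuous maps. -/
theorem exists_denseRange_of_transitive {Y : Type*} [TopologicalSpace Y] [BaireSpace Y]
    [SecondCountableTopology Y] [Nonempty Y] {g : ℕ → Y → Y} (hg : ∀ n, Continuous (g n))
    (h : ∀ U V : Set Y, IsOpen U → U.Nonempty → IsOpen V → V.Nonempty →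
      ∃ n, ∃ y ∈ U, g n y ∈ V) : ∃ y, DenseRange fun n => g n y := by
  have hb := TopologicalSpace.isBasis_countableBasis Y
  have hd : Dense (⋂ V ∈ TopologicalSpace.countableBasis Y, ⋃ n, g n ⁻¹' V) := by
    refine dense_biInter_of_isOpen (fun V hV => isOpen_iUnion fun n =>
      (hb.isOpen hV).preimage (hg n)) (TopologicalSpace.countable_countableBasis Y) ?_
    intro V hV
    refine dense_iff_inter_open.2 fun U hU hUne => ?_
    obtain ⟨n, y, hy, hyV⟩ := h U V hU hUne (hb.isOpen hV)
      (TopologicalSpace.nonempty_of_mem_countableBasis hV)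
    exact ⟨y, hy, Set.mem_iUnion.2 ⟨n, hyV⟩⟩
  obtain ⟨y, hy⟩ := hd.nonempty
  refine ⟨y, hb.dense_iff.2 fun V hV _ => ?_⟩
  obtain ⟨n, hn⟩ := Set.mem_iUnion.1 (Set.mem_iInter₂.1 hy V hV)
  exact ⟨g n y, hn, n, rfl⟩

theorem frequently_mem_of_denseRange {Y : Type*} [TopologicalSpace Y] [T1Space Y]
    [∀ y : Y, NeBot (𝓝[≠] y)] {u : ℕ → Y} (hu : DenseRange u) {U : Set Y} (hU : IsOpen U)
    (hne : U.Nonempty) : ∃ᶠ n in atTop, u n ∈ U := by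
  rw [frequently_atTop]
  intro N
  obtain ⟨_, hy, ⟨n, rfl⟩, hn⟩ := (Dense.sdiff_finite hu
    ((Finset.range N).finite_toSet.image u)).inter_open_nonempty U hU hne
  refine ⟨n, not_lt.1 fun h => hn ⟨n, ?_, rfl⟩, hy⟩
  simpa using h

variable {X : Type*} [NormedAddCommGroup X] [NormedSpace ℂ X] {T : X →L[ℂ] X}

theorem denseRange_pow (hT : DenseRange T) (i : ℕ) : DenseRange (T ^ i : X →L[ℂ] X) := by
  induction i with
  | zero => simpa using denseRange_id
  | succ i ih =>
    rw [pow_succ]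
    exact ih.comp hT (T ^ i).continuous

/-- For a weakly mixing operator there is a hypercyclic vector whose orbit satisfies the
hypercyclicity criterion. -/
theorem exists_strictMono_of_weaklyMixing [Nontrivial X] {z : X × X}
    (hz : DenseRange fun n : ℕ => ((T ^ n) z.1, (T ^ n) z.2)) :
    ∃ n m : ℕ → ℕ, StrictMono n ∧ (∀ k, 0 < n k) ∧
      Tendsto (fun k => (T ^ n k) z.1) atTop (𝓝 0) ∧
      Tendsto (fun k => (T ^ m k) z.1) atTop (𝓝 0) ∧
      Tendsto (fun k => (T ^ n k) ((T ^ m k) z.1)) atTop (𝓝 z.1) := by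
  obtain ⟨a, c⟩ := z
  simp only at hz ⊢
  have ha : DenseRange fun n : ℕ => (T ^ n) a :=
    Prod.fst_surjective.denseRange.comp hz continuous_fst
  have hc : DenseRange fun n : ℕ => (T ^ n) c :=
    Prod.snd_surjective.denseRange.comp hz continuous_snd
  have hneX : ∀ y : X, NeBot (𝓝[≠] y) := fun y => Module.punctured_nhds_neBot ℂ X y
  have hneXX : ∀ y : X × X, NeBot (𝓝[≠] y) := fun y => Module.punctured_nhds_neBot ℂ (X × X) y
  have hT : DenseRange T := by
    simpa using denseRange_sub_algebraMap ha (μ := 0) (by simp)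
  have key : ∀ j : ℕ, ∃ᶠ n in atTop, 0 < n ∧ ∃ m : ℕ, ‖(T ^ n) a‖ < 1 / (j + 1 : ℝ) ∧
      ‖(T ^ m) a‖ < 1 / (j + 1 : ℝ) ∧ ‖(T ^ n) ((T ^ m) a) - a‖ < 1 / (j + 1 : ℝ) := by
    intro j
    set ε : ℝ := 1 / (j + 1 : ℝ)
    have hε : 0 < ε := by positivity
    obtain ⟨l, hl⟩ := hc.exists_mem_open (Metric.isOpen_ball (x := (0 : X)) (ε := ε / 2))
      ⟨0, Metric.mem_ball_self (half_pos hε)⟩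
    have hl' : ‖(T ^ l) c‖ < ε / 2 := by simpa using hl
    have hac : DenseRange fun n : ℕ => ((T ^ n) a, (T ^ n) ((T ^ l) c)) := by
      have h1 : DenseRange (Prod.map id (T ^ l : X →L[ℂ] X) : X × X → X × X) :=
        denseRange_id.prodMap (denseRange_pow hT l)
      have h2 := h1.comp hz (continuous_id.prodMap (T ^ l).continuous)
      convert h2 using 2 with n
      simp only [Function.comp, Prod.map, id]
      rw [← mul_apply_eq_comp, ← mul_apply_eq_comp, ← pow_add, ← pow_add, add_comm]
    refine ((frequently_mem_of_denseRange hac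
      ((Metric.isOpen_ball (x := (0 : X)) (ε := ε)).prod
        (Metric.isOpen_ball (x := a) (ε := ε / 2)))
      ⟨(0, a), Metric.mem_ball_self hε, Metric.mem_ball_self (half_pos hε)⟩).and_eventually
      (eventually_gt_atTop 0)).mono ?_
    rintro n ⟨⟨hn1, hn2⟩, hn0⟩
    rw [mem_ball_iff_norm] at hn1 hn2
    rw [sub_zero] at hn1
    obtain ⟨m, hm⟩ := ha.exists_mem_open
      (Metric.isOpen_ball (x := (T ^ l) c) (ε := min (ε / 2) (ε / 2 / (‖T ^ n‖ + 1))))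
      ⟨_, Metric.mem_ball_self (by positivity)⟩
    rw [mem_ball_iff_norm, lt_min_iff,
      lt_div_iff₀ (a := ‖(T ^ m) a - (T ^ l) c‖) (c := ‖T ^ n‖ + 1) (by positivity)] at hm
    refine ⟨hn0, m, hn1, ?_, ?_⟩
    · have := norm_sub_norm_le ((T ^ m) a) ((T ^ l) c)
      linarith
    · have e : (T ^ n) ((T ^ m) a) - a =
          (T ^ n) ((T ^ m) a - (T ^ l) c) + ((T ^ n) ((T ^ l) c) - a) := by
        rw [map_sub]; abel
      have h1 := (T ^ n).le_opNorm ((T ^ m) a - (T ^ l) c)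
      have h2 := norm_nonneg ((T ^ m) a - (T ^ l) c)
      rw [e]
      refine (norm_add_le _ _).trans_lt ?_
      nlinarith
  obtain ⟨n, hn, hnP⟩ := extraction_forall_of_frequently key
  choose hn0 m h1 h2 h3 using hnP
  have h0 := tendsto_one_div_add_atTop_nhds_zero_nat (𝕜 := ℝ)
  exact ⟨n, m, hn, hn0, squeeze_zero_norm (fun k => (h1 k).le) h0,
    squeeze_zero_norm (fun k => (h2 k).le) h0,
    tendsto_iff_norm_sub_tendsto_zero.2
      (squeeze_zero (fun k => norm_nonneg _) (fun k => (h3 k).le) h0)⟩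

/-- An operator such that each subsequence of `(T ^ n k)` has a dense orbit is weakly mixing. -/
theorem exists_denseRange_prod_of_forall_subsequence [CompleteSpace X] {n : ℕ → ℕ}
    (hn : ∀ k, 0 < n k)
    (h : ∀ f : ℕ → ℕ, StrictMono f → ∃ x : X, DenseRange fun k : ℕ => (T ^ n (f k)) x) :
    ∃ z : X × X, DenseRange fun n : ℕ => ((T ^ n) z.1, (T ^ n) z.2) := by
  obtain ⟨x₀, hx₀⟩ := h id strictMono_id
  have hT : DenseRange T := by
    refine Dense.mono ?_ hx₀
    rintro _ ⟨k, rfl⟩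
    refine ⟨(T ^ (n k - 1)) x₀, ?_⟩
    rw [← mul_apply_eq_comp, ← pow_succ', Nat.sub_add_cancel (hn k)]
    rfl
  have : TopologicalSpace.SeparableSpace X :=
    ⟨⟨_, Set.countable_range _, hx₀⟩⟩
  have : SecondCountableTopology X := UniformSpace.secondCountable_of_separable X
  have key : ∀ U V : Set X, IsOpen U → U.Nonempty → IsOpen V → V.Nonempty →
      ∀ᶠ k in atTop, ∃ w ∈ U, (T ^ n k) w ∈ V := by
    intro U V hU hUne hV hVne
    by_contra hcon
    rw [not_eventually] at hcon
    obtain ⟨f, hf, hfP⟩ := extraction_of_frequently_atTop hcon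
    obtain ⟨x, hx⟩ := h f hf
    obtain ⟨i, hi⟩ := hx.exists_mem_open hU hUne
    obtain ⟨k, hk⟩ := ((denseRange_pow hT (n (f i))).comp hx
      (T ^ n (f i)).continuous).exists_mem_open hV hVne
    refine hfP k ⟨_, hi, ?_⟩
    simp only [Function.comp] at hk
    rwa [← mul_apply_eq_comp, ← pow_add, add_comm, pow_add, mul_apply_eq_comp]
  refine exists_denseRange_of_transitive (Y := X × X)
    (g := fun n w => ((T ^ n) w.1, (T ^ n) w.2)) (fun n => by fun_prop) ?_
  rintro U V hU ⟨⟨u₁, u₂⟩, hu⟩ hV ⟨⟨v₁, v₂⟩, hv⟩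
  obtain ⟨U₁, U₂, hU₁, hU₂, hu₁, hu₂, hUU⟩ := isOpen_prod_iff.1 hU u₁ u₂ hu
  obtain ⟨V₁, V₂, hV₁, hV₂, hv₁, hv₂, hVV⟩ := isOpen_prod_iff.1 hV v₁ v₂ hv
  obtain ⟨k, ⟨w₁, hw₁, hw₁'⟩, w₂, hw₂, hw₂'⟩ := ((key U₁ V₁ hU₁ ⟨_, hu₁⟩ hV₁ ⟨_, hv₁⟩).and
    (key U₂ V₂ hU₂ ⟨_, hu₂⟩ hV₂ ⟨_, hv₂⟩)).exists
  exact ⟨n k, (w₁, w₂), hUU ⟨hw₁, hw₂⟩, hVV ⟨hw₁', hw₂'⟩⟩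

end WeakMixing

section Stages

variable {X : Type*} [NormedAddCommGroup X] [NormedSpace ℂ X]

/-- A functional vanishing on a subspace and equal to `1` at a unit vector almost orthogonal
to it. -/
theorem exists_functional_eq_one {F E : Submodule ℂ X} (hF : IsClosed (F : Set X))
    (h : ∀ y ∈ F, ∀ v ∈ E, ‖y‖ ≤ 2 * ‖y + v‖) {e : X} (he : e ∈ E) (he1 : ‖e‖ = 1) :
    ∃ φ : X →L[ℂ] ℂ, φ e = 1 ∧ (∀ v, ‖φ v‖ ≤ 3 * ‖v‖) ∧ ∀ y ∈ F, φ y = 0 := by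
  have : IsClosed (F : Set X) := hF
  have hnorm : 1 / 3 ≤ ‖F.mkQL e‖ := by
    refine le_of_forall_pos_le_add fun ε hε => ?_
    obtain ⟨m, hm, hmε⟩ := Submodule.Quotient.norm_mk_lt (F.mkQL e) hε
    have hmF : m - e ∈ F := (Submodule.Quotient.eq F).1 hm
    have h1 := h _ hmF e he
    rw [sub_add_cancel] at h1
    have h2 : ‖e‖ ≤ ‖m‖ + ‖m - e‖ := by
      calc ‖e‖ = ‖m - (m - e)‖ := by rw [sub_sub_cancel]
        _ ≤ _ := norm_sub_le _ _
    linarith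
  have hpos : 0 < ‖F.mkQL e‖ := by linarith
  obtain ⟨ψ, hψ1, hψ⟩ := exists_dual_vector ℂ (F.mkQL e) hpos.ne'
  refine ⟨((‖F.mkQL e‖⁻¹ : ℝ) : ℂ) • (ψ ∘L F.mkQL), ?_, fun v => ?_, fun y hy => ?_⟩
  · rw [smul_apply, ContinuousLinearMap.comp_apply, hψ, smul_eq_mul]
    rw [Complex.ofReal_inv]
    exact inv_mul_cancel₀ (Complex.ofReal_ne_zero.2 hpos.ne')
  · have h1 : ‖ψ (F.mkQL v)‖ ≤ ‖v‖ := by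
      calc ‖ψ (F.mkQL v)‖ ≤ ‖ψ‖ * ‖F.mkQL v‖ := ψ.le_opNorm _
        _ = ‖F.mkQL v‖ := by rw [hψ1, one_mul]
        _ ≤ ‖v‖ := Submodule.Quotient.norm_mk_le F v
    have h2 : ‖F.mkQL e‖⁻¹ ≤ 3 := by
      rw [inv_le_comm₀ hpos (by norm_num)]
      linarith
    rw [smul_apply, ContinuousLinearMap.comp_apply, norm_smul, Complex.norm_real, norm_inv,
      norm_norm]
    gcongr
  · have h0 : F.mkQL y = 0 := (Submodule.Quotient.mk_eq_zero F).2 hy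
    simp [h0]

/-- One stage of the construction of a hypercyclic subspace: a basic vector, its coordinate
functional, the span of the vectors chosen so far, the subspace reserved for the later ones, a
time, and a perturbation. -/
structure Stage (X : Type*) [NormedAddCommGroup X] [NormedSpace ℂ X] where
  vec : X
  functional : X →L[ℂ] ℂ
  head : Submodule ℂ X
  tail : Submodule ℂ X
  time : ℕ
  pert : X

namespace Stage

/-- The requirements on a single stage. -/
structure IsGood (A : ℕ → X →L[ℂ] X) (D : Submodule ℂ X) (y : X) (s : ℕ) (a : Stage X) :
    Prop where
  vec_mem_dense : a.vec ∈ D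
  pert_mem_dense : a.pert ∈ D
  norm_vec : ‖a.vec‖ = 1
  vec_mem : a.vec ∈ a.head
  finite_head : FiniteDimensional ℂ a.head
  closedCofinite_tail : ClosedCofinite a.tail
  norm_le : ∀ x ∈ a.head, ∀ v ∈ a.tail, ‖x‖ ≤ 2 * ‖x + v‖
  functional_tail : ∀ v ∈ a.tail, a.functional v = 0
  functional_vec : a.functional a.vec = 1
  norm_functional_le : ∀ v, ‖a.functional v‖ ≤ 3 * ‖v‖
  norm_apply_vec_le : ‖A a.time a.vec‖ ≤ (1 / 2) ^ (s + 4)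
  norm_pert_le : ‖a.pert‖ ≤ (1 / 2) ^ (s + 4)
  norm_apply_pert_le : ‖A a.time a.pert - y‖ ≤ (1 / 2) ^ (s + 4)

/-- The requirements on the `s`-th stage `b` with respect to an earlier stage `a`. -/
structure Precedes (A : ℕ → X →L[ℂ] X) (ν : ℕ → ℂ) (s : ℕ) (a b : Stage X) : Prop where
  vec_mem_tail : b.vec ∈ a.tail
  head_le : a.head ≤ b.head
  functional_head : ∀ x ∈ a.head, b.functional x = 0
  norm_apply_sub_le : ‖A a.time b.vec - ν a.time • b.vec‖ ≤ (1 / 2) ^ (s + 4)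
  norm_apply_vec_le : ‖A b.time a.vec‖ ≤ (1 / 2) ^ (s + 4)
  norm_apply_pert_le : ‖A b.time a.pert‖ ≤ (1 / 2) ^ (s + 4)
  norm_apply_pert_le' : ‖A a.time b.pert‖ ≤ (1 / 2) ^ (s + 4)

instance : Nonempty (Stage X) := ⟨⟨0, 0, ⊥, ⊥, 0, 0⟩⟩

theorem exists_seq {A : ℕ → X →L[ℂ] X} {ν : ℕ → ℂ} {D : Submodule ℂ X}
    (hAD : ∀ d ∈ D, Tendsto (fun k => A k d) atTop (𝓝 0))
    (hν : ∀ E : Submodule ℂ X, ClosedCofinite E → ∀ (N : ℕ) (δ : ℝ), 0 < δ →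
      ∃ x ∈ D, x ∈ E ∧ ‖x‖ = 1 ∧ ∀ k < N, ‖A k x - ν k • x‖ ≤ δ)
    {y : ℕ → X} {u : ℕ → ℕ → X} (huD : ∀ j k, u j k ∈ D)
    (hu : ∀ j, Tendsto (u j) atTop (𝓝 0))
    (hAu : ∀ j, Tendsto (fun k => A k (u j k)) atTop (𝓝 (y j))) (j : ℕ → ℕ) :
    ∃ f : ℕ → Stage X, (∀ s, (f s).IsGood A D (y (j s)) s) ∧
      ∀ t s, t < s → (f t).Precedes A ν s (f s) := by
  refine exists_seq_forall_lt (fun s (a : Stage X) => a.IsGood A D (y (j s)) s)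
    (fun _ s (a b : Stage X) => a.Precedes A ν s b) fun s g hg => ?_
  have hε : (0 : ℝ) < (1 / 2) ^ (s + 4) := by positivity
  have hfin : ∀ t : Fin s, FiniteDimensional ℂ (g t).head := fun t => (hg t t.2).finite_head
  let G : Submodule ℂ X := ⨆ t : Fin s, (g t).head
  have hGle : ∀ t < s, (g t).head ≤ G := fun t ht =>
    le_iSup (fun t : Fin s => (g t).head) ⟨t, ht⟩
  have hGfin : FiniteDimensional ℂ G := inferInstance
  obtain ⟨C, hC, hGC⟩ := exists_closedCofinite_norm_le G
  obtain ⟨e, heD, ⟨heC, heE⟩, he1, heN⟩ := hν (C ⊓ ⨅ t, ⨅ _ : t < s, (g t).tail)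
    (hC.inf (ClosedCofinite.iInf_lt s fun t ht => (hg t ht).closedCofinite_tail))
    (1 + ∑ t ∈ Finset.range s, (g t).time) _ hε
  simp only [SetLike.mem_coe, Submodule.mem_iInf] at heE
  obtain ⟨φ, hφe, hφ3, hφG⟩ := exists_functional_eq_one G.closed_of_finiteDimensional hGC heC he1
  have hFfin : FiniteDimensional ℂ (G ⊔ Submodule.span ℂ {e} : Submodule ℂ X) := inferInstance
  obtain ⟨E, hE, hFE⟩ := exists_closedCofinite_norm_le (G ⊔ Submodule.span ℂ {e})
  have hsmall : ∀ {v : ℕ → X} {z : X}, Tendsto v atTop (𝓝 z) →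
      ∀ᶠ k in atTop, ‖v k - z‖ ≤ (1 / 2) ^ (s + 4) := fun hv =>
    (tendsto_iff_norm_sub_tendsto_zero.1 hv).eventually_le_const hε
  have hsmall0 : ∀ {v : ℕ → X}, Tendsto v atTop (𝓝 0) →
      ∀ᶠ k in atTop, ‖v k‖ ≤ (1 / 2) ^ (s + 4) := fun hv => by
    simpa using hsmall hv
  have hall : ∀ᶠ k in atTop, ∀ t ∈ Finset.range s, ‖A k (g t).vec‖ ≤ (1 / 2) ^ (s + 4) ∧
      ‖A k (g t).pert‖ ≤ (1 / 2) ^ (s + 4) ∧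
      ‖A (g t).time (u (j s) k)‖ ≤ (1 / 2) ^ (s + 4) := by
    refine (Finset.eventually_all _).2 fun t ht => ?_
    have ht' := Finset.mem_range.1 ht
    refine (hsmall0 (hAD _ (hg t ht').vec_mem_dense)).and
      ((hsmall0 (hAD _ (hg t ht').pert_mem_dense)).and (hsmall0 ?_))
    have h := ((A (g t).time).continuous.tendsto 0).comp (hu (j s))
    rwa [map_zero] at h
  obtain ⟨k, hk1, hk2, hk3, hk⟩ := ((hsmall0 (hAD e heD)).and ((hsmall0 (hu (j s))).and
    ((hsmall (hAu (j s))).and hall))).exists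
  refine ⟨⟨e, φ, G ⊔ Submodule.span ℂ {e}, E ⊓ (φ : X →ₗ[ℂ] ℂ).ker, k, u (j s) k⟩, ?_, ?_⟩
  · exact
      { vec_mem_dense := heD
        pert_mem_dense := huD _ _
        norm_vec := he1
        vec_mem := Submodule.mem_sup_right (Submodule.mem_span_singleton_self e)
        finite_head := hFfin
        closedCofinite_tail := hE.inf (ClosedCofinite.ker φ)
        norm_le := fun x hx v hv => hFE x hx v hv.1
        functional_tail := fun v hv => hv.2
        functional_vec := hφe
        norm_functional_le := hφ3
        norm_apply_vec_le := hk1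
        norm_pert_le := hk2
        norm_apply_pert_le := hk3 }
  · intro t ht
    obtain ⟨h1, h2, h3⟩ := hk t (Finset.mem_range.2 ht)
    have hle := Finset.single_le_sum (f := fun t => (g t).time) (fun _ _ => Nat.zero_le _)
      (Finset.mem_range.2 ht)
    exact
      { vec_mem_tail := heE t ht
        head_le := (hGle t ht).trans le_sup_left
        functional_head := fun x hx => hφG x (hGle t ht hx)
        norm_apply_sub_le := heN _ (by omega)
        norm_apply_vec_le := h1
        norm_apply_pert_le := h2
        norm_apply_pert_le' := h3 }

end Stage

end Stages

section StageSequences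

variable {X : Type*} [NormedAddCommGroup X] [NormedSpace ℂ X]

theorem sum_Ico_one_half_pow_le {s m : ℕ} (hsm : s ≤ m) :
    ∑ t ∈ Finset.Ico (s + 1) (m + 1), (1 / 2 : ℝ) ^ (t + 4) ≤ (1 / 2) ^ (s + 4) := by
  have h : ∑ t ∈ Finset.Ico (s + 1) (m + 1), (1 / 2 : ℝ) ^ (t + 4) =
      (1 / 2) ^ (s + 4) - (1 / 2) ^ (m + 4) := by
    induction m, hsm using Nat.le_induction with
    | base => simp
    | succ m hm ih =>
      rw [Finset.sum_Ico_succ_top (by omega), ih, show m + 1 + 4 = m + 4 + 1 by omega, pow_succ]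
      ring
  rw [h]
  have : (0 : ℝ) < (1 / 2) ^ (m + 4) := by positivity
  linarith

theorem hasSum_one_half_pow (s : ℕ) :
    HasSum (fun r : ℕ => (1 / 2 : ℝ) ^ (r + s + 4)) (2 * (1 / 2) ^ (s + 4)) := by
  have h := hasSum_geometric_two.mul_right ((1 / 2 : ℝ) ^ (s + 4))
  refine h.congr_fun fun r => ?_
  rw [← pow_add, add_assoc]

namespace Stage

/-- The closed linear span of the basic vectors. -/
def closedSpan (f : ℕ → Stage X) : Submodule ℂ X :=
  (Submodule.span ℂ (Set.range fun s => (f s).vec)).topologicalClosure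

/-- The partial sum projections. -/
noncomputable def partialSum (f : ℕ → Stage X) (s : ℕ) : X →L[ℂ] X :=
  ∑ t ∈ Finset.range (s + 1), (f t).functional.smulRight (f t).vec

theorem partialSum_apply (f : ℕ → Stage X) (s : ℕ) (b : X) :
    partialSum f s b = ∑ t ∈ Finset.range (s + 1), (f t).functional b • (f t).vec := by
  simp [partialSum]

variable {A : ℕ → X →L[ℂ] X} {ν : ℕ → ℂ} {D : Submodule ℂ X} {y : ℕ → X} {f : ℕ → Stage X}

theorem functional_vec_eq_zero (hf : ∀ s, (f s).IsGood A D (y s) s)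
    (hr : ∀ t s, t < s → (f t).Precedes A ν s (f s)) {s t : ℕ} (hst : s ≠ t) :
    (f s).functional (f t).vec = 0 := by
  rcases hst.lt_or_gt with h | h
  · exact (hf s).functional_tail _ (hr s t h).vec_mem_tail
  · exact (hr t s h).functional_head _ (hf t).vec_mem

theorem partialSum_vec_of_le (hf : ∀ s, (f s).IsGood A D (y s) s)
    (hr : ∀ t s, t < s → (f t).Precedes A ν s (f s)) {s t : ℕ} (hts : t ≤ s) :
    partialSum f s (f t).vec = (f t).vec := by
  rw [partialSum_apply, Finset.sum_eq_single t]
  · rw [(hf t).functional_vec, one_smul]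
  · intro m _ hm
    rw [functional_vec_eq_zero hf hr hm, zero_smul]
  · intro h
    exact absurd (Finset.mem_range.2 (Nat.lt_succ_of_le hts)) h

theorem partialSum_vec_of_lt (hf : ∀ s, (f s).IsGood A D (y s) s)
    (hr : ∀ t s, t < s → (f t).Precedes A ν s (f s)) {s t : ℕ} (hst : s < t) :
    partialSum f s (f t).vec = 0 := by
  rw [partialSum_apply]
  refine Finset.sum_eq_zero fun m hm => ?_
  have := Finset.mem_range.1 hm
  rw [functional_vec_eq_zero hf hr (by omega), zero_smul]

theorem partialSum_mem_head (hf : ∀ s, (f s).IsGood A D (y s) s)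
    (hr : ∀ t s, t < s → (f t).Precedes A ν s (f s)) (s : ℕ) (b : X) :
    partialSum f s b ∈ (f s).head := by
  rw [partialSum_apply]
  refine Submodule.sum_mem _ fun t ht => Submodule.smul_mem _ _ ?_
  rcases (Nat.lt_succ_iff.1 (Finset.mem_range.1 ht)).eq_or_lt with rfl | h
  · exact (hf t).vec_mem
  · exact (hr t s h).head_le (hf t).vec_mem

theorem sub_partialSum_mem_tail (hf : ∀ s, (f s).IsGood A D (y s) s)
    (hr : ∀ t s, t < s → (f t).Precedes A ν s (f s)) (s : ℕ) {b : X} (hb : b ∈ closedSpan f) :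
    b - partialSum f s b ∈ (f s).tail := by
  have hle : closedSpan f ≤
      (f s).tail.comap ((1 - partialSum f s : X →L[ℂ] X) : X →ₗ[ℂ] X) := by
    refine Submodule.topologicalClosure_minimal _ (Submodule.span_le.2 ?_)
      ((hf s).closedCofinite_tail.comap _).1
    rintro _ ⟨t, rfl⟩
    change (f t).vec - partialSum f s (f t).vec ∈ (f s).tail
    rcases le_or_gt t s with h | h
    · rw [partialSum_vec_of_le hf hr h, sub_self]
      exact zero_mem _
    · rw [partialSum_vec_of_lt hf hr h, sub_zero]
      exact (hr s t h).vec_mem_tail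
  exact hle hb

theorem norm_partialSum_le (hf : ∀ s, (f s).IsGood A D (y s) s)
    (hr : ∀ t s, t < s → (f t).Precedes A ν s (f s)) (s : ℕ) {b : X} (hb : b ∈ closedSpan f) :
    ‖partialSum f s b‖ ≤ 2 * ‖b‖ := by
  have h := (hf s).norm_le _ (partialSum_mem_head hf hr s b) _ (sub_partialSum_mem_tail hf hr s hb)
  rwa [add_sub_cancel] at h

theorem tendsto_partialSum (hf : ∀ s, (f s).IsGood A D (y s) s)
    (hr : ∀ t s, t < s → (f t).Precedes A ν s (f s)) {b : X} (hb : b ∈ closedSpan f) :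
    Tendsto (fun s => partialSum f s b) atTop (𝓝 b) := by
  have hspan : ∀ x ∈ Submodule.span ℂ (Set.range fun s => (f s).vec),
      ∀ᶠ s in atTop, partialSum f s x = x := by
    intro x hx
    induction hx using Submodule.span_induction with
    | mem x hx =>
      obtain ⟨t, rfl⟩ := hx
      filter_upwards [eventually_ge_atTop t] with s hs using partialSum_vec_of_le hf hr hs
    | zero => simp
    | add x z _ _ hx hz =>
      filter_upwards [hx, hz] with s h1 h2
      rw [map_add, h1, h2]
    | smul c x _ hx =>
      filter_upwards [hx] with s h1
      rw [map_smul, h1]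
  rw [Metric.tendsto_atTop']
  intro ε hε
  obtain ⟨x, hx, hbx⟩ := Metric.mem_closure_iff.1 hb (ε / 3) (by positivity)
  rw [dist_eq_norm] at hbx
  obtain ⟨N, hN⟩ := eventually_atTop.1 (hspan x hx)
  refine ⟨N, fun s hs => ?_⟩
  have h1 := norm_partialSum_le hf hr s
    ((closedSpan f).sub_mem hb (Submodule.le_topologicalClosure _ hx))
  have e : partialSum f s b - b = partialSum f s (b - x) - (b - x) := by
    rw [map_sub, hN s hs.le]
    abel
  rw [dist_eq_norm, e]
  have h2 := norm_sub_le (partialSum f s (b - x)) (b - x)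
  linarith

theorem norm_apply_sub_partialSum_le (hf : ∀ s, (f s).IsGood A D (y s) s)
    (hr : ∀ t s, t < s → (f t).Precedes A ν s (f s)) (s : ℕ) {b : X} (hb : b ∈ closedSpan f) :
    ‖A (f s).time (b - partialSum f s b) - ν (f s).time • (b - partialSum f s b)‖ ≤
      3 * ‖b‖ * (1 / 2) ^ (s + 4) := by
  have hlim : Tendsto (fun m => A (f s).time (partialSum f m b - partialSum f s b) -
      ν (f s).time • (partialSum f m b - partialSum f s b)) atTop
      (𝓝 (A (f s).time (b - partialSum f s b) - ν (f s).time • (b - partialSum f s b))) := by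
    have h := (tendsto_partialSum hf hr hb).sub_const (partialSum f s b)
    exact (((A (f s).time).continuous.tendsto _).comp h).sub (h.const_smul _)
  refine le_of_tendsto hlim.norm ?_
  filter_upwards [eventually_ge_atTop s] with m hm
  have e : partialSum f m b - partialSum f s b =
      ∑ t ∈ Finset.Ico (s + 1) (m + 1), (f t).functional b • (f t).vec := by
    rw [partialSum_apply, partialSum_apply, Finset.sum_Ico_eq_sub _ (by omega)]
  rw [e, map_sum, Finset.smul_sum, ← Finset.sum_sub_distrib]
  calc _ ≤ ∑ t ∈ Finset.Ico (s + 1) (m + 1), 3 * ‖b‖ * (1 / 2) ^ (t + 4) := by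
        refine norm_sum_le_of_le _ fun t ht => ?_
        rw [map_smul, smul_comm (ν (f s).time), ← smul_sub, norm_smul]
        gcongr
        · exact (hf t).norm_functional_le b
        · exact (hr s t (Finset.mem_Ico.1 ht).1).norm_apply_sub_le
    _ = 3 * ‖b‖ * ∑ t ∈ Finset.Ico (s + 1) (m + 1), (1 / 2) ^ (t + 4) := by
      rw [Finset.mul_sum]
    _ ≤ 3 * ‖b‖ * (1 / 2) ^ (s + 4) := by
      gcongr
      exact sum_Ico_one_half_pow_le hm

theorem tendsto_nat_mul_one_half_pow (c : ℝ) :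
    Tendsto (fun s : ℕ => c * ((s + 1) * (1 / 2 : ℝ) ^ (s + 4))) atTop (𝓝 0) := by
  have h1 := tendsto_self_mul_const_pow_of_lt_one (r := (1 / 2 : ℝ)) (by norm_num) (by norm_num)
  have h2 := tendsto_pow_atTop_nhds_zero_of_lt_one (r := (1 / 2 : ℝ)) (by norm_num) (by norm_num)
  have h3 := (h1.add h2).const_mul (c * (1 / 2) ^ 4)
  rw [add_zero, mul_zero] at h3
  refine h3.congr fun s => ?_
  rw [pow_add]
  ring

theorem tendsto_apply_time (hf : ∀ s, (f s).IsGood A D (y s) s)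
    (hr : ∀ t s, t < s → (f t).Precedes A ν s (f s)) (hν : ∀ k, ‖ν k‖ ≤ 1) {b : X}
    (hb : b ∈ closedSpan f) : Tendsto (fun s => A (f s).time b) atTop (𝓝 0) := by
  have hhead : ∀ s, ‖A (f s).time (partialSum f s b)‖ ≤
      3 * ‖b‖ * ((s + 1) * (1 / 2) ^ (s + 4)) := by
    intro s
    rw [partialSum_apply, map_sum]
    calc _ ≤ ∑ t ∈ Finset.range (s + 1), 3 * ‖b‖ * (1 / 2 : ℝ) ^ (s + 4) := by
          refine norm_sum_le_of_le _ fun t ht => ?_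
          rw [map_smul, norm_smul]
          gcongr
          · exact (hf t).norm_functional_le b
          · rcases (Nat.lt_succ_iff.1 (Finset.mem_range.1 ht)).eq_or_lt with rfl | h
            · exact (hf t).norm_apply_vec_le
            · exact (hr t s h).norm_apply_vec_le
      _ = _ := by
        rw [Finset.sum_const, Finset.card_range, nsmul_eq_mul]
        push_cast
        ring
  have hlim : Tendsto (fun s : ℕ => 6 * ‖b‖ * ((s + 1) * (1 / 2 : ℝ) ^ (s + 4)) +
      ‖partialSum f s b - b‖) atTop (𝓝 0) := by
    simpa using (tendsto_nat_mul_one_half_pow (6 * ‖b‖)).add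
      (tendsto_iff_norm_sub_tendsto_zero.1 (tendsto_partialSum hf hr hb))
  refine squeeze_zero_norm (fun s => ?_) hlim
  have e : A (f s).time b = A (f s).time (partialSum f s b) +
      (A (f s).time (b - partialSum f s b) - ν (f s).time • (b - partialSum f s b)) +
      ν (f s).time • (b - partialSum f s b) := by
    rw [map_sub]
    abel
  have h1 := norm_apply_sub_partialSum_le hf hr s hb
  have h2 : ‖ν (f s).time • (b - partialSum f s b)‖ ≤ ‖partialSum f s b - b‖ := by
    rw [norm_smul, norm_sub_rev]
    exact mul_le_of_le_one_left (norm_nonneg _) (hν _)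
  have h3 : 3 * ‖b‖ * (1 / 2 : ℝ) ^ (s + 4) ≤ 3 * ‖b‖ * ((s + 1) * (1 / 2) ^ (s + 4)) := by
    gcongr
    refine le_mul_of_one_le_left (by positivity) ?_
    have : (0 : ℝ) ≤ s := Nat.cast_nonneg s
    linarith
  rw [e]
  refine (norm_add₃_le).trans ?_
  linarith [hhead s]

theorem exists_functional_ne_zero (hf : ∀ s, (f s).IsGood A D (y s) s)
    (hr : ∀ t s, t < s → (f t).Precedes A ν s (f s)) {b : X} (hb : b ∈ closedSpan f)
    (hb0 : b ≠ 0) : ∃ s, (f s).functional b ≠ 0 := by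
  by_contra! h
  refine hb0 (tendsto_nhds_unique (tendsto_partialSum hf hr hb) ?_)
  simp [partialSum_apply, h]

end Stage

end StageSequences

section Perturbation

variable {X : Type*} [NormedAddCommGroup X] [NormedSpace ℂ X]

namespace Stage

/-- The perturbation sending the vectors with nonzero `i s`-th coordinate to vectors whose image
at the time `s` is controlled. -/
noncomputable def perturbation (f : ℕ → Stage X) (i : ℕ → ℕ) : X →L[ℂ] X :=
  ∑' s, (f (i s)).functional.smulRight (f s).pert

variable {A : ℕ → X →L[ℂ] X} {ν : ℕ → ℂ} {D : Submodule ℂ X} {y : ℕ → X} {f : ℕ → Stage X}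

theorem norm_smulRight_functional_pert_le (hf : ∀ s, (f s).IsGood A D (y s) s) (i : ℕ → ℕ)
    (s : ℕ) : ‖(f (i s)).functional.smulRight (f s).pert‖ ≤ 3 * (1 / 2) ^ (s + 0 + 4) := by
  rw [ContinuousLinearMap.norm_smulRight_apply]
  gcongr
  · exact ContinuousLinearMap.opNorm_le_bound _ (by norm_num) (hf (i s)).norm_functional_le
  · exact (hf s).norm_pert_le

theorem summable_perturbation [CompleteSpace X] (hf : ∀ s, (f s).IsGood A D (y s) s) (i : ℕ → ℕ) :
    Summable fun s => (f (i s)).functional.smulRight (f s).pert :=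
  Summable.of_norm_bounded ((hasSum_one_half_pow 0).summable.mul_left 3)
    (norm_smulRight_functional_pert_le hf i)

theorem norm_perturbation_le (hf : ∀ s, (f s).IsGood A D (y s) s) (i : ℕ → ℕ) :
    ‖perturbation f i‖ ≤ 3 / 8 := by
  have h := tsum_of_norm_bounded ((hasSum_one_half_pow 0).mul_left 3)
    (norm_smulRight_functional_pert_le hf i)
  refine h.trans (by norm_num)

theorem hasSum_perturbation [CompleteSpace X] (hf : ∀ s, (f s).IsGood A D (y s) s) (i : ℕ → ℕ)
    (B : X →L[ℂ] X) (b : X) :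
    HasSum (fun s => (f (i s)).functional b • B (f s).pert) (B (perturbation f i b)) := by
  have h := (summable_perturbation hf i).hasSum.mapL (ContinuousLinearMap.apply ℂ X b)
  have h2 := h.mapL B
  simpa [perturbation] using h2

theorem antilipschitzWith_one_add_perturbation [CompleteSpace X]
    (hf : ∀ s, (f s).IsGood A D (y s) s) (i : ℕ → ℕ) : AntilipschitzWith 2 ⇑(1 + perturbation f i) := by
  refine AddMonoidHomClass.antilipschitz_of_bound _ fun b => ?_
  have h1 : ‖perturbation f i b‖ ≤ 3 / 8 * ‖b‖ :=
    (perturbation f i).le_of_opNorm_le (norm_perturbation_le hf i) b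
  have h2 : ‖b‖ ≤ ‖b + perturbation f i b‖ + ‖perturbation f i b‖ := by
    simpa using norm_sub_le (b + perturbation f i b) (perturbation f i b)
  change ‖b‖ ≤ 2 * ‖b + perturbation f i b‖
  linarith [norm_nonneg b]

theorem norm_apply_perturbation_sub_le [CompleteSpace X] (hf : ∀ s, (f s).IsGood A D (y s) s)
    (hr : ∀ t s, t < s → (f t).Precedes A ν s (f s)) (i : ℕ → ℕ) (s : ℕ) (b : X) :
    ‖A (f s).time (perturbation f i b) - (f (i s)).functional b • y s‖ ≤
      6 * ‖b‖ * ((s + 1) * (1 / 2) ^ (s + 4)) := by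
  have hs := hasSum_perturbation hf i (A (f s).time) b
  have hsum := hs.summable.sum_add_tsum_nat_add (s + 1)
  rw [hs.tsum_eq, Finset.sum_range_succ] at hsum
  have h1 : ‖∑ t ∈ Finset.range s, (f (i t)).functional b • A (f s).time (f t).pert‖ ≤
      s * (3 * ‖b‖ * (1 / 2) ^ (s + 4)) := by
    calc _ ≤ ∑ t ∈ Finset.range s, 3 * ‖b‖ * (1 / 2 : ℝ) ^ (s + 4) := by
          refine norm_sum_le_of_le _ fun t ht => ?_
          rw [norm_smul]
          gcongr
          · exact (hf (i t)).norm_functional_le b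
          · exact (hr t s (Finset.mem_range.1 ht)).norm_apply_pert_le
      _ = _ := by rw [Finset.sum_const, Finset.card_range, nsmul_eq_mul]
  have h2 : ‖(f (i s)).functional b • (A (f s).time (f s).pert - y s)‖ ≤
      3 * ‖b‖ * (1 / 2) ^ (s + 4) := by
    rw [norm_smul]
    gcongr
    · exact (hf (i s)).norm_functional_le b
    · exact (hf s).norm_apply_pert_le
  have h3 : ‖∑' r, (f (i (r + (s + 1)))).functional b • A (f s).time (f (r + (s + 1))).pert‖ ≤
      3 * ‖b‖ * (2 * (1 / 2) ^ (s + 1 + 4)) := by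
    refine tsum_of_norm_bounded ((hasSum_one_half_pow (s + 1)).mul_left (3 * ‖b‖)) fun r => ?_
    rw [norm_smul]
    gcongr
    · exact (hf _).norm_functional_le b
    · exact (hr s _ (by omega)).norm_apply_pert_le'
  have e : A (f s).time (perturbation f i b) - (f (i s)).functional b • y s =
      (∑ t ∈ Finset.range s, (f (i t)).functional b • A (f s).time (f t).pert) +
      (f (i s)).functional b • (A (f s).time (f s).pert - y s) +
      ∑' r, (f (i (r + (s + 1)))).functional b • A (f s).time (f (r + (s + 1))).pert := by
    rw [← hsum, smul_sub]
    abel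
  rw [e]
  refine (norm_add₃_le).trans ?_
  have h4 : (0 : ℝ) ≤ ‖b‖ * (1 / 2 : ℝ) ^ (s + 4) := by positivity
  have h5 : (0 : ℝ) ≤ s * (‖b‖ * (1 / 2 : ℝ) ^ (s + 4)) := by positivity
  rw [show s + 1 + 4 = s + 4 + 1 by omega, pow_succ] at h3
  linarith

theorem tendsto_apply_time_one_add_perturbation [CompleteSpace X]
    (hf : ∀ s, (f s).IsGood A D (y s) s)
    (hr : ∀ t s, t < s → (f t).Precedes A ν s (f s)) (hν : ∀ k, ‖ν k‖ ≤ 1) (i : ℕ → ℕ) {b : X}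
    (hb : b ∈ closedSpan f) :
    Tendsto (fun s => A (f s).time ((1 + perturbation f i) b) - (f (i s)).functional b • y s)
      atTop (𝓝 0) := by
  have h := (tendsto_apply_time hf hr hν hb).add (squeeze_zero_norm
    (fun s => norm_apply_perturbation_sub_le hf hr i s b) (tendsto_nat_mul_one_half_pow _))
  rw [add_zero] at h
  refine h.congr fun s => ?_
  rw [add_apply, one_apply_eq_self, map_add]
  abel

theorem linearIndependent_vec (hf : ∀ s, (f s).IsGood A D (y s) s)
    (hr : ∀ t s, t < s → (f t).Precedes A ν s (f s)) :
    LinearIndependent ℂ fun s => (f s).vec := by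
  rw [linearIndependent_iff']
  intro S g hg s hs
  have h := congrArg (f s).functional hg
  rw [map_sum, map_zero, Finset.sum_eq_single s] at h
  · rwa [map_smul, (hf s).functional_vec, smul_eq_mul, mul_one] at h
  · intro t _ ht
    rw [map_smul, functional_vec_eq_zero hf hr ht.symm, smul_zero]
  · exact fun h => absurd hs h

theorem not_finite_closedSpan (hf : ∀ s, (f s).IsGood A D (y s) s)
    (hr : ∀ t s, t < s → (f t).Precedes A ν s (f s)) :
    ¬ Module.Finite ℂ (closedSpan f) := by
  intro h
  let e : ℕ → closedSpan f := fun s =>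
    ⟨(f s).vec, Submodule.le_topologicalClosure _ (Submodule.subset_span ⟨s, rfl⟩)⟩
  have he : LinearIndependent ℂ e :=
    LinearIndependent.of_comp (closedSpan f).subtype (linearIndependent_vec hf hr)
  exact not_finite_iff_infinite.2 inferInstance he.finite

end Stage

/-- A criterion for the existence of a hypercyclic subspace for a sequence of operators. -/
theorem exists_hypercyclic_subspace [CompleteSpace X] {A : ℕ → X →L[ℂ] X} {ν : ℕ → ℂ}
    (hν1 : ∀ k, ‖ν k‖ ≤ 1) {D : Submodule ℂ X}
    (hAD : ∀ d ∈ D, Tendsto (fun k => A k d) atTop (𝓝 0))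
    (hν : ∀ E : Submodule ℂ X, ClosedCofinite E → ∀ (N : ℕ) (δ : ℝ), 0 < δ →
      ∃ x ∈ D, x ∈ E ∧ ‖x‖ = 1 ∧ ∀ k < N, ‖A k x - ν k • x‖ ≤ δ)
    {y : ℕ → X} (hy : DenseRange y) {u : ℕ → ℕ → X} (huD : ∀ j k, u j k ∈ D)
    (hu : ∀ j, Tendsto (u j) atTop (𝓝 0))
    (hAu : ∀ j, Tendsto (fun k => A k (u j k)) atTop (𝓝 (y j))) :
    ∃ M : Submodule ℂ X, IsClosed (M : Set X) ∧ ¬ Module.Finite ℂ ↥M ∧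
      ∀ x ∈ M, x ≠ 0 → DenseRange fun k => A k x := by
  let i : ℕ → ℕ := fun s => s.unpair.1
  let j : ℕ → ℕ := fun s => s.unpair.2.unpair.1
  obtain ⟨f, hf, hr⟩ := Stage.exists_seq hAD hν huD hu hAu j
  have hV := Stage.antilipschitzWith_one_add_perturbation hf i
  have hVc := hV.isClosedEmbedding (1 + Stage.perturbation f i).uniformContinuous
  refine ⟨(Stage.closedSpan f).map ((1 + Stage.perturbation f i : X →L[ℂ] X) : X →ₗ[ℂ] X), ?_, ?_,
    ?_⟩
  · exact hVc.isClosedMap _ (Submodule.isClosed_topologicalClosure _)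
  · intro h
    exact Stage.not_finite_closedSpan hf hr
      (Module.Finite.equiv (Submodule.equivMapOfInjective _ hV.injective _).symm)
  · rintro _ ⟨b, hb, rfl⟩ hx
    have hb0 : b ≠ 0 := by
      rintro rfl
      exact hx (map_zero _)
    obtain ⟨t, ht⟩ := Stage.exists_functional_ne_zero hf hr hb hb0
    have hlim := Stage.tendsto_apply_time_one_add_perturbation hf hr hν1 i hb
    have hcy : DenseRange fun q => (f t).functional b • y q :=
      (Homeomorph.smulOfNeZero _ ht).surjective.denseRange.comp hy
        (Homeomorph.smulOfNeZero _ ht).continuous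
    refine Metric.dense_iff.2 fun z ε hε => ?_
    obtain ⟨_, hq, q, rfl⟩ := Metric.dense_iff.1 hcy z (ε / 2) (by positivity)
    obtain ⟨N, hN⟩ := Metric.tendsto_atTop.1 hlim (ε / 2) (by positivity)
    have hs := hN (Nat.pair t (Nat.pair q N))
      ((Nat.right_le_pair q N).trans (Nat.right_le_pair t _))
    simp only [i, j, Nat.unpair_pair, dist_zero_right] at hs
    refine ⟨_, ?_, (f (Nat.pair t (Nat.pair q N))).time, rfl⟩
    rw [Metric.mem_ball] at hq ⊢
    refine (dist_triangle _ _ _).trans_lt ((add_lt_add ?_ hq).trans_eq (add_halves ε))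
    rw [dist_eq_norm]
    exact hs

end Perturbation

theorem exists_hypercyclic_subspace_along {X : Type*} [NormedAddCommGroup X] [NormedSpace ℂ X]
    [CompleteSpace X] {T : X →L[ℂ] X} {x : X} (hx : DenseRange fun n => (T ^ n) x)
    {n m : ℕ → ℕ} (hn : StrictMono n) (hn0 : Tendsto (fun k => (T ^ n k) x) atTop (𝓝 0))
    (hm0 : Tendsto (fun k => (T ^ m k) x) atTop (𝓝 0))
    (hnm : Tendsto (fun k => (T ^ n k) ((T ^ m k) x)) atTop (𝓝 x)) {μ : ℂ} (hμ : ‖μ‖ ≤ 1)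
    (hT : ∀ E : Submodule ℂ X, ClosedCofinite E → ∀ δ : ℝ, 0 < δ →
      ∃ x ∈ E, ‖x‖ = 1 ∧ ‖T x - μ • x‖ ≤ δ) :
    ∃ M : Submodule ℂ X, IsClosed (M : Set X) ∧ ¬ Module.Finite ℂ ↥M ∧
      ∀ x ∈ M, x ≠ 0 → DenseRange fun k => (T ^ n k) x := by
  have hcomm : ∀ (a b : ℕ) (v : X), (T ^ a) ((T ^ b) v) = (T ^ b) ((T ^ a) v) := fun a b v => by
    rw [← mul_apply_eq_comp, ← mul_apply_eq_comp, ← pow_add, ← pow_add,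
      add_comm]
  have hcont : ∀ j : ℕ, Tendsto (T ^ j) (𝓝 0) (𝓝 0) := fun j => by
    simpa using (T ^ j).continuous.tendsto 0
  refine exists_hypercyclic_subspace (A := fun k => T ^ n k) (ν := fun k => μ ^ n k)
    (D := Submodule.span ℂ (Set.range fun j => (T ^ j) x)) (y := fun j => (T ^ j) x)
    (u := fun j k => (T ^ j) ((T ^ m k) x)) ?_ ?_ ?_ hx ?_ ?_ ?_
  · intro k
    rw [norm_pow]
    exact pow_le_one₀ (norm_nonneg _) hμ
  · intro d hd
    induction hd using Submodule.span_induction with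
    | mem d hd =>
      obtain ⟨j, rfl⟩ := hd
      exact ((hcont j).comp hn0).congr fun k => hcomm _ _ _
    | zero => simp
    | add a b _ _ ha hb => simpa using ha.add hb
    | smul c a _ ha => simpa using ha.const_smul c
  · intro E hE N δ hδ
    obtain ⟨v, hvD, hvE, hv1, hv⟩ := exists_approximate_eigenvector_pow hT
      (hx.mono Submodule.subset_span) hE (n N) hδ
    exact ⟨v, hvD, hvE, hv1, fun k hk => hv _ (hn hk)⟩
  · intro j k
    rw [← mul_apply_eq_comp, ← pow_add]
    exact Submodule.subset_span ⟨_, rfl⟩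
  · exact fun j => (hcont j).comp hm0
  · exact fun j => (((T ^ j).continuous.tendsto x).comp hnm).congr fun k => hcomm _ _ _

/-- **Theorem (complex Banach spaces).** Let `X` be a complex Banach space and `T` a continuous
linear operator on `X`. Then `T` possesses hereditarily hypercyclic subspaces if and only if
`T` is weakly mixing and `T` possesses a hypercyclic subspace. -/
theorem hereditarily_hypercyclic_subspaces_iff_weaklyMixing_and_hypercyclic_subspace
    {X : Type*} [NormedAddCommGroup X] [NormedSpace ℂ X] [CompleteSpace X]
    (T : X →L[ℂ] X) :
    -- (1) T possesses hereditarily hypercyclic subspaces: there is an increasing sequence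
    -- (n k) of positive integers such that along every subsequence (n (f k)) the sequence
    -- (T ^ (n (f k))) possesses a hypercyclic subspace
    (∃ n : ℕ → ℕ, StrictMono n ∧ (∀ k, 0 < n k) ∧
      ∀ f : ℕ → ℕ, StrictMono f →
        ∃ M : Submodule ℂ X, IsClosed (M : Set X) ∧ ¬ Module.Finite ℂ ↥M ∧
          ∀ x ∈ M, x ≠ 0 → DenseRange fun k : ℕ => (T ^ (n (f k))) x) ↔
    -- (2) T is weakly mixing and T possesses a hypercyclic subspace
    ((∃ z : X × X, DenseRange fun n : ℕ => ((T ^ n) z.1, (T ^ n) z.2)) ∧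
      ∃ M : Submodule ℂ X, IsClosed (M : Set X) ∧ ¬ Module.Finite ℂ ↥M ∧
        ∀ x ∈ M, x ≠ 0 → DenseRange fun n : ℕ => (T ^ n) x) := by
  constructor
  · rintro ⟨n, -, hn0, h⟩
    refine ⟨exists_denseRange_prod_of_forall_subsequence hn0 fun f hf => ?_, ?_⟩
    · obtain ⟨M, -, hM, h⟩ := h f hf
      obtain ⟨x, hx, hx0⟩ := M.exists_mem_ne_zero_of_ne_bot (by
        rintro rfl
        exact hM inferInstance)
      exact ⟨x, h x hx hx0⟩
    · obtain ⟨M, hMc, hM, h⟩ := h id strictMono_id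
      refine ⟨M, hMc, hM, fun x hx hx0 => (h x hx hx0).mono ?_⟩
      rintro _ ⟨k, rfl⟩
      exact ⟨n k, rfl⟩
  · rintro ⟨⟨z, hz⟩, M, hMc, hM, hMd⟩
    have : Nontrivial X := by
      by_contra h
      have := not_nontrivial_iff_subsingleton.1 h
      exact hM inferInstance
    obtain ⟨n, m, hn, hn0, hnz, hmz, hnmz⟩ := exists_strictMono_of_weaklyMixing hz
    obtain ⟨μ, hμ, hT⟩ := exists_approximate_eigenvalue hMc hM hMd
    have hz1 : DenseRange fun k => (T ^ k) z.1 :=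
      Prod.fst_surjective.denseRange.comp hz continuous_fst
    refine ⟨n, hn, hn0, fun f hf => ?_⟩
    have hft := hf.tendsto_atTop
    exact exists_hypercyclic_subspace_along hz1 (hn.comp hf) (hnz.comp hft) (hmz.comp hft)
      (hnmz.comp hft) hμ hT
end

section
/- Let X be a separable complex Banach space and T a weakly mixing continuous linear operator on X. The following assertions are equivalent: (1) T has a hypercyclic subspace; (2) there exist an increasing sequence (n_k) of positive integers and an infinite-dimensional closed subspace M_0 of X such that T^{n_k} x → 0 for every x ∈ M_0; (3) there exist an increasing sequence (n_k) of positive integers and an infinite-dimensional closed subspace M_b of X such that sup_k ‖T^{n_k}|_{M_b}‖ < ∞. -/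
open Filter Topology

section FiniteCodimension

variable {X : Type*} [NormedAddCommGroup X] [NormedSpace ℂ X]

/-- An infinite-dimensional subspace meets the common kernel of finitely many functionals. -/
lemma exists_ne_zero_mem_of_finite_functionals {M : Submodule ℂ X} (hM : ¬ Module.Finite ℂ M)
    {S : Set (X →L[ℂ] ℂ)} (hS : S.Finite) : ∃ x ∈ M, x ≠ 0 ∧ ∀ φ ∈ S, φ x = 0 := by
  by_contra! h
  apply hM
  have := hS.to_subtype
  have := Fintype.ofFinite S
  let F : M →ₗ[ℂ] (S → ℂ) := LinearMap.pi fun φ => (φ.1 : X →ₗ[ℂ] ℂ) ∘ₗ M.subtype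
  refine Module.Finite.of_injective F ?_
  rw [← LinearMap.ker_eq_bot, LinearMap.ker_eq_bot']
  intro m hm
  by_contra hne
  obtain ⟨φ, hφ, hφm⟩ := h m m.2 (by simpa using hne)
  exact hφm (congrFun hm ⟨φ, hφ⟩)

/-- **Mazur's lemma**: a finite-dimensional subspace is almost norm-complemented by the common
kernel of finitely many functionals. -/
lemma exists_finite_functionals_norm_le_two_mul (F : Submodule ℂ X) [FiniteDimensional ℂ F] :
    ∃ S : Set (X →L[ℂ] ℂ), S.Finite ∧
      ∀ v ∈ F, ∀ w : X, (∀ φ ∈ S, φ w = 0) → ‖v‖ ≤ 2 * ‖v + w‖ := by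
  have : ProperSpace F := FiniteDimensional.proper ℂ F
  have key : ∃ S : Set (X →L[ℂ] ℂ), S.Finite ∧
      ∀ v ∈ Metric.sphere (0 : F) 1, ∀ w : X, (∀ φ ∈ S, φ w = 0) → 1 ≤ 2 * ‖(v : X) + w‖ := by
    refine (isCompact_sphere (0 : F) 1).induction_on
      (p := fun s => ∃ S : Set (X →L[ℂ] ℂ), S.Finite ∧
        ∀ v ∈ s, ∀ w : X, (∀ φ ∈ S, φ w = 0) → 1 ≤ 2 * ‖(v : X) + w‖) ?_ ?_ ?_ ?_
    · exact ⟨∅, Set.finite_empty, by simp⟩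
    · rintro s t hst ⟨S, hS, h⟩
      exact ⟨S, hS, fun v hv => h v (hst hv)⟩
    · rintro s t ⟨S, hS, h⟩ ⟨S', hS', h'⟩
      refine ⟨S ∪ S', hS.union hS', ?_⟩
      rintro v (hv | hv) w hw
      · exact h v hv w fun φ hφ => hw φ (Or.inl hφ)
      · exact h' v hv w fun φ hφ => hw φ (Or.inr hφ)
    · intro v₀ hv₀
      have hv₀' : ‖(v₀ : X)‖ = 1 := by simpa using hv₀
      obtain ⟨φ, hφ, hφv⟩ := exists_dual_vector ℂ (v₀ : X) (by rw [← norm_ne_zero_iff, hv₀']; simp)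
      refine ⟨Metric.ball v₀ (1 / 2), mem_nhdsWithin_of_mem_nhds (Metric.ball_mem_nhds _ (by simp)),
        {φ}, Set.finite_singleton _, ?_⟩
      intro v hv w hw
      have hw := hw φ rfl
      have h1 : ‖φ ((v : X) - v₀)‖ ≤ 1 / 2 := by
        refine (φ.le_opNorm _).trans ?_
        rw [hφ, one_mul]
        have : ‖v - v₀‖ < 1 / 2 := by simpa [dist_eq_norm] using hv
        exact this.le
      have h2 : ‖φ ((v : X) + w)‖ ≤ ‖(v : X) + w‖ := by
        simpa [hφ] using φ.le_opNorm ((v : X) + w)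
      have h3 : ‖φ (v₀ : X)‖ = 1 := by rw [hφv, hv₀']; simp
      have h4 : φ (v₀ : X) = φ ((v : X) + w) - φ ((v : X) - v₀) := by
        rw [map_add, map_sub, hw]; ring
      have h5 := norm_sub_le (φ ((v : X) + w)) (φ ((v : X) - v₀))
      rw [← h4, h3] at h5
      linarith
  obtain ⟨S, hS, h⟩ := key
  refine ⟨S, hS, fun v hv w hw => ?_⟩
  rcases eq_or_ne v 0 with rfl | hv0
  · simp
  have hn : 0 < ‖v‖ := norm_pos_iff.2 hv0
  have hc : ‖((‖v‖ : ℂ)⁻¹)‖ = ‖v‖⁻¹ := by simp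
  have := h ((‖v‖ : ℂ)⁻¹ • ⟨v, hv⟩) (by
    rw [mem_sphere_zero_iff_norm, norm_smul, hc]
    exact inv_mul_cancel₀ hn.ne') ((‖v‖ : ℂ)⁻¹ • w) (fun φ hφ => by simp [hw φ hφ])
  simp only [Submodule.coe_smul, ← smul_add] at this
  rw [norm_smul, hc] at this
  calc ‖v‖ = ‖v‖ * 1 := by ring
    _ ≤ ‖v‖ * (2 * (‖v‖⁻¹ * ‖v + w‖)) := by gcongr
    _ = 2 * ‖v + w‖ := by field_simp

end FiniteCodimension

section Transitivity

lemma DenseRange.exists_ge_mem {Y : Type*} [TopologicalSpace Y] [T1Space Y]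
    [∀ y : Y, NeBot (𝓝[≠] y)] {u : ℕ → Y} (hu : DenseRange u) {U : Set Y} (hU : IsOpen U)
    (hne : U.Nonempty) (N : ℕ) : ∃ n, N ≤ n ∧ u n ∈ U := by
  have hd : Dense (Set.range u \ (u '' Set.Iio N)) :=
    Dense.sdiff_finite hu ((Set.finite_Iio N).image u)
  obtain ⟨_, hyU, ⟨n, rfl⟩, hn⟩ := hd.inter_open_nonempty U hU hne
  refine ⟨n, ?_, hyU⟩
  by_contra! hlt
  exact hn ⟨n, hlt, rfl⟩

variable {X : Type*} [NormedAddCommGroup X] [NormedSpace ℂ X]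

lemma exists_iterate_mem_of_weaklyMixing [Nontrivial X] {T : X →L[ℂ] X}
    (hwm : ∃ z : X × X, DenseRange fun n : ℕ => ((T ^ n) z.1, (T ^ n) z.2))
    {U₁ V₁ U₂ V₂ : Set X} (hU₁ : IsOpen U₁) (hV₁ : IsOpen V₁) (hU₂ : IsOpen U₂) (hV₂ : IsOpen V₂)
    (hU₁' : U₁.Nonempty) (hV₁' : V₁.Nonempty) (hU₂' : U₂.Nonempty) (hV₂' : V₂.Nonempty) (N : ℕ) :
    ∃ m, N ≤ m ∧ (∃ x ∈ U₁, (T ^ m) x ∈ V₁) ∧ ∃ x ∈ U₂, (T ^ m) x ∈ V₂ := by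
  obtain ⟨z, hz⟩ := hwm
  have : ∀ y : X × X, NeBot (𝓝[≠] y) := fun y => Module.punctured_nhds_neBot ℂ (X × X) y
  obtain ⟨a, -, ha₁, ha₂⟩ := hz.exists_ge_mem (hU₁.prod hU₂) (hU₁'.prod hU₂') 0
  obtain ⟨b, hb, hb₁, hb₂⟩ := hz.exists_ge_mem (hV₁.prod hV₂) (hV₁'.prod hV₂') (a + N)
  have hab : b - a + a = b := by omega
  refine ⟨b - a, by omega, ⟨_, ha₁, ?_⟩, ⟨_, ha₂, ?_⟩⟩
  · rw [← mul_apply_eq_comp, ← pow_add, hab]; exact hb₁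
  · rw [← mul_apply_eq_comp, ← pow_add, hab]; exact hb₂

/-- Furstenberg's lemma: a weakly mixing operator realizes finitely many transitions at a common
time. -/
lemma exists_common_iterate_of_weaklyMixing [Nontrivial X] {T : X →L[ℂ] X}
    (hwm : ∃ z : X × X, DenseRange fun n : ℕ => ((T ^ n) z.1, (T ^ n) z.2))
    (p q : ℕ → X) {δ : ℝ} (hδ : 0 < δ) (s N : ℕ) :
    ∃ m, N ≤ m ∧ ∃ v : ℕ → X, ∀ j < s, ‖v j - p j‖ < δ ∧ ‖(T ^ m) (v j) - q j‖ < δ := by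
  have key : ∃ U V : Set X, IsOpen U ∧ IsOpen V ∧ U.Nonempty ∧ V.Nonempty ∧
      ∀ m : ℕ, (∃ x ∈ U, (T ^ m) x ∈ V) →
        ∀ j < s, ∃ x ∈ Metric.ball (p j) δ, (T ^ m) x ∈ Metric.ball (q j) δ := by
    induction s with
    | zero => exact ⟨_, _, isOpen_univ, isOpen_univ, ⟨0, trivial⟩, ⟨0, trivial⟩, by simp⟩
    | succ s ih =>
      obtain ⟨U, V, hU, hV, hU', hV', h⟩ := ih
      obtain ⟨n, -, ⟨x, hxU, hxB⟩, ⟨y, hyV, hyB⟩⟩ := exists_iterate_mem_of_weaklyMixing hwm hU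
        (Metric.isOpen_ball (x := p s) (ε := δ)) hV (Metric.isOpen_ball (x := q s) (ε := δ)) hU'
        ⟨_, Metric.mem_ball_self hδ⟩ hV' ⟨_, Metric.mem_ball_self hδ⟩ 0
      refine ⟨U ∩ (T ^ n) ⁻¹' Metric.ball (p s) δ, V ∩ (T ^ n) ⁻¹' Metric.ball (q s) δ,
        hU.inter (Metric.isOpen_ball.preimage (T ^ n).continuous),
        hV.inter (Metric.isOpen_ball.preimage (T ^ n).continuous),
        ⟨x, hxU, hxB⟩, ⟨y, hyV, hyB⟩, ?_⟩
      rintro m ⟨w, ⟨hw1, hw2⟩, hw3, hw4⟩ j hj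
      rcases Nat.lt_succ_iff_lt_or_eq.1 hj with hj | rfl
      · exact h m ⟨w, hw1, hw3⟩ j hj
      · refine ⟨(T ^ n) w, hw2, ?_⟩
        rw [← mul_apply_eq_comp, ← pow_add, add_comm, pow_add,
          mul_apply_eq_comp]
        exact hw4
  obtain ⟨U, V, hU, hV, hU', hV', h⟩ := key
  obtain ⟨m, hm, hx, -⟩ := exists_iterate_mem_of_weaklyMixing hwm hU hV hU hV hU' hV' hU' hV' N
  have := h m hx
  choose! v hv hv' using this
  exact ⟨m, hm, v, fun j hj => ⟨by simpa [dist_eq_norm] using hv j hj,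
    by simpa [dist_eq_norm] using hv' j hj⟩⟩

end Transitivity

section Growth

variable {X : Type*} [NormedAddCommGroup X] [NormedSpace ℂ X]

/-- A Cauchy estimate for the central coefficient of a Fejér-type sum. -/
lemma norm_central_coeff_le (c : ℕ → X) (n : ℕ) {r B : ℝ} (hr : 0 ≤ r)
    (h : ∀ μ : ℂ, ‖μ‖ = r →
      ‖∑ i ∈ Finset.range (n + 1), ∑ j ∈ Finset.range (n + 1), μ ^ (i + j) • c (i + j)‖ ≤ B) :
    n * (r ^ (n + 1) * ‖c (n + 1)‖) ≤ B := by
  have hM : 2 * (n + 1) ≠ 0 := by omega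
  obtain ⟨ω, hω⟩ : ∃ ω : ℂ, IsPrimitiveRoot ω (2 * (n + 1)) :=
    ⟨_, Complex.isPrimitiveRoot_exp _ hM⟩
  have hω1 : ‖ω‖ = 1 := hω.norm'_eq_one hM
  have hgeom : ∀ k < 2 * n + 1, ∑ s ∈ Finset.range (2 * (n + 1)), (ω ^ (n + 1 + k)) ^ s =
      if k = n + 1 then (2 * (n + 1) : ℂ) else 0 := by
    intro k hk
    split_ifs with hkn
    · subst hkn
      have : ω ^ (n + 1 + (n + 1)) = 1 := by rw [← two_mul]; exact hω.pow_eq_one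
      simp [this]
    · have hne : ω ^ (n + 1 + k) ≠ 1 := by
        intro h1
        obtain ⟨d, hd⟩ := (hω.pow_eq_one_iff_dvd _).1 h1
        rcases d with _ | _ | d
        · omega
        · omega
        · nlinarith
      have h2 := geom_sum_mul (ω ^ (n + 1 + k)) (2 * (n + 1))
      rw [← pow_mul, mul_comm (n + 1 + k), pow_mul, hω.pow_eq_one, one_pow, sub_self] at h2
      exact (mul_eq_zero.1 h2).resolve_right (sub_ne_zero.2 hne)
  have hcount : ∑ i ∈ Finset.range (n + 1), ∑ j ∈ Finset.range (n + 1),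
      (if i + j = n + 1 then (1 : ℂ) else 0) = n := by
    rw [Finset.sum_range_succ']
    have h0 : ∑ j ∈ Finset.range (n + 1), (if 0 + j = n + 1 then (1 : ℂ) else 0) = 0 := by
      refine Finset.sum_eq_zero fun j hj => if_neg ?_
      have := Finset.mem_range.1 hj
      omega
    rw [h0, add_zero]
    have h1 : ∀ i ∈ Finset.range n, ∑ j ∈ Finset.range (n + 1),
        (if i + 1 + j = n + 1 then (1 : ℂ) else 0) = 1 := by
      intro i hi
      have := Finset.mem_range.1 hi
      rw [Finset.sum_eq_single (n - i)]
      · rw [if_pos (by omega)]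
      · intro j _ hj
        exact if_neg (by omega)
      · intro hh
        exact absurd (Finset.mem_range.2 (by omega)) hh
    rw [Finset.sum_congr rfl h1]
    simp
  have hid : ∑ s ∈ Finset.range (2 * (n + 1)), (ω ^ (n + 1)) ^ s •
      ∑ i ∈ Finset.range (n + 1), ∑ j ∈ Finset.range (n + 1),
        ((r : ℂ) * ω ^ s) ^ (i + j) • c (i + j) =
      ((2 * (n + 1) : ℂ) * (n * r ^ (n + 1))) • c (n + 1) := by
    simp_rw [Finset.smul_sum]
    rw [Finset.sum_comm]
    simp_rw [Finset.sum_comm (s := Finset.range (2 * (n + 1)))]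
    have h3 : ∀ i ∈ Finset.range (n + 1), ∀ j ∈ Finset.range (n + 1),
        ∑ s ∈ Finset.range (2 * (n + 1)), (ω ^ (n + 1)) ^ s •
          ((r : ℂ) * ω ^ s) ^ (i + j) • c (i + j) =
        (if i + j = n + 1 then (1 : ℂ) else 0) •
          ((2 * (n + 1) : ℂ) * r ^ (n + 1)) • c (n + 1) := by
      intro i hi j hj
      have hi' := Finset.mem_range.1 hi
      have hj' := Finset.mem_range.1 hj
      have h4 : ∀ s ∈ Finset.range (2 * (n + 1)), (ω ^ (n + 1)) ^ s •
          ((r : ℂ) * ω ^ s) ^ (i + j) • c (i + j) =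
          ((ω ^ (n + 1 + (i + j))) ^ s * r ^ (i + j)) • c (i + j) := by
        intro s _
        rw [smul_smul]
        congr 1
        ring
      rw [Finset.sum_congr rfl h4, ← Finset.sum_smul, ← Finset.sum_mul, hgeom _ (by omega)]
      split_ifs with hij
      · rw [hij, one_smul]
      · simp
    rw [Finset.sum_congr rfl fun i hi => Finset.sum_congr rfl fun j hj => h3 i hi j hj]
    simp_rw [← Finset.sum_smul]
    rw [hcount, smul_smul]
    congr 1
    ring
  have hle : ‖((2 * (n + 1) : ℂ) * (n * r ^ (n + 1))) • c (n + 1)‖ ≤ (2 * (n + 1)) * B := by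
    rw [← hid]
    refine (norm_sum_le _ _).trans ?_
    calc _ ≤ ∑ s ∈ Finset.range (2 * (n + 1)), B := by
          refine Finset.sum_le_sum fun s _ => ?_
          rw [norm_smul, norm_pow, norm_pow, hω1, one_pow, one_pow, one_mul]
          exact h _ (by rw [norm_mul, norm_pow, hω1, one_pow, mul_one]; simp [abs_of_nonneg hr])
      _ = _ := by simp
  have hnorm : ‖(2 * (n + 1) : ℂ) * (n * r ^ (n + 1))‖ = 2 * (n + 1) * (n * r ^ (n + 1)) := by
    have : (2 * (n + 1) : ℂ) * (n * r ^ (n + 1)) =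
        ((2 * (n + 1) * (n * r ^ (n + 1)) : ℝ) : ℂ) := by push_cast; ring
    rw [this, Complex.norm_real, Real.norm_of_nonneg (by positivity)]
  rw [norm_smul, hnorm, mul_assoc, mul_assoc (n : ℝ)] at hle
  exact le_of_mul_le_mul_left hle (by positivity)

/-- If `T - λ` is bounded below on the circle `|λ| = ρ`, then an orbit that grows at rate `ρ`
over a long enough window grows faster over the next one. -/
lemma three_mul_pow_mul_norm_le {T : X →L[ℂ] X} {L : Submodule ℂ X} {κ ρ : ℝ} (hκ : 0 < κ)
    (hρ : 0 < ρ) (hρ1 : ρ ≤ 1)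
    (hL : ∀ l : ℂ, ‖l‖ = ρ → ∀ x ∈ L, κ * ‖x‖ ≤ ‖T x - l • x‖) {n : ℕ} (hn : 6 ≤ n * κ ^ 2)
    {y : X} (hy : ∀ k ≤ 2 * (n + 1), (T ^ k) y ∈ L)
    (hgrow : ρ ^ (n + 1) * ‖y‖ ≤ ‖(T ^ (n + 1)) y‖) :
    3 * ρ ^ (n + 1) * ‖(T ^ (n + 1)) y‖ ≤ ‖(T ^ (2 * (n + 1))) y‖ := by
  set N := n + 1 with hN
  set r := ρ⁻¹ with hr
  have hr0 : 0 < r := inv_pos.2 hρ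
  have hr1 : 1 ≤ r := (one_le_inv₀ hρ).2 hρ1
  have hcoef := norm_central_coeff_le (fun k => (T ^ k) y) n (r := r)
    (B := (r ^ (2 * N) * ‖(T ^ (2 * N)) y‖ + 2 * (r ^ N * ‖(T ^ N) y‖) + ‖y‖) / κ ^ 2) hr0.le
    (by
      intro μ hμ
      have hμ0 : μ ≠ 0 := by rw [← norm_ne_zero_iff, hμ]; exact hr0.ne'
      set A : X →L[ℂ] X := μ • T with hA
      have hApow : ∀ k : ℕ, ∀ x, (A ^ k) x = μ ^ k • (T ^ k) x := by
        intro k x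
        rw [hA, smul_pow]; rfl
      have hbelow : ∀ x ∈ L, κ * ‖x‖ ≤ ‖(A - 1) x‖ := by
        intro x hx
        have h1 := hL μ⁻¹ (by rw [norm_inv, hμ, hr, inv_inv]) x hx
        have h2 : (A - 1) x = μ • (T x - μ⁻¹ • x) := by
          rw [smul_sub, smul_inv_smul₀ hμ0]; rfl
        rw [h2, norm_smul, hμ]
        calc κ * ‖x‖ ≤ ‖T x - μ⁻¹ • x‖ := h1
          _ ≤ r * ‖T x - μ⁻¹ • x‖ := le_mul_of_one_le_left (norm_nonneg _) hr1
      set Z := ∑ i ∈ Finset.range N, ∑ j ∈ Finset.range N, μ ^ (i + j) • (T ^ (i + j)) y with hZ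
      set G : X →L[ℂ] X := ∑ i ∈ Finset.range N, A ^ i with hG
      have hZG : Z = (G * G) y := by
        rw [hG, Finset.sum_mul_sum, hZ]
        simp only [sum_apply, ← pow_add, hApow]
      have hG1 : (A - 1) * G = A ^ N - 1 := mul_geom_sum A N
      have hG2 : G * (A - 1) = A ^ N - 1 := geom_sum_mul A N
      have hop : (A - 1) * ((A - 1) * (G * G)) = (A ^ N - 1) * (A ^ N - 1) := by
        calc (A - 1) * ((A - 1) * (G * G)) = (A - 1) * (((A - 1) * G) * G) := by
              rw [mul_assoc (A - 1) G G]
          _ = (A - 1) * ((G * (A - 1)) * G) := by rw [hG1.trans hG2.symm]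
          _ = ((A - 1) * G) * ((A - 1) * G) := by simp only [mul_assoc]
          _ = _ := by rw [hG1]
      have hZL : Z ∈ L := by
        refine Submodule.sum_mem _ fun i hi => Submodule.sum_mem _ fun j hj =>
          Submodule.smul_mem _ _ (hy _ ?_)
        have := Finset.mem_range.1 hi
        have := Finset.mem_range.1 hj
        omega
      have hAZL : (A - 1) Z ∈ L := by
        have h1 : (A - 1) Z = A Z - Z := rfl
        rw [h1]
        refine Submodule.sub_mem _ ?_ hZL
        rw [hZ]
        simp only [map_sum, map_smul]
        refine Submodule.sum_mem _ fun i hi => Submodule.sum_mem _ fun j hj =>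
          Submodule.smul_mem _ _ ?_
        have h2 : A ((T ^ (i + j)) y) = μ • (T ^ (i + j + 1)) y := by rw [pow_succ']; rfl
        rw [h2]
        refine Submodule.smul_mem _ _ (hy _ ?_)
        have := Finset.mem_range.1 hi
        have := Finset.mem_range.1 hj
        omega
      have h1 := hbelow _ hZL
      have h2 := hbelow _ hAZL
      have h3 : (A - 1) ((A - 1) Z) = μ ^ (2 * N) • (T ^ (2 * N)) y - (2 : ℂ) • μ ^ N • (T ^ N) y
          + y := by
        have h4 : (A - 1) ((A - 1) Z) = ((A - 1) * ((A - 1) * (G * G))) y := by rw [hZG]; rfl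
        have h5 : ∀ B : X →L[ℂ] X, (B - 1) * (B - 1) = B * B - (2 : ℂ) • B + 1 := by
          intro B
          rw [two_smul]
          noncomm_ring
        rw [h4, hop, h5, ← pow_add, ← two_mul]
        simp [hApow]
      have h6 : ‖(A - 1) ((A - 1) Z)‖ ≤
          r ^ (2 * N) * ‖(T ^ (2 * N)) y‖ + 2 * (r ^ N * ‖(T ^ N) y‖) + ‖y‖ := by
        rw [h3]
        refine (norm_add_le _ _).trans (add_le_add ((norm_sub_le _ _).trans ?_) le_rfl)
        simp [norm_smul, hμ]
      rw [le_div_iff₀ (by positivity)]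
      calc ‖Z‖ * κ ^ 2 = κ * (κ * ‖Z‖) := by ring
        _ ≤ κ * ‖(A - 1) Z‖ := by gcongr
        _ ≤ _ := h2.trans h6)
  rw [le_div_iff₀ (by positivity)] at hcoef
  have hρr : ρ * r = 1 := mul_inv_cancel₀ hρ.ne'
  have hρrN : ρ ^ N * r ^ N = 1 := by rw [← mul_pow, hρr, one_pow]
  have hb0 : ‖y‖ ≤ r ^ N * ‖(T ^ N) y‖ := by
    calc ‖y‖ = r ^ N * (ρ ^ N * ‖y‖) := by rw [← mul_assoc, mul_comm (r ^ N), hρrN, one_mul]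
      _ ≤ _ := by gcongr
  set b := r ^ N * ‖(T ^ N) y‖ with hb
  have hbnn : 0 ≤ b := by positivity
  have h7 : 3 * b ≤ r ^ (2 * N) * ‖(T ^ (2 * N)) y‖ := by
    have h8 : 6 * b ≤ (n * b) * κ ^ 2 := by
      calc 6 * b ≤ (n * κ ^ 2) * b := by gcongr
        _ = _ := by ring
    linarith
  calc 3 * ρ ^ N * ‖(T ^ N) y‖ = ρ ^ N * (3 * ((ρ ^ N * r ^ N) * ‖(T ^ N) y‖)) := by
        rw [hρrN]; ring
    _ = ρ ^ (2 * N) * (3 * b) := by rw [hb]; ring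
    _ ≤ ρ ^ (2 * N) * (r ^ (2 * N) * ‖(T ^ (2 * N)) y‖) := by gcongr
    _ = ‖(T ^ (2 * N)) y‖ := by rw [← mul_assoc, ← mul_pow, hρr, one_pow, one_mul]

/-- If `T - λ` is bounded below on `L` uniformly for `|λ| ≤ 1`, then orbits staying in `L` grow
uniformly. -/
lemma exists_forall_mul_norm_le_norm_pow {T : X →L[ℂ] X} {L : Submodule ℂ X} {κ : ℝ}
    (hκ : 0 < κ) (hκ1 : κ ≤ 1)
    (hL : ∀ l : ℂ, ‖l‖ ≤ 1 → ∀ x ∈ L, κ * ‖x‖ ≤ ‖T x - l • x‖) (R : ℝ) :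
    ∃ n₀ : ℕ, ∀ n, n₀ ≤ n → ∀ y, (∀ k ≤ n, (T ^ k) y ∈ L) → R * ‖y‖ ≤ ‖(T ^ n) y‖ := by
  obtain ⟨p, hp⟩ := exists_nat_ge (6 / κ ^ 2)
  have hp' : 6 ≤ p * κ ^ 2 := by rwa [div_le_iff₀ (by positivity)] at hp
  set N := p + 1 with hN
  obtain ⟨J, hJ⟩ := pow_unbounded_of_one_lt (3 / κ ^ N) (by norm_num : (1 : ℝ) < 3)
  obtain ⟨I, hI⟩ := pow_unbounded_of_one_lt (R / (κ ^ N * κ ^ (N * J)))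
    (by norm_num : (1 : ℝ) < 3)
  refine ⟨N * (J + I), fun n hn y hy => ?_⟩
  have hiter : ∀ m k, m + k ≤ n → κ ^ k * ‖(T ^ m) y‖ ≤ ‖(T ^ (m + k)) y‖ := by
    intro m k
    induction k with
    | zero => simp
    | succ k ih =>
      intro hk
      have h1 := hL 0 (by simp) _ (hy (m + k) (by omega))
      rw [zero_smul, sub_zero] at h1
      calc κ ^ (k + 1) * ‖(T ^ m) y‖ = κ * (κ ^ k * ‖(T ^ m) y‖) := by ring
        _ ≤ κ * ‖(T ^ (m + k)) y‖ := by gcongr; exact ih (by omega)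
        _ ≤ _ := h1
        _ = _ := by rw [← add_assoc, pow_succ']; rfl
  have hrate : ∀ i, N * (i + 1) ≤ n →
      min (3 ^ i * κ ^ N) 3 * ‖(T ^ (N * i)) y‖ ≤ ‖(T ^ (N * (i + 1))) y‖ := by
    intro i
    induction i with
    | zero =>
      intro h
      refine le_trans ?_ (hiter (N * 0) N (by omega))
      gcongr
      simp
    | succ i ih =>
      intro h
      have h0 : N * (i + 1) + N ≤ n := by linarith
      set t := min (3 ^ i * κ ^ N) 1 with ht
      have ht0 : 0 < t := lt_min (by positivity) one_pos
      set ρ := t ^ ((N : ℝ)⁻¹) with hρ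
      have hρt : ρ ^ N = t := Real.rpow_inv_natCast_pow ht0.le (by omega)
      have hρ0 : 0 < ρ := Real.rpow_pos_of_pos ht0 _
      have hρ1 : ρ ≤ 1 := Real.rpow_le_one ht0.le (min_le_right _ _) (by positivity)
      have hgrow : ρ ^ N * ‖(T ^ (N * i)) y‖ ≤ ‖(T ^ N) ((T ^ (N * i)) y)‖ := by
        rw [hρt, ← mul_apply_eq_comp, ← pow_add]
        have h1 : N + N * i = N * (i + 1) := by ring
        rw [h1]
        refine le_trans ?_ (ih (by linarith))
        gcongr
        exact min_le_min le_rfl (by norm_num)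
      have h2 := three_mul_pow_mul_norm_le hκ hρ0 hρ1
        (fun l hl => hL l (hl.trans_le hρ1)) hp' (y := (T ^ (N * i)) y)
        (fun k hk => by
          rw [← mul_apply_eq_comp, ← pow_add]
          refine hy _ ?_
          rw [← hN] at hk
          linarith) hgrow
      rw [← hN, hρt, ← mul_apply_eq_comp, ← mul_apply_eq_comp, ← pow_add, ← pow_add] at h2
      have h3 : N + N * i = N * (i + 1) := by ring
      have h4 : 2 * N + N * i = N * (i + 1 + 1) := by ring
      rw [h3, h4] at h2
      refine le_trans ?_ h2
      gcongr
      rw [ht, mul_min_of_nonneg _ _ (by norm_num : (0 : ℝ) ≤ 3)]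
      exact le_of_eq (by ring_nf)
  have hrate' : ∀ i, N * (J + i) ≤ n →
      3 ^ i * ‖(T ^ (N * J)) y‖ ≤ ‖(T ^ (N * (J + i))) y‖ := by
    intro i
    induction i with
    | zero => simp
    | succ i ih =>
      intro h
      have h1 := hrate (J + i) (by linarith)
      rw [min_eq_right] at h1
      · calc 3 ^ (i + 1) * ‖(T ^ (N * J)) y‖ = 3 * (3 ^ i * ‖(T ^ (N * J)) y‖) := by ring
          _ ≤ 3 * ‖(T ^ (N * (J + i))) y‖ := by gcongr; exact ih (by linarith)
          _ ≤ _ := h1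
      · rw [div_lt_iff₀ (by positivity)] at hJ
        calc (3 : ℝ) ≤ 3 ^ J * κ ^ N := hJ.le
          _ ≤ 3 ^ (J + i) * κ ^ N := by gcongr <;> [norm_num; omega]
  obtain ⟨i, hi⟩ : ∃ i, n / N = J + i :=
    Nat.exists_eq_add_of_le ((Nat.le_div_iff_mul_le (by omega)).2 (by nlinarith))
  have hIi : I ≤ i := by
    have : J + I ≤ n / N := (Nat.le_div_iff_mul_le (by omega)).2 (by linarith)
    omega
  have hdiv := Nat.div_add_mod n N
  rw [hi] at hdiv
  have hmod : n % N < N := Nat.mod_lt _ (by omega)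
  have h1 := hiter (N * (J + i)) (n % N) hdiv.le
  rw [hdiv] at h1
  have h2 := hrate' i (by omega)
  have h3 := hiter 0 (N * J) (by nlinarith)
  rw [zero_add, pow_zero] at h3
  have h3' : κ ^ (N * J) * ‖y‖ ≤ ‖(T ^ (N * J)) y‖ := h3
  have hR : R ≤ 3 ^ i * (κ ^ N * κ ^ (N * J)) := by
    rw [div_lt_iff₀ (by positivity)] at hI
    refine hI.le.trans ?_
    gcongr
    norm_num
  calc R * ‖y‖ ≤ 3 ^ i * (κ ^ N * κ ^ (N * J)) * ‖y‖ := by gcongr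
    _ = κ ^ N * (3 ^ i * (κ ^ (N * J) * ‖y‖)) := by ring
    _ ≤ κ ^ N * (3 ^ i * ‖(T ^ (N * J)) y‖) := by gcongr
    _ ≤ κ ^ N * ‖(T ^ (N * (J + i))) y‖ := by gcongr
    _ ≤ κ ^ (n % N) * ‖(T ^ (N * (J + i))) y‖ := by
        gcongr ?_ * _
        exact pow_le_pow_of_le_one hκ.le hκ1 hmod.le
    _ ≤ _ := h1

end Growth

section EssentialSpectrum

variable {X : Type*} [NormedAddCommGroup X] [NormedSpace ℂ X]

/-- `l` is an approximate eigenvalue of `T` on every closed subspace of finite codimension. -/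
def IsEssentialApproxEigenvalue (T : X →L[ℂ] X) (l : ℂ) : Prop :=
  ∀ ε > 0, ∀ S : Set (X →L[ℂ] ℂ), S.Finite →
    ∃ y : X, ‖y‖ = 1 ∧ (∀ φ ∈ S, φ y = 0) ∧ ‖T y - l • y‖ < ε

lemma exists_uniform_lower_bound {T : X →L[ℂ] X}
    (hT : ∀ l : ℂ, ‖l‖ ≤ 1 → ¬ IsEssentialApproxEigenvalue T l) :
    ∃ κ : ℝ, 0 < κ ∧ ∃ S : Set (X →L[ℂ] ℂ), S.Finite ∧ ∀ l : ℂ, ‖l‖ ≤ 1 →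
      ∀ x : X, (∀ φ ∈ S, φ x = 0) → κ * ‖x‖ ≤ ‖T x - l • x‖ := by
  have key : ∃ κ : ℝ, 0 < κ ∧ ∃ S : Set (X →L[ℂ] ℂ), S.Finite ∧
      ∀ l ∈ Metric.closedBall (0 : ℂ) 1,
        ∀ x : X, (∀ φ ∈ S, φ x = 0) → κ * ‖x‖ ≤ ‖T x - l • x‖ := by
    refine (isCompact_closedBall (0 : ℂ) 1).induction_on
      (p := fun s => ∃ κ : ℝ, 0 < κ ∧ ∃ S : Set (X →L[ℂ] ℂ), S.Finite ∧ ∀ l ∈ s,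
        ∀ x : X, (∀ φ ∈ S, φ x = 0) → κ * ‖x‖ ≤ ‖T x - l • x‖) ?_ ?_ ?_ ?_
    · exact ⟨1, one_pos, ∅, Set.finite_empty, by simp⟩
    · rintro s t hst ⟨κ, hκ, S, hS, h⟩
      exact ⟨κ, hκ, S, hS, fun l hl => h l (hst hl)⟩
    · rintro s t ⟨κ, hκ, S, hS, h⟩ ⟨κ', hκ', S', hS', h'⟩
      refine ⟨min κ κ', lt_min hκ hκ', S ∪ S', hS.union hS', ?_⟩
      rintro l (hl | hl) x hx
      · refine le_trans ?_ (h l hl x fun φ hφ => hx φ (Or.inl hφ))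
        gcongr
        exact min_le_left _ _
      · refine le_trans ?_ (h' l hl x fun φ hφ => hx φ (Or.inr hφ))
        gcongr
        exact min_le_right _ _
    · intro l₀ hl₀
      have h0 := hT l₀ (by simpa using hl₀)
      unfold IsEssentialApproxEigenvalue at h0
      push Not at h0
      obtain ⟨ε, hε, S, hS, h⟩ := h0
      refine ⟨Metric.ball l₀ (ε / 2),
        mem_nhdsWithin_of_mem_nhds (Metric.ball_mem_nhds _ (by positivity)),
        ε / 2, by positivity, S, hS, ?_⟩
      intro l hl x hx
      have hlow : ε * ‖x‖ ≤ ‖T x - l₀ • x‖ := by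
        rcases eq_or_ne x 0 with rfl | hx0
        · simp
        have hn : 0 < ‖x‖ := norm_pos_iff.2 hx0
        have hc : ‖((‖x‖ : ℂ)⁻¹)‖ = ‖x‖⁻¹ := by simp
        have h1 := h ((‖x‖ : ℂ)⁻¹ • x) (by rw [norm_smul, hc]; exact inv_mul_cancel₀ hn.ne')
          (fun φ hφ => by simp [hx φ hφ])
        rw [map_smul, smul_comm l₀, ← smul_sub, norm_smul, hc] at h1
        calc ε * ‖x‖ ≤ (‖x‖⁻¹ * ‖T x - l₀ • x‖) * ‖x‖ := by gcongr
          _ = _ := by field_simp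
      have h2 : ‖T x - l₀ • x‖ ≤ ‖T x - l • x‖ + ‖l - l₀‖ * ‖x‖ := by
        rw [← norm_smul]
        refine le_of_eq_of_le ?_ (norm_add_le _ _)
        congr 1
        rw [sub_smul]
        abel
      have h3 : ‖l - l₀‖ ≤ ε / 2 := by
        have := Metric.mem_ball.1 hl
        rw [dist_eq_norm] at this
        exact this.le
      have h4 : ‖l - l₀‖ * ‖x‖ ≤ ε / 2 * ‖x‖ := by gcongr
      linarith
  obtain ⟨κ, hκ, S, hS, h⟩ := key
  exact ⟨κ, hκ, S, hS, fun l hl => h l (by simpa using hl)⟩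

lemma exists_growth_of_not_isEssentialApproxEigenvalue {T : X →L[ℂ] X}
    (hT : ∀ l : ℂ, ‖l‖ ≤ 1 → ¬ IsEssentialApproxEigenvalue T l) (R : ℝ) :
    ∃ n₀ : ℕ, ∀ n, n₀ ≤ n → ∃ S : Set (X →L[ℂ] ℂ), S.Finite ∧
      ∀ y : X, (∀ φ ∈ S, φ y = 0) → R * ‖y‖ ≤ ‖(T ^ n) y‖ := by
  obtain ⟨κ, hκ, S, hS, h⟩ := exists_uniform_lower_bound hT
  let L : Submodule ℂ X := ⨅ φ ∈ S, LinearMap.ker (φ : X →ₗ[ℂ] ℂ)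
  have hLmem : ∀ x, x ∈ L ↔ ∀ φ ∈ S, φ x = 0 := by
    intro x
    simp [L, Submodule.mem_iInf]
  obtain ⟨n₀, hn₀⟩ := exists_forall_mul_norm_le_norm_pow (T := T) (L := L) (κ := min κ 1)
    (lt_min hκ one_pos) (min_le_right _ _) (fun l hl x hx => by
      refine le_trans ?_ (h l hl x ((hLmem x).1 hx))
      gcongr
      exact min_le_left _ _) R
  refine ⟨n₀, fun n hn => ⟨Set.image2 (fun (φ : X →L[ℂ] ℂ) (k : ℕ) => φ.comp (T ^ k)) S (Set.Iic n),
    hS.image2 _ (Set.finite_Iic n), fun y hy => hn₀ n hn y fun k hk => ?_⟩⟩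
  rw [hLmem]
  intro φ hφ
  exact hy _ (Set.mem_image2_of_mem hφ hk)

lemma exists_isEssentialApproxEigenvalue_of_bounded {T : X →L[ℂ] X} {n : ℕ → ℕ} (hn : StrictMono n)
    {M : Submodule ℂ X} (hM : ¬ Module.Finite ℂ M) {C : ℝ}
    (hC : ∀ k : ℕ, ∀ x ∈ M, ‖(T ^ (n k)) x‖ ≤ C * ‖x‖) :
    ∃ l : ℂ, ‖l‖ ≤ 1 ∧ IsEssentialApproxEigenvalue T l := by
  by_contra! hT
  obtain ⟨n₀, hn₀⟩ := exists_growth_of_not_isEssentialApproxEigenvalue hT (C + 1)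
  obtain ⟨S, hS, h⟩ := hn₀ (n n₀) (hn.id_le n₀)
  obtain ⟨x, hxM, hx0, hx⟩ := exists_ne_zero_mem_of_finite_functionals hM hS
  have h1 := h x hx
  have h2 := hC n₀ x hxM
  have h3 : 0 < ‖x‖ := norm_pos_iff.2 hx0
  linarith

lemma exists_mem_forall_two_le_norm_pow [CompleteSpace X] {T : X →L[ℂ] X}
    (hT : ∀ l : ℂ, ‖l‖ ≤ 1 → ¬ IsEssentialApproxEigenvalue T l)
    {M : Submodule ℂ X} (hMc : IsClosed (M : Set X)) (hM : ¬ Module.Finite ℂ M) :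
    ∃ x ∈ M, ∃ n₀ : ℕ, ∀ n, n₀ ≤ n → 2 ≤ ‖(T ^ n) x‖ := by
  choose m hm using fun j : ℕ =>
    exists_growth_of_not_isEssentialApproxEigenvalue hT (4 * 2 ^ j)
  -- a strictly increasing sequence of thresholds
  let N : ℕ → ℕ := fun j => ∑ i ∈ Finset.range (j + 1), (m i + 1)
  have hN : StrictMono N := strictMono_nat_of_lt_succ fun j => by
    change ∑ i ∈ Finset.range (j + 1), (m i + 1) < ∑ i ∈ Finset.range (j + 1 + 1), (m i + 1)
    rw [Finset.sum_range_succ _ (j + 1)]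
    omega
  have hmN : ∀ j, m j ≤ N j := fun j => by
    change m j ≤ ∑ i ∈ Finset.range (j + 1), (m i + 1)
    rw [Finset.sum_range_succ]
    omega
  have step : ∀ (j : ℕ) (s : M), ∃ s' : M, dist s s' ≤ 2 / 2 / 2 ^ j ∧
      (∀ i < N (j + 1), ‖(T ^ i) (s : X)‖ ≤ ‖(T ^ i) (s' : X)‖) ∧
      ∀ i, N j ≤ i → i < N (j + 1) → 2 ≤ ‖(T ^ i) (s' : X)‖ := by
    intro j s
    have hS : ∀ i : ℕ, ∃ S : Set (X →L[ℂ] ℂ), S.Finite ∧ (N j ≤ i →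
        ∀ y : X, (∀ φ ∈ S, φ y = 0) → 4 * 2 ^ j * ‖y‖ ≤ ‖(T ^ i) y‖) := by
      intro i
      by_cases hi : N j ≤ i
      · obtain ⟨S, hS, h⟩ := hm j i ((hmN j).trans hi)
        exact ⟨S, hS, fun _ => h⟩
      · exact ⟨∅, Set.finite_empty, fun h => absurd h hi⟩
    choose S hSf hS using hS
    have hψ : ∀ i : ℕ, ∃ ψ : X →L[ℂ] ℂ, ‖ψ‖ ≤ 1 ∧ ψ ((T ^ i) (s : X)) = ‖(T ^ i) (s : X)‖ :=
      fun i => exists_dual_vector'' ℂ _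
    choose ψ hψ1 hψ using hψ
    obtain ⟨x, hxM, hx0, hx⟩ := exists_ne_zero_mem_of_finite_functionals hM
      (S := ⋃ i ∈ Set.Iio (N (j + 1)), (S i ∪ {(ψ i).comp (T ^ i)}))
      ((Set.finite_Iio _).biUnion fun i _ => (hSf i).union (Set.finite_singleton _))
    have hn : 0 < ‖x‖ := norm_pos_iff.2 hx0
    set a : ℂ := ((1 / 2) ^ j : ℝ) * (‖x‖ : ℂ)⁻¹ with ha
    have hax : ‖a • x‖ = (1 / 2) ^ j := by
      rw [norm_smul, ha, norm_mul, Complex.norm_real, norm_inv, Complex.norm_real, norm_norm,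
        mul_assoc, inv_mul_cancel₀ hn.ne', mul_one, Real.norm_of_nonneg (by positivity)]
    have hS' : ∀ i < N (j + 1), ∀ φ ∈ S i, φ (a • x) = 0 := fun i hi φ hφ => by
      rw [map_smul, hx φ (Set.mem_biUnion hi (Or.inl hφ)), smul_zero]
    have hψ' : ∀ i < N (j + 1), ψ i ((T ^ i) (a • x)) = 0 := fun i hi => by
      have : (ψ i).comp (T ^ i) (a • x) = 0 := by
        rw [map_smul, hx _ (Set.mem_biUnion hi (Or.inr rfl)), smul_zero]
      exact this
    have hmono : ∀ i < N (j + 1), ‖(T ^ i) (s : X)‖ ≤ ‖(T ^ i) ((s : X) + a • x)‖ := by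
      intro i hi
      have h1 : ψ i ((T ^ i) ((s : X) + a • x)) = ‖(T ^ i) (s : X)‖ := by
        rw [map_add, map_add, hψ' i hi, add_zero, hψ]
      calc ‖(T ^ i) (s : X)‖ = ‖ψ i ((T ^ i) ((s : X) + a • x))‖ := by rw [h1]; simp
        _ ≤ 1 * ‖(T ^ i) ((s : X) + a • x)‖ := (ψ i).le_of_opNorm_le (hψ1 i) _
        _ = _ := one_mul _
    refine ⟨s + ⟨a • x, M.smul_mem a hxM⟩, ?_, hmono, ?_⟩
    · rw [dist_self_add_right]
      change ‖a • x‖ ≤ _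
      rw [hax]
      refine le_of_eq ?_
      rw [one_div_pow]
      ring
    · intro i hi hi'
      have h1 := hS i hi (a • x) (hS' i hi')
      have h3 : 4 * 2 ^ j * ‖a • x‖ = 4 := by
        rw [hax, mul_assoc, ← mul_pow]; norm_num
      have h4 : ‖(T ^ i) (a • x)‖ ≤ ‖(T ^ i) ((s : X) + a • x)‖ + ‖(T ^ i) (s : X)‖ := by
        refine le_of_eq_of_le ?_ (norm_sub_le _ _)
        rw [map_add, add_sub_cancel_left]
      have h5 := hmono i hi'
      change 2 ≤ ‖(T ^ i) ((s : X) + a • x)‖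
      linarith
  choose f hf1 hf2 hf3 using step
  obtain ⟨s, hs⟩ : ∃ s : ℕ → M, ∀ j, s (j + 1) = f j (s j) :=
    ⟨fun n => Nat.rec 0 f n, fun _ => rfl⟩
  have : CompleteSpace M := hMc.completeSpace_coe
  have hcau : CauchySeq s := cauchySeq_of_le_geometric_two (C := 2) fun j => by
    rw [hs]
    exact hf1 j (s j)
  obtain ⟨x, hx⟩ := cauchySeq_tendsto_of_complete hcau
  refine ⟨x, x.2, N 0, fun i hi => ?_⟩
  obtain ⟨j, hj⟩ : ∃ j, N j ≤ i ∧ i < N (j + 1) := by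
    have hex : ∃ j, i < N j := ⟨i + 1, lt_of_lt_of_le (Nat.lt_succ_self i) (hN.id_le _)⟩
    classical
    have hpos : Nat.find hex ≠ 0 := fun h0 => by
      have := Nat.find_spec hex
      rw [h0] at this
      omega
    obtain ⟨j, hj⟩ := Nat.exists_eq_succ_of_ne_zero hpos
    refine ⟨j, not_lt.1 (Nat.find_min hex (m := j) (by omega)), ?_⟩
    have := Nat.find_spec hex
    rwa [hj] at this
  have hlow : ∀ k : ℕ, 2 ≤ ‖(T ^ i) (s (j + 1 + k) : X)‖ := by
    intro k
    induction k with
    | zero =>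
      rw [add_zero, hs]
      exact hf3 j (s j) i hj.1 hj.2
    | succ k ih =>
      rw [← add_assoc, hs]
      exact ih.trans (hf2 (j + 1 + k) _ i (hj.2.trans_le (hN.monotone (by omega))))
  have hlim : Tendsto (fun k => ‖(T ^ i) (s (k + (j + 1)) : X)‖) atTop (𝓝 ‖(T ^ i) (x : X)‖) :=
    (((T ^ i).continuous.comp continuous_subtype_val).norm.tendsto x).comp
      ((tendsto_add_atTop_iff_nat (j + 1)).2 hx)
  refine ge_of_tendsto' hlim fun k => ?_
  rw [add_comm]
  exact hlow k

lemma exists_isEssentialApproxEigenvalue_of_hypercyclic_subspace [CompleteSpace X]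
    {T : X →L[ℂ] X} {M : Submodule ℂ X} (hMc : IsClosed (M : Set X)) (hM : ¬ Module.Finite ℂ M)
    (h : ∀ x ∈ M, x ≠ 0 → DenseRange fun n : ℕ => (T ^ n) x) :
    ∃ l : ℂ, ‖l‖ ≤ 1 ∧ IsEssentialApproxEigenvalue T l := by
  by_contra! hT
  obtain ⟨x, hxM, n₀, hx⟩ := exists_mem_forall_two_le_norm_pow hT hMc hM
  have hx0 : x ≠ 0 := by
    rintro rfl
    have := hx n₀ le_rfl
    simp at this
    linarith
  have : Nontrivial X := ⟨x, 0, hx0⟩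
  have : ∀ y : X, NeBot (𝓝[≠] y) := fun y => Module.punctured_nhds_neBot ℂ X y
  obtain ⟨n, hn, hn'⟩ := (h x hxM hx0).exists_ge_mem (Metric.isOpen_ball (x := (0 : X)) (ε := 1))
    ⟨0, Metric.mem_ball_self one_pos⟩ n₀
  have h1 := hx n hn
  have h2 : ‖(T ^ n) x‖ < 1 := by simpa using hn'
  linarith

end EssentialSpectrum

section BasicSequences

variable {X : Type*} [NormedAddCommGroup X] [NormedSpace ℂ X]

/-- A sequence whose initial spans are complemented in its span by the corresponding tails, with
projections of norm at most `2`. -/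
def IsBasicSequence (f : ℕ → X) : Prop :=
  ∀ s : ℕ, ∀ v ∈ Submodule.span ℂ (f '' Set.Iio s), ∀ w ∈ Submodule.span ℂ (f '' Set.Ici s),
    ‖v‖ ≤ 2 * ‖v + w‖

lemma IsBasicSequence.comp_strictMono {f : ℕ → X} (hf : IsBasicSequence f) {ι : ℕ → ℕ}
    (hι : StrictMono ι) : IsBasicSequence (f ∘ ι) := by
  intro s v hv w hw
  refine hf (ι s) v (Submodule.span_mono ?_ hv) w (Submodule.span_mono ?_ hw)
  · rintro _ ⟨i, hi, rfl⟩
    exact ⟨ι i, hι hi, rfl⟩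
  · rintro _ ⟨i, hi, rfl⟩
    exact ⟨ι i, hι.monotone hi, rfl⟩

/-- In an infinite-dimensional setting, basic sequences can be chosen step by step subject to any
property available in every finite-codimensional subspace. -/
lemma exists_isBasicSequence {p : ℕ → X → Prop}
    (hp : ∀ (n : ℕ) (S : Set (X →L[ℂ] ℂ)), S.Finite → ∃ y, p n y ∧ ∀ φ ∈ S, φ y = 0) :
    ∃ f : ℕ → X, IsBasicSequence f ∧ ∀ n, p n (f n) := by
  have hmaz : ∀ F : {F : Submodule ℂ X // FiniteDimensional ℂ F},
      ∃ S : Set (X →L[ℂ] ℂ), S.Finite ∧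
        ∀ v ∈ F.1, ∀ w : X, (∀ φ ∈ S, φ w = 0) → ‖v‖ ≤ 2 * ‖v + w‖ := fun F =>
    haveI := F.2
    exists_finite_functionals_norm_le_two_mul F.1
  choose Maz hMazf hMaz using hmaz
  choose y hyp hy using fun (n : ℕ) (S : {S : Set (X →L[ℂ] ℂ) // S.Finite}) => hp n S.1 S.2
  have hfd : ∀ (F : {F : Submodule ℂ X // FiniteDimensional ℂ F}) (z : X),
      FiniteDimensional ℂ ↥(F.1 ⊔ Submodule.span ℂ {z}) := fun F z => by
    have := F.2
    infer_instance
  obtain ⟨st, hst0, hst⟩ : ∃ st : ℕ → {F : Submodule ℂ X // FiniteDimensional ℂ F} ×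
      {S : Set (X →L[ℂ] ℂ) // S.Finite},
      (∀ v ∈ (st 0).1.1, ∀ w : X, (∀ φ ∈ (st 0).2.1, φ w = 0) → ‖v‖ ≤ 2 * ‖v + w‖) ∧
      ∀ n, st (n + 1) = (⟨_, hfd (st n).1 (y n (st n).2)⟩,
        ⟨(st n).2.1 ∪ Maz ⟨_, hfd (st n).1 (y n (st n).2)⟩, (st n).2.2.union (hMazf _)⟩) := by
    refine ⟨fun n => Nat.rec (⟨⊥, inferInstance⟩, ⟨∅, Set.finite_empty⟩) (fun n s =>
      (⟨_, hfd s.1 (y n s.2)⟩, ⟨s.2.1 ∪ Maz ⟨_, hfd s.1 (y n s.2)⟩, s.2.2.union (hMazf _)⟩)) n,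
      ?_, fun n => rfl⟩
    intro v hv w _
    have : v = 0 := (Submodule.mem_bot ℂ).1 hv
    rw [this]
    simp
  let f : ℕ → X := fun n => y n (st n).2
  have hF : ∀ n, (st (n + 1)).1.1 = (st n).1.1 ⊔ Submodule.span ℂ {f n} := fun n => by rw [hst]
  have hS : ∀ n, (st (n + 1)).2.1 = (st n).2.1 ∪ Maz (st (n + 1)).1 := fun n => by rw [hst]
  have hFmono : Monotone fun n => (st n).1.1 := monotone_nat_of_le_succ fun n => by
    rw [hF]; exact le_sup_left
  have hSmono : Monotone fun n => (st n).2.1 := monotone_nat_of_le_succ fun n => by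
    rw [hS]; exact Set.subset_union_left
  have hcompl : ∀ s, ∀ v ∈ (st s).1.1, ∀ w : X, (∀ φ ∈ (st s).2.1, φ w = 0) →
      ‖v‖ ≤ 2 * ‖v + w‖ := by
    intro s
    cases s with
    | zero => exact hst0
    | succ s =>
      intro v hv w hw
      refine hMaz _ v hv w fun φ hφ => hw φ ?_
      rw [hS]
      exact Or.inr hφ
  refine ⟨f, fun s v hv w hw => hcompl s v ?_ w ?_, fun n => hyp n _⟩
  · refine Submodule.span_le.2 ?_ hv
    rintro _ ⟨i, hi, rfl⟩
    refine hFmono (Nat.succ_le_of_lt hi) ?_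
    change f i ∈ (st (i + 1)).1.1
    rw [hF]
    exact Submodule.mem_sup_right (Submodule.mem_span_singleton_self _)
  · intro φ hφ
    have : Submodule.span ℂ (f '' Set.Ici s) ≤ LinearMap.ker (φ : X →ₗ[ℂ] ℂ) := by
      refine Submodule.span_le.2 ?_
      rintro _ ⟨i, hi, rfl⟩
      exact hy i (st i).2 φ (hSmono hi hφ)
    exact this hw

lemma IsBasicSequence.norm_sum_range_le {g : ℕ → X} (hg : IsBasicSequence g) (a : ℕ → ℂ)
    {s N : ℕ} (hs : s ≤ N) :
    ‖∑ i ∈ Finset.range s, a i • g i‖ ≤ 2 * ‖∑ i ∈ Finset.range N, a i • g i‖ := by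
  rw [← Finset.sum_range_add_sum_Ico _ hs]
  refine hg s _ ?_ _ ?_
  · exact Submodule.sum_mem _ fun i hi => Submodule.smul_mem _ _
      (Submodule.subset_span ⟨i, Finset.mem_range.1 hi, rfl⟩)
  · exact Submodule.sum_mem _ fun i hi => Submodule.smul_mem _ _
      (Submodule.subset_span ⟨i, (Finset.mem_Ico.1 hi).1, rfl⟩)

lemma linearCombination_eq_sum_range (g : ℕ → X) (a : ℕ →₀ ℂ) :
    ∃ N₀, ∀ N, N₀ ≤ N → ∑ i ∈ Finset.range N, a i • g i = Finsupp.linearCombination ℂ g a := by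
  refine ⟨a.support.sup id + 1, fun N hN => ?_⟩
  rw [Finsupp.linearCombination_apply, Finsupp.sum_of_support_subset]
  · intro i hi
    exact Finset.mem_range.2 (lt_of_lt_of_le (Nat.lt_succ_of_le (Finset.le_sup (f := id) hi)) hN)
  · simp

lemma IsBasicSequence.norm_coeff_le {g : ℕ → X} (hg : IsBasicSequence g) (hg1 : ∀ i, ‖g i‖ = 1)
    (a : ℕ →₀ ℂ) (i : ℕ) : ‖a i‖ ≤ 4 * ‖Finsupp.linearCombination ℂ g a‖ := by
  obtain ⟨N₀, hN₀⟩ := linearCombination_eq_sum_range g a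
  rw [← hN₀ (max N₀ (i + 1)) (le_max_left _ _)]
  have h1 := hg.norm_sum_range_le a (le_max_right N₀ (i + 1))
  have h2 := hg.norm_sum_range_le a ((Nat.le_succ i).trans (le_max_right N₀ (i + 1)))
  have h3 : a i • g i = ∑ j ∈ Finset.range (i + 1), a j • g j - ∑ j ∈ Finset.range i, a j • g j := by
    rw [Finset.sum_range_succ, add_sub_cancel_left]
  have h4 : ‖a i‖ = ‖a i • g i‖ := by rw [norm_smul, hg1, mul_one]
  rw [h4, h3]
  refine (norm_sub_le _ _).trans ?_
  linarith

lemma IsBasicSequence.linearIndependent {g : ℕ → X} (hg : IsBasicSequence g)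
    (hg1 : ∀ i, ‖g i‖ = 1) : LinearIndependent ℂ g := by
  rw [linearIndependent_iff]
  intro a ha
  ext i
  have := hg.norm_coeff_le hg1 a i
  rw [ha, norm_zero, mul_zero] at this
  simpa using this

/-- Coefficient functionals of a normalized basic sequence. -/
lemma IsBasicSequence.exists_coeff {g : ℕ → X} (hg : IsBasicSequence g) (hg1 : ∀ i, ‖g i‖ = 1) :
    ∃ ψ : ℕ → X →L[ℂ] ℂ, (∀ i, ‖ψ i‖ ≤ 4) ∧ (∀ i j, ψ i (g j) = if i = j then 1 else 0) ∧
      (∀ x ∈ Submodule.span ℂ (Set.range g), ∃ N₀, ∀ N, N₀ ≤ N →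
        ∑ i ∈ Finset.range N, ψ i x • g i = x) ∧
      ∀ x ∈ Submodule.span ℂ (Set.range g), ∀ s,
        ‖∑ i ∈ Finset.range s, ψ i x • g i‖ ≤ 2 * ‖x‖ := by
  have hli := hg.linearIndependent hg1
  have hψ : ∀ i : ℕ, ∃ ψ : X →L[ℂ] ℂ, ‖ψ‖ ≤ 4 ∧
      ∀ a : ℕ →₀ ℂ, ψ (Finsupp.linearCombination ℂ g a) = a i := by
    intro i
    let ψ₀ : StrongDual ℂ (Submodule.span ℂ (Set.range g)) :=
      LinearMap.mkContinuous (Finsupp.lapply i ∘ₗ hli.repr) 4 (by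
        intro x
        have := hg.norm_coeff_le hg1 (hli.repr x) i
        rwa [hli.linearCombination_repr] at this)
    obtain ⟨ψ, hψ, hψn⟩ := exists_extension_norm_eq _ ψ₀
    refine ⟨ψ, ?_, fun a => ?_⟩
    · rw [hψn]
      exact LinearMap.mkContinuous_norm_le _ (by norm_num) _
    · have hmem : Finsupp.linearCombination ℂ g a ∈ Submodule.span ℂ (Set.range g) :=
        Finsupp.mem_span_range_iff_exists_finsupp.2 ⟨a, rfl⟩
      have h1 := hψ ⟨_, hmem⟩
      rw [h1]
      change (hli.repr ⟨_, hmem⟩) i = a i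
      rw [hli.repr_eq (l := a) rfl]
  choose ψ hψn hψ using hψ
  have hrep : ∀ x ∈ Submodule.span ℂ (Set.range g), ∃ N₀, ∀ N, N₀ ≤ N →
        ∑ i ∈ Finset.range N, ψ i x • g i = x := by
    intro x hx
    obtain ⟨a, rfl⟩ := Finsupp.mem_span_range_iff_exists_finsupp.1 hx
    change ∃ N₀, ∀ N, N₀ ≤ N → ∑ i ∈ Finset.range N,
      ψ i (Finsupp.linearCombination ℂ g a) • g i = Finsupp.linearCombination ℂ g a
    simp_rw [hψ]
    exact linearCombination_eq_sum_range g a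
  refine ⟨ψ, hψn, fun i j => ?_, hrep, fun x hx s => ?_⟩
  · have := hψ i (Finsupp.single j 1)
    rw [Finsupp.linearCombination_single, one_smul] at this
    rw [this, Finsupp.single_apply]
    simp [eq_comm]
  · obtain ⟨N₀, hN₀⟩ := hrep x hx
    have := hg.norm_sum_range_le (fun i => ψ i x) (le_max_right N₀ s)
    rwa [hN₀ _ (le_max_left _ _)] at this

lemma tendsto_sum_range_of_mem_topologicalClosure {g : ℕ → X} {ψ : ℕ → X →L[ℂ] ℂ}
    (hrep : ∀ x ∈ Submodule.span ℂ (Set.range g), ∃ N₀, ∀ N, N₀ ≤ N →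
      ∑ i ∈ Finset.range N, ψ i x • g i = x)
    (hbd : ∀ x ∈ Submodule.span ℂ (Set.range g), ∀ s,
      ‖∑ i ∈ Finset.range s, ψ i x • g i‖ ≤ 2 * ‖x‖)
    {x : X} (hx : x ∈ (Submodule.span ℂ (Set.range g)).topologicalClosure) :
    Tendsto (fun s => ∑ i ∈ Finset.range s, ψ i x • g i) atTop (𝓝 x) := by
  let P : ℕ → X →L[ℂ] X := fun s => ∑ i ∈ Finset.range s, (ψ i).smulRight (g i)
  have hP : ∀ s x, P s x = ∑ i ∈ Finset.range s, ψ i x • g i := fun s x => by simp [P]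
  have hbd' : ∀ s, ∀ x ∈ closure (Submodule.span ℂ (Set.range g) : Set X), ‖P s x‖ ≤ 2 * ‖x‖ := by
    intro s
    refine fun x hx => closure_minimal (t := {x | ‖P s x‖ ≤ 2 * ‖x‖}) ?_
      (isClosed_le (P s).continuous.norm (continuous_const.mul continuous_norm)) hx
    intro x hx
    change ‖P s x‖ ≤ 2 * ‖x‖
    rw [hP]
    exact hbd x hx s
  simp_rw [← hP]
  rw [Metric.tendsto_atTop]
  intro ε hε
  obtain ⟨x', hx', hd⟩ := Metric.mem_closure_iff.1 hx (ε / 4) (by positivity)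
  obtain ⟨N₀, hN₀⟩ := hrep x' hx'
  refine ⟨N₀, fun s hs => ?_⟩
  have h1 : P s x' = x' := by rw [hP, hN₀ s hs]
  have h2 : ‖P s (x - x')‖ ≤ 2 * ‖x - x'‖ := hbd' s _
    ((Submodule.span ℂ (Set.range g)).topologicalClosure.sub_mem hx (subset_closure hx'))
  rw [dist_eq_norm] at hd ⊢
  have h3 : P s x - x = P s (x - x') - (x - x') := by rw [map_sub, h1]; abel
  rw [h3]
  refine (norm_sub_le _ _).trans_lt ?_
  linarith

end BasicSequences

section ApproximateEigenvectors

variable {X : Type*} [NormedAddCommGroup X] [NormedSpace ℂ X]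

lemma norm_pow_sub_pow_smul_le (T : X →L[ℂ] X) {l : ℂ} (hl : ‖l‖ ≤ 1) (y : X) (m : ℕ) :
    ‖(T ^ m) y - l ^ m • y‖ ≤ (1 + ‖T‖) ^ m * ‖T y - l • y‖ := by
  induction m with
  | zero => simp
  | succ m ih =>
    have h1 : (T ^ (m + 1)) y - l ^ (m + 1) • y =
        T ((T ^ m) y - l ^ m • y) + l ^ m • (T y - l • y) := by
      rw [map_sub, map_smul, pow_succ' T, pow_succ l, smul_sub, smul_smul, mul_apply_eq_comp]
      abel
    have h2 : ‖T ((T ^ m) y - l ^ m • y)‖ ≤ ‖T‖ * ((1 + ‖T‖) ^ m * ‖T y - l • y‖) :=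
      T.le_opNorm_of_le ih
    have h3 : ‖l ^ m • (T y - l • y)‖ ≤ (1 + ‖T‖) ^ m * ‖T y - l • y‖ := by
      rw [norm_smul, norm_pow]
      refine mul_le_mul_of_nonneg_right ?_ (norm_nonneg _)
      calc ‖l‖ ^ m ≤ 1 := pow_le_one₀ (norm_nonneg _) hl
        _ ≤ (1 + ‖T‖) ^ m := one_le_pow₀ (by linarith [norm_nonneg T])
    rw [h1]
    refine (norm_add_le _ _).trans ((add_le_add h2 h3).trans (le_of_eq ?_))
    ring

lemma IsEssentialApproxEigenvalue.exists_isBasicSequence {T : X →L[ℂ] X} {l : ℂ} (hl : ‖l‖ ≤ 1)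
    (hT : IsEssentialApproxEigenvalue T l) {ε : ℕ → ℝ} (hε : ∀ i, 0 < ε i) :
    ∃ f : ℕ → X, IsBasicSequence f ∧ (∀ i, ‖f i‖ = 1) ∧
      ∀ i, ∀ m ≤ i, ‖(T ^ m) (f i) - l ^ m • f i‖ ≤ ε i := by
  obtain ⟨f, hf, hfp⟩ := _root_.exists_isBasicSequence
    (p := fun i y => ‖y‖ = 1 ∧ ∀ m ≤ i, ‖(T ^ m) y - l ^ m • y‖ ≤ ε i) (by
      intro i S hS
      have hpos : 0 < 1 + ‖T‖ := by positivity
      obtain ⟨y, hy1, hyS, hy⟩ := hT (ε i / (1 + ‖T‖) ^ i)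
        (div_pos (hε i) (by positivity)) S hS
      refine ⟨y, ⟨hy1, fun m hm => ?_⟩, hyS⟩
      refine (norm_pow_sub_pow_smul_le T hl y m).trans ?_
      rw [lt_div_iff₀ (by positivity)] at hy
      calc (1 + ‖T‖) ^ m * ‖T y - l • y‖ ≤ (1 + ‖T‖) ^ i * ‖T y - l • y‖ := by
            gcongr
            linarith [norm_nonneg T]
        _ ≤ ε i := by rw [mul_comm]; exact hy.le)
  exact ⟨f, hf, fun i => (hfp i).1, fun i => (hfp i).2⟩

end ApproximateEigenvectors

section Perturbation

variable {X : Type*} [NormedAddCommGroup X] [NormedSpace ℂ X]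

/-- The inductive construction: starting from a sequence `f`, pick iterates `μ` and successive
small perturbations `z r` of `fun j => f (μ j + 1)` that are sent close to the targets `q`. -/
lemma exists_iterates_and_perturbations [Nontrivial X] {T : X →L[ℂ] X}
    (hwm : ∃ z : X × X, DenseRange fun n : ℕ => ((T ^ n) z.1, (T ^ n) z.2))
    (f : ℕ → X) (q : ℕ → ℕ → X) {η : ℕ → ℝ} (hη : ∀ s, 0 < η s) :
    ∃ (μ : ℕ → ℕ) (z : ℕ → ℕ → X), StrictMono μ ∧ μ 0 = 0 ∧
      (∀ r j : ℕ, r ≤ j → z r j = f (μ j + 1)) ∧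
      (∀ r j : ℕ, ‖z (r + 1) j - z r j‖ ≤ η r / (1 + ‖T‖) ^ μ r) ∧
      ∀ s j : ℕ, j ≤ s → ‖(T ^ μ (s + 1)) (z (s + 1) j) - q s j‖ ≤ η s := by
  have hT : 1 ≤ 1 + ‖T‖ := by linarith [norm_nonneg T]
  have step : ∀ (s m : ℕ) (u : ℕ → X), ∃ (m' : ℕ) (v : ℕ → X), m < m' ∧ ∀ j ≤ s,
      ‖v j - Function.update u s (f (m + 1)) j‖ ≤ η s / (1 + ‖T‖) ^ m ∧
      ‖(T ^ m') (v j) - q s j‖ ≤ η s := by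
    intro s m u
    have hpos : 0 < η s / (1 + ‖T‖) ^ m := div_pos (hη s) (by positivity)
    obtain ⟨m', hm', v, hv⟩ := exists_common_iterate_of_weaklyMixing hwm
      (Function.update u s (f (m + 1))) (q s) hpos (s + 1) (m + 1)
    refine ⟨m', v, hm', fun j hj => ⟨(hv j (Nat.lt_succ_of_le hj)).1.le, ?_⟩⟩
    exact (hv j (Nat.lt_succ_of_le hj)).2.le.trans
      (div_le_self (hη s).le (one_le_pow₀ hT))
  choose mm vv hmm hvv using step
  obtain ⟨st, hst0, hst⟩ : ∃ st : ℕ → ℕ × (ℕ → X), st 0 = (0, 0) ∧ ∀ n : ℕ,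
      st (n + 1) = (mm n (st n).1 (st n).2, vv n (st n).1 (st n).2) :=
    ⟨fun n => Nat.rec (0, 0) (fun k p => (mm k p.1 p.2, vv k p.1 p.2)) n, rfl, fun _ => rfl⟩
  refine ⟨fun n => (st n).1, fun r j => if r ≤ j then f ((st j).1 + 1) else (st r).2 j,
    ?_, by simp [hst0], ?_, ?_, ?_⟩
  · refine strictMono_nat_of_lt_succ fun n => ?_
    simp only [hst]
    exact hmm _ _ _
  · intro r j hrj
    simp [hrj]
  · intro r j
    have hpos : 0 ≤ η r / (1 + ‖T‖) ^ (st r).1 := div_nonneg (hη r).le (by positivity)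
    rcases lt_trichotomy j r with h | rfl | h
    · have h1 : ¬ r + 1 ≤ j := by omega
      have h2 : ¬ r ≤ j := by omega
      have := (hvv r (st r).1 (st r).2 j h.le).1
      rw [Function.update_of_ne h.ne] at this
      simpa only [h1, h2, if_false, hst] using this
    · have := (hvv j (st j).1 (st j).2 j le_rfl).1
      rw [Function.update_self] at this
      have h1 : ¬ j + 1 ≤ j := by omega
      simpa only [h1, le_refl, if_true, if_false, hst] using this
    · have h1 : r + 1 ≤ j := h
      simpa only [h1, h.le, if_true, sub_self, norm_zero] using hpos
  · intro s j hj
    have h1 : ¬ s + 1 ≤ j := by omega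
    have := (hvv s (st s).1 (st s).2 j hj).2
    simpa only [h1, if_false, hst] using this

/-- Passing to the limit in `exists_iterates_and_perturbations`. -/
lemma exists_iterates_and_perturbation [CompleteSpace X] [Nontrivial X] {T : X →L[ℂ] X}
    (hwm : ∃ z : X × X, DenseRange fun n : ℕ => ((T ^ n) z.1, (T ^ n) z.2))
    (f : ℕ → X) (q : ℕ → ℕ → X) {c : ℝ} (hc : 0 < c) :
    ∃ (μ : ℕ → ℕ) (e : ℕ → X), StrictMono μ ∧ μ 0 = 0 ∧
      (∀ p j : ℕ, p ≤ j → ‖(T ^ μ p) (e j - f (μ j + 1))‖ ≤ 2 * (c / 2 ^ j)) ∧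
      ∀ s j : ℕ, j ≤ s → ‖(T ^ μ (s + 1)) (e j) - q s j‖ ≤ 2 * (c / 2 ^ s) := by
  obtain ⟨μ, z, hμ, hμ0, hz, hzd, hzq⟩ := exists_iterates_and_perturbations hwm f q
    (η := fun s => c / 2 ^ s) (fun s => by positivity)
  have hT : 1 ≤ 1 + ‖T‖ := by linarith [norm_nonneg T]
  have hstep : ∀ p r j : ℕ, p ≤ r → ‖(T ^ μ p) (z (r + 1) j - z r j)‖ ≤ c / 2 ^ r := by
    intro p r j hpr
    have h1 : ‖T ^ μ p‖ ≤ (1 + ‖T‖) ^ μ r :=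
      calc ‖T ^ μ p‖ ≤ ‖T‖ ^ μ p := by
            rcases Nat.eq_zero_or_pos (μ p) with h | h
            · rw [h, pow_zero, pow_zero]
              exact ContinuousLinearMap.norm_id_le
            · exact norm_pow_le' T h
        _ ≤ (1 + ‖T‖) ^ μ p := by gcongr; linarith
        _ ≤ (1 + ‖T‖) ^ μ r := pow_le_pow_right₀ hT (hμ.monotone hpr)
    calc ‖(T ^ μ p) (z (r + 1) j - z r j)‖
        ≤ (1 + ‖T‖) ^ μ r * (c / 2 ^ r / (1 + ‖T‖) ^ μ r) :=
          (T ^ μ p).le_of_opNorm_le_of_le h1 (hzd r j)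
      _ = c / 2 ^ r := by field_simp
  have hlim : ∀ j : ℕ, ∃ e : X, Tendsto (fun r => z r j) atTop (𝓝 e) := by
    intro j
    refine cauchySeq_tendsto_of_complete (cauchySeq_of_le_geometric_two (C := 2 * c) fun r => ?_)
    have := hstep 0 r j (Nat.zero_le _)
    rw [hμ0, pow_zero] at this
    rw [dist_comm, dist_eq_norm]
    refine this.trans (le_of_eq ?_)
    ring
  choose e he using hlim
  have hclose : ∀ p r j : ℕ, p ≤ r → ‖(T ^ μ p) (e j) - (T ^ μ p) (z r j)‖ ≤ 2 * (c / 2 ^ r) := by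
    intro p r j hpr
    have h := dist_le_of_le_geometric_two_of_tendsto₀
      (f := fun k => (T ^ μ p) (z (k + r) j)) (a := (T ^ μ p) (e j)) (C := 2 * (c / 2 ^ r)) ?_ ?_
    · rwa [Nat.zero_add, dist_comm, dist_eq_norm] at h
    · intro k
      rw [dist_comm, dist_eq_norm, ← map_sub, add_right_comm]
      refine (hstep p (k + r) j (hpr.trans (Nat.le_add_left _ _))).trans (le_of_eq ?_)
      rw [pow_add]
      field_simp
    · exact (((T ^ μ p).continuous.tendsto _).comp ((tendsto_add_atTop_iff_nat r).2 (he j)))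
  refine ⟨μ, e, hμ, hμ0, ?_, ?_⟩
  · intro p j hpj
    rw [map_sub, ← hz j j le_rfl]
    exact hclose p j j hpj
  · intro s j hj
    have h1 := hclose (s + 1) (s + 1) j le_rfl
    have h2 := hzq s j hj
    calc ‖(T ^ μ (s + 1)) (e j) - q s j‖
        ≤ ‖(T ^ μ (s + 1)) (e j) - (T ^ μ (s + 1)) (z (s + 1) j)‖ +
            ‖(T ^ μ (s + 1)) (z (s + 1) j) - q s j‖ := norm_sub_le_norm_sub_add_norm_sub _ _ _
      _ ≤ 2 * (c / 2 ^ (s + 1)) + c / 2 ^ s := add_le_add h1 h2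
      _ = 2 * (c / 2 ^ s) := by rw [pow_succ]; ring

end Perturbation

section Transfer

variable {X : Type*} [NormedAddCommGroup X] [NormedSpace ℂ X]

/-- Small perturbations of a sequence with uniformly bounded coordinate functionals are
images of the sequence under an automorphism of the space. -/
lemma exists_continuousLinearEquiv_apply_eq [CompleteSpace X] {g e : ℕ → X}
    {ψ : ℕ → X →L[ℂ] ℂ} (hψ : ∀ i, ‖ψ i‖ ≤ 4) (hψg : ∀ i j, ψ i (g j) = if i = j then 1 else 0)
    (he : ∀ j : ℕ, ‖e j - g j‖ ≤ 1 / 32 / 2 ^ j) :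
    ∃ A : X ≃L[ℂ] X, ∀ j, A (g j) = e j := by
  have hgeo : HasSum (fun j : ℕ => (1 / 4 / 2 / 2 ^ j : ℝ)) (1 / 4) := hasSum_geometric_two' _
  have hK : ∀ j : ℕ, ‖(ψ j).smulRight (g j - e j)‖ ≤ 1 / 4 / 2 / 2 ^ j := by
    intro j
    rw [ContinuousLinearMap.norm_smulRight_apply, norm_sub_rev]
    calc ‖ψ j‖ * ‖e j - g j‖ ≤ 4 * (1 / 32 / 2 ^ j) :=
          mul_le_mul (hψ j) (he j) (norm_nonneg _) (by norm_num)
      _ = 1 / 4 / 2 / 2 ^ j := by ring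
  have hsum : Summable fun j : ℕ => (ψ j).smulRight (g j - e j) :=
    Summable.of_norm_bounded hgeo.summable hK
  have hlt : ‖∑' j : ℕ, (ψ j).smulRight (g j - e j)‖ < 1 :=
    (tsum_of_norm_bounded hgeo hK).trans_lt (by norm_num)
  refine ⟨ContinuousLinearEquiv.ofUnit (Units.oneSub _ hlt), fun j => ?_⟩
  have h1 : (∑' i : ℕ, (ψ i).smulRight (g i - e i)) (g j) = g j - e j := by
    have h2 := (ContinuousLinearMap.apply ℂ X (g j)).hasSum hsum.hasSum
    refine h2.unique ?_
    convert hasSum_ite_eq j (g j - e j) using 2 with i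
    simp only [ContinuousLinearMap.apply_apply, ContinuousLinearMap.smulRight_apply, hψg]
    by_cases h : i = j
    · simp [h]
    · simp [h]
  change ((1 : X →L[ℂ] X) - ∑' i : ℕ, (ψ i).smulRight (g i - e i)) (g j) = e j
  rw [sub_apply, h1]
  simp

/-- Uniform control of iterates on the tails of a basic expansion. -/
lemma norm_map_sub_sum_range_le {g : ℕ → X} {ψ : ℕ → X →L[ℂ] ℂ} (hψ : ∀ i, ‖ψ i‖ ≤ 4)
    (hψg : ∀ i j, ψ i (g j) = if i = j then 1 else 0)
    (hrep : ∀ x ∈ Submodule.span ℂ (Set.range g), ∃ N₀, ∀ N, N₀ ≤ N →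
      ∑ i ∈ Finset.range N, ψ i x • g i = x)
    {B : X →L[ℂ] X} {a : ℂ} (ha : ‖a‖ ≤ 1) {p : ℕ}
    (hB : ∀ j, p ≤ j → ‖B (g j) - a • g j‖ ≤ 1 / 16 / 2 ^ j)
    {x : X} (hx : x ∈ (Submodule.span ℂ (Set.range g)).topologicalClosure) :
    ‖B (x - ∑ i ∈ Finset.range p, ψ i x • g i)‖ ≤
      2 * ‖x - ∑ i ∈ Finset.range p, ψ i x • g i‖ := by
  have hcl : IsClosed {x : X | ‖B (x - ∑ i ∈ Finset.range p, ψ i x • g i)‖ ≤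
      2 * ‖x - ∑ i ∈ Finset.range p, ψ i x • g i‖} :=
    isClosed_le (by fun_prop) (by fun_prop)
  refine closure_minimal (s := (Submodule.span ℂ (Set.range g) : Set X)) ?_ hcl hx
  intro x hx
  rw [Set.mem_ofPred_eq]
  obtain ⟨N₀, hN₀⟩ := hrep x hx
  have hN := hN₀ (max N₀ p) (le_max_left _ _)
  have hw : x - ∑ i ∈ Finset.range p, ψ i x • g i =
      ∑ i ∈ Finset.Ico p (max N₀ p), ψ i x • g i := by
    rw [Finset.sum_Ico_eq_sub _ (le_max_right _ _), hN]
  have hco : ∀ i, p ≤ i → ψ i (x - ∑ i ∈ Finset.range p, ψ i x • g i) = ψ i x := by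
    intro i hi
    rw [map_sub, map_sum, Finset.sum_eq_zero, sub_zero]
    intro k hk
    have : i ≠ k := by have := Finset.mem_range.1 hk; omega
    rw [map_smul, hψg, if_neg this, smul_zero]
  set w := x - ∑ i ∈ Finset.range p, ψ i x • g i with hwdef
  have h1 : B w - a • w = ∑ i ∈ Finset.Ico p (max N₀ p), ψ i x • (B (g i) - a • g i) := by
    rw [hw, map_sum, Finset.smul_sum, ← Finset.sum_sub_distrib]
    refine Finset.sum_congr rfl fun i _ => ?_
    rw [map_smul, smul_sub, smul_comm]
  have h2 : ‖B w - a • w‖ ≤ 1 / 2 * ‖w‖ := by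
    rw [h1]
    calc ‖∑ i ∈ Finset.Ico p (max N₀ p), ψ i x • (B (g i) - a • g i)‖
        ≤ ∑ i ∈ Finset.Ico p (max N₀ p), (1 / 2 * ‖w‖) / 2 / 2 ^ i := by
          refine norm_sum_le_of_le _ fun i hi => ?_
          have hpi := (Finset.mem_Ico.1 hi).1
          rw [norm_smul, ← hco i hpi]
          calc ‖ψ i w‖ * ‖B (g i) - a • g i‖ ≤ (4 * ‖w‖) * (1 / 16 / 2 ^ i) :=
                mul_le_mul ((ψ i).le_of_opNorm_le (hψ i) w) (hB i hpi) (norm_nonneg _)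
                  (by positivity)
            _ = (1 / 2 * ‖w‖) / 2 / 2 ^ i := by ring
      _ ≤ 1 / 2 * ‖w‖ := sum_le_hasSum _ (fun i _ => by positivity) (hasSum_geometric_two' _)
  have h3 : ‖a • w‖ ≤ ‖w‖ := by
    rw [norm_smul]
    exact mul_le_of_le_one_left (norm_nonneg _) ha
  calc ‖B w‖ = ‖(B w - a • w) + a • w‖ := by rw [sub_add_cancel]
    _ ≤ 1 / 2 * ‖w‖ + ‖w‖ := (norm_add_le _ _).trans (add_le_add h2 h3)
    _ ≤ 2 * ‖w‖ := by linarith [norm_nonneg w]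

/-- Along a sequence of operators that is asymptotically prescribed on the initial segments of a
basic sequence and controlled on its tails, the images of vectors of the closed span are
asymptotically determined by their coordinates. -/
lemma tendsto_apply_sub_sum_range {g : ℕ → X} {ψ : ℕ → X →L[ℂ] ℂ} (hψ : ∀ i, ‖ψ i‖ ≤ 4)
    (hψg : ∀ i j, ψ i (g j) = if i = j then 1 else 0)
    (hrep : ∀ x ∈ Submodule.span ℂ (Set.range g), ∃ N₀, ∀ N, N₀ ≤ N →
      ∑ i ∈ Finset.range N, ψ i x • g i = x)
    (hbd : ∀ x ∈ Submodule.span ℂ (Set.range g), ∀ s,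
      ‖∑ i ∈ Finset.range s, ψ i x • g i‖ ≤ 2 * ‖x‖)
    {B : ℕ → X →L[ℂ] X} {a : ℕ → ℂ} (ha : ∀ s, ‖a s‖ ≤ 1) {q : ℕ → ℕ → X}
    (hB : ∀ s j : ℕ, s + 1 ≤ j → ‖B s (g j) - a s • g j‖ ≤ 1 / 16 / 2 ^ j)
    (hq : ∀ s j : ℕ, j ≤ s → ‖B s (g j) - q s j‖ ≤ 1 / 32 / 2 ^ s)
    {x : X} (hx : x ∈ (Submodule.span ℂ (Set.range g)).topologicalClosure) :
    Tendsto (fun s => B s x - ∑ j ∈ Finset.range (s + 1), ψ j x • q s j) atTop (𝓝 0) := by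
  have hP := tendsto_sum_range_of_mem_topologicalClosure hrep hbd hx
  have hP' : Tendsto (fun s => 2 * ‖x - ∑ i ∈ Finset.range (s + 1), ψ i x • g i‖) atTop (𝓝 0) := by
    have h := ((tendsto_const_nhds (x := x)).sub
      (hP.comp (tendsto_add_atTop_nat 1))).norm.const_mul 2
    simpa using h
  have hgeo : Tendsto (fun s : ℕ => ‖x‖ / 8 * (s * (1 / 2 : ℝ) ^ s + (1 / 2 : ℝ) ^ s))
      atTop (𝓝 0) := by
    have h1 := tendsto_self_mul_const_pow_of_lt_one (r := (1 / 2 : ℝ)) (by norm_num) (by norm_num)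
    have h2 := tendsto_pow_atTop_nhds_zero_of_lt_one (r := (1 / 2 : ℝ)) (by norm_num) (by norm_num)
    simpa using (h1.add h2).const_mul (‖x‖ / 8)
  have hlim := hgeo.add hP'
  rw [add_zero] at hlim
  refine squeeze_zero_norm (fun s => ?_) hlim
  have hdec : B s x - ∑ j ∈ Finset.range (s + 1), ψ j x • q s j =
      ∑ j ∈ Finset.range (s + 1), ψ j x • (B s (g j) - q s j) +
        B s (x - ∑ i ∈ Finset.range (s + 1), ψ i x • g i) := by
    simp only [smul_sub, Finset.sum_sub_distrib, map_sub, map_sum, map_smul]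
    abel
  rw [hdec]
  refine (norm_add_le _ _).trans (add_le_add ?_
    (norm_map_sub_sum_range_le hψ hψg hrep (ha s) (hB s) hx))
  calc ‖∑ j ∈ Finset.range (s + 1), ψ j x • (B s (g j) - q s j)‖
      ≤ ∑ _j ∈ Finset.range (s + 1), 4 * ‖x‖ * (1 / 32 / 2 ^ s) := by
        refine norm_sum_le_of_le _ fun j hj => ?_
        rw [norm_smul]
        exact mul_le_mul ((ψ j).le_of_opNorm_le (hψ j) x)
          (hq s j (Nat.lt_succ_iff.1 (Finset.mem_range.1 hj))) (norm_nonneg _) (by positivity)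
    _ = ‖x‖ / 8 * (s * (1 / 2 : ℝ) ^ s + (1 / 2 : ℝ) ^ s) := by
        rw [Finset.sum_const, Finset.card_range, nsmul_eq_mul, one_div_pow]
        push_cast
        ring

end Transfer

section Main

variable {X : Type*} [NormedAddCommGroup X] [NormedSpace ℂ X] [CompleteSpace X]

/-- For a weakly mixing operator with an essential approximate eigenvalue in the closed unit disc,
iterates along a suitable sequence act on some infinite-dimensional closed subspace like prescribed
rank-one maps. -/
lemma exists_subspace_tendsto_sub_smul {T : X →L[ℂ] X}
    (hwm : ∃ z : X × X, DenseRange fun n : ℕ => ((T ^ n) z.1, (T ^ n) z.2)) {l : ℂ}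
    (hl : ‖l‖ ≤ 1) (hT : IsEssentialApproxEigenvalue T l) {J : ℕ → ℕ} (hJ : ∀ s, J s ≤ s)
    (y : ℕ → X) :
    ∃ (M : Submodule ℂ X) (ν : ℕ → ℕ) (φ : ℕ → X → ℂ), IsClosed (M : Set X) ∧
      ¬ Module.Finite ℂ M ∧ StrictMono ν ∧ (∀ s, 0 < ν s) ∧
      (∀ x ∈ M, x ≠ 0 → ∃ j, φ j x ≠ 0) ∧
      ∀ x ∈ M, Tendsto (fun s => (T ^ ν s) x - φ (J s) x • y s) atTop (𝓝 0) := by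
  have hnt : Nontrivial X := by
    obtain ⟨u, hu, -⟩ := hT 1 one_pos ∅ Set.finite_empty
    exact nontrivial_of_ne u 0 (by rintro rfl; simp at hu)
  obtain ⟨f, hf, hf1, hfT⟩ := hT.exists_isBasicSequence hl
    (ε := fun i => 1 / 64 / 2 ^ i) (fun i => by positivity)
  obtain ⟨μ, e, hμ, hμ0, hclose, hq⟩ := exists_iterates_and_perturbation hwm f
    (fun s j => if j = J s then y s else 0) (c := 1 / 64) (by norm_num)
  have hι : StrictMono fun j => μ j + 1 := fun i j hij => Nat.succ_lt_succ (hμ hij)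
  set g : ℕ → X := f ∘ fun j => μ j + 1 with hgdef
  have hg : IsBasicSequence g := hf.comp_strictMono hι
  have hg1 : ∀ i, ‖g i‖ = 1 := fun i => hf1 _
  obtain ⟨ψ, hψ, hψg, hrep, hbd⟩ := hg.exists_coeff hg1
  have hgT : ∀ p j : ℕ, p ≤ j → ‖(T ^ μ p) (g j) - l ^ μ p • g j‖ ≤ 1 / 64 / 2 ^ j := by
    intro p j hpj
    refine (hfT (μ j + 1) (μ p) ((hμ.monotone hpj).trans (Nat.le_succ _))).trans ?_
    have : j ≤ μ j + 1 := hμ.le_apply.trans (Nat.le_succ _)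
    gcongr
    norm_num
  obtain ⟨A, hA⟩ := exists_continuousLinearEquiv_apply_eq hψ hψg (e := e) (fun j => by
    have h := hclose 0 j (Nat.zero_le j)
    rw [hμ0, pow_zero] at h
    refine le_trans h (le_of_eq ?_)
    ring)
  set Y := (Submodule.span ℂ (Set.range g)).topologicalClosure with hY
  have hgY : ∀ j, g j ∈ Y := fun j =>
    Submodule.le_topologicalClosure _ (Submodule.subset_span ⟨j, rfl⟩)
  refine ⟨Y.comap (A.symm : X →ₗ[ℂ] X), fun s => μ (s + 1), fun j x => ψ j (A.symm x),
    ?_, ?_, fun i j hij => hμ (Nat.succ_lt_succ hij),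
    fun s => (Nat.zero_le _).trans_lt (hμ s.lt_succ_self), ?_, ?_⟩
  · exact (Submodule.isClosed_topologicalClosure _).preimage A.symm.continuous
  · intro hfin
    have hmem : ∀ j, A (g j) ∈ Y.comap (A.symm : X →ₗ[ℂ] X) := by
      intro j
      change A.symm (A (g j)) ∈ Y
      rw [A.symm_apply_apply]
      exact hgY j
    have hli : LinearIndependent ℂ fun j => A (g j) :=
      (hg.linearIndependent hg1).map' (A.toLinearEquiv : X →ₗ[ℂ] X) (LinearEquiv.ker _)
    have hli' : LinearIndependent ℂ
        fun j => (⟨A (g j), hmem j⟩ : Y.comap (A.symm : X →ₗ[ℂ] X)) :=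
      LinearIndependent.of_comp (Submodule.subtype _) hli
    have : Finite ℕ := hli'.finite_of_isNoetherian
    exact not_finite ℕ
  · intro x hx hx0
    by_contra! h
    have hlim := tendsto_sum_range_of_mem_topologicalClosure hrep hbd (x := A.symm x) hx
    simp only [h, zero_smul, Finset.sum_const_zero] at hlim
    have := tendsto_nhds_unique hlim tendsto_const_nhds
    exact hx0 (by simpa using this)
  · intro x hx
    have h := tendsto_apply_sub_sum_range hψ hψg hrep hbd
      (B := fun s => (T ^ μ (s + 1)) ∘L (A : X →L[ℂ] X)) (a := fun s => l ^ μ (s + 1))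
      (fun s => by rw [norm_pow]; exact pow_le_one₀ (norm_nonneg _) hl)
      (q := fun s j => if j = J s then y s else 0) ?_ ?_ (x := A.symm x) hx
    · refine h.congr fun s => ?_
      simp [Finset.sum_ite_eq', Nat.lt_succ_iff.2 (hJ s)]
    · intro s j hsj
      have h1 := hclose (s + 1) j hsj
      have h2 := hgT (s + 1) j hsj
      rw [map_sub] at h1
      change ‖(T ^ μ (s + 1)) (A (g j)) - _‖ ≤ _
      rw [hA]
      calc ‖(T ^ μ (s + 1)) (e j) - l ^ μ (s + 1) • g j‖
          ≤ 2 * (1 / 64 / 2 ^ j) + 1 / 64 / 2 ^ j :=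
            (norm_sub_le_norm_sub_add_norm_sub _ _ _).trans (add_le_add h1 h2)
        _ = 3 / 64 * (1 / 2 ^ j) := by ring
        _ ≤ 1 / 16 * (1 / 2 ^ j) :=
            mul_le_mul_of_nonneg_right (by norm_num) (by positivity)
        _ = 1 / 16 / 2 ^ j := by ring
    · intro s j hjs
      change ‖(T ^ μ (s + 1)) (A (g j)) - _‖ ≤ _
      rw [hA]
      refine (hq s j hjs).trans (le_of_eq ?_)
      ring

lemma exists_hypercyclic_subspace_of_isEssentialApproxEigenvalue
    [TopologicalSpace.SeparableSpace X] {T : X →L[ℂ] X}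
    (hwm : ∃ z : X × X, DenseRange fun n : ℕ => ((T ^ n) z.1, (T ^ n) z.2)) {l : ℂ}
    (hl : ‖l‖ ≤ 1) (hT : IsEssentialApproxEigenvalue T l) :
    ∃ M : Submodule ℂ X, IsClosed (M : Set X) ∧ ¬ Module.Finite ℂ M ∧
      ∀ x ∈ M, x ≠ 0 → DenseRange fun n : ℕ => (T ^ n) x := by
  obtain ⟨M, ν, φ, hMc, hM, -, -, hφ, hlim⟩ := exists_subspace_tendsto_sub_smul hwm hl hT
    (J := fun s => s.unpair.1.unpair.1)
    (fun s => (Nat.unpair_left_le _).trans (Nat.unpair_left_le _))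
    (fun s => TopologicalSpace.denseSeq X s.unpair.1.unpair.2)
  refine ⟨M, hMc, hM, fun x hx hx0 => ?_⟩
  obtain ⟨j, hj⟩ := hφ x hx hx0
  have hD : DenseRange fun k => φ j x • TopologicalSpace.denseSeq X k :=
    ((Homeomorph.smulOfNeZero (α := X) _ hj).surjective.denseRange).comp
      (TopologicalSpace.denseRange_denseSeq X) (continuous_const_smul _)
  refine dense_closure.1 (Dense.mono ?_ hD)
  rintro _ ⟨k, rfl⟩
  have hpair : StrictMono fun b => Nat.pair (Nat.pair j k) b := fun a b hab =>
    Nat.pair_lt_pair_right _ hab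
  have h := ((hlim x hx).comp hpair.tendsto_atTop).add_const
    (φ j x • TopologicalSpace.denseSeq X k)
  refine mem_closure_of_tendsto (f := fun b => (T ^ ν (Nat.pair (Nat.pair j k) b)) x)
    (b := atTop) ?_ (Eventually.of_forall fun b => ⟨_, rfl⟩)
  simpa [Function.comp_def] using h

lemma exists_subspace_tendsto_zero_of_isEssentialApproxEigenvalue {T : X →L[ℂ] X}
    (hwm : ∃ z : X × X, DenseRange fun n : ℕ => ((T ^ n) z.1, (T ^ n) z.2)) {l : ℂ}
    (hl : ‖l‖ ≤ 1) (hT : IsEssentialApproxEigenvalue T l) :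
    ∃ n : ℕ → ℕ, StrictMono n ∧ (∀ k, 0 < n k) ∧
      ∃ M : Submodule ℂ X, IsClosed (M : Set X) ∧ ¬ Module.Finite ℂ M ∧
        ∀ x ∈ M, Tendsto (fun k : ℕ => (T ^ n k) x) atTop (𝓝 0) := by
  obtain ⟨M, ν, φ, hMc, hM, hν, hν0, -, hlim⟩ := exists_subspace_tendsto_sub_smul hwm hl hT
    (J := fun _ => 0) (fun s => Nat.zero_le s) (fun _ => 0)
  exact ⟨ν, hν, hν0, M, hMc, hM, fun x hx => by simpa using hlim x hx⟩

/-- A sequence of operators converging pointwise to zero on a closed subspace is uniformly bounded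
there. -/
lemma exists_bound_of_tendsto_zero {B : ℕ → X →L[ℂ] X} {M : Submodule ℂ X}
    (hM : IsClosed (M : Set X)) (h : ∀ x ∈ M, Tendsto (fun k => B k x) atTop (𝓝 0)) :
    ∃ C : ℝ, ∀ k : ℕ, ∀ x ∈ M, ‖B k x‖ ≤ C * ‖x‖ := by
  have : CompleteSpace M := hM.completeSpace_coe
  obtain ⟨C, hC⟩ := banach_steinhaus (g := fun k => B k ∘L M.subtypeL) fun x => by
    obtain ⟨C, hC⟩ := (h x x.2).norm.bddAbove_range
    exact ⟨C, fun k => hC ⟨k, rfl⟩⟩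
  exact ⟨C, fun k x hx => (B k ∘L M.subtypeL).le_of_opNorm_le (hC k) ⟨x, hx⟩⟩

end Main

/-- **Theorem (González–León–Montes).** Let `X` be a separable complex Banach space and `T` a
weakly mixing continuous linear operator on `X`. The following are equivalent:
(1) `T` has a hypercyclic subspace;
(2) there exist an increasing sequence `(n k)` of positive integers and an infinite-dimensional
closed subspace `M₀` of `X` such that `T ^ (n k) x → 0` for all `x ∈ M₀`;
(3) there exist an increasing sequence `(n k)` of positive integers and an infinite-dimensional
closed subspace `M_b` of `X` such that `sup_k ‖T ^ (n k)|_{M_b}‖ < ∞`. -/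
theorem hypercyclic_subspace_tfae_of_weaklyMixing
    {X : Type*} [NormedAddCommGroup X] [NormedSpace ℂ X] [CompleteSpace X]
    [TopologicalSpace.SeparableSpace X]
    (T : X →L[ℂ] X)
    (hwm : ∃ z : X × X, DenseRange fun n : ℕ => ((T ^ n) z.1, (T ^ n) z.2)) :
    List.TFAE
      [ -- (1) T has a hypercyclic subspace
        ∃ M : Submodule ℂ X, IsClosed (M : Set X) ∧ ¬ Module.Finite ℂ ↥M ∧
          ∀ x ∈ M, x ≠ 0 → DenseRange fun n : ℕ => (T ^ n) x,
        -- (2) along some increasing sequence, T ^ (n k) → 0 pointwise on an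
        -- infinite-dimensional closed subspace M₀
        ∃ n : ℕ → ℕ, StrictMono n ∧ (∀ k, 0 < n k) ∧
          ∃ M₀ : Submodule ℂ X, IsClosed (M₀ : Set X) ∧ ¬ Module.Finite ℂ ↥M₀ ∧
            ∀ x ∈ M₀, Tendsto (fun k : ℕ => (T ^ (n k)) x) atTop (𝓝 0),
        -- (3) along some increasing sequence, the restrictions T ^ (n k)|_{M_b} are
        -- uniformly bounded in operator norm on an infinite-dimensional closed subspace M_b
        ∃ n : ℕ → ℕ, StrictMono n ∧ (∀ k, 0 < n k) ∧
          ∃ Mb : Submodule ℂ X, IsClosed (Mb : Set X) ∧ ¬ Module.Finite ℂ ↥Mb ∧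
            ∃ C : ℝ, ∀ k : ℕ, ∀ x ∈ Mb, ‖(T ^ (n k)) x‖ ≤ C * ‖x‖ ] := by
  tfae_have 1 → 2 := by
    rintro ⟨M, hMc, hM, h⟩
    obtain ⟨l, hl, hT⟩ := exists_isEssentialApproxEigenvalue_of_hypercyclic_subspace hMc hM h
    exact exists_subspace_tendsto_zero_of_isEssentialApproxEigenvalue hwm hl hT
  tfae_have 2 → 3 := by
    rintro ⟨n, hn, hn0, M, hMc, hM, h⟩
    exact ⟨n, hn, hn0, M, hMc, hM, exists_bound_of_tendsto_zero (B := fun k => T ^ n k) hMc h⟩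
  tfae_have 3 → 1 := by
    rintro ⟨n, hn, -, M, -, hM, C, hC⟩
    obtain ⟨l, hl, hT⟩ := exists_isEssentialApproxEigenvalue_of_bounded hn hM hC
    exact exists_hypercyclic_subspace_of_isEssentialApproxEigenvalue hwm hl hT
  tfae_finish
end
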